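/- (No single jump occurs.) Let L be any 3-dimensional subspace of the quadratic forms in k[x₀,x₁,x₂,x₃]. If K(L) ≠ 0, i.e. some nonzero homogeneous cubic C ∈ k[y₀,…,y₆] satisfies C(q₀,…,q₆) = 0 for a basis q₀,…,q₆ of L^⊥, then in fact dim_k K(L) ≥ 3. -/

import Mathlib

open MvPolynomial

noncomputable section

variable {k : Type} [Field k]

/-- The constant-coefficient differential operator `∂^m` on `k[x₀,x₁,x₂,x₃]`
associated to a monomial exponent vector `m`. -/
noncomputable def monD (k : Type) [Field k] (m : Fin 4 →₀ ℕ) :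
    Module.End k (MvPolynomial (Fin 4) k) :=
  ((pderiv (0 : Fin 4)).toLinearMap) ^ (m 0) * ((pderiv 1).toLinearMap) ^ (m 1) *
    ((pderiv 2).toLinearMap) ^ (m 2) * ((pderiv 3).toLinearMap) ^ (m 3)

/-- The apolarity action `f(∂)(g)` of a polynomial `f` (viewed as a constant
coefficient differential operator) on a polynomial `g`. -/
noncomputable def diffOp (f g : MvPolynomial (Fin 4) k) : MvPolynomial (Fin 4) k :=
  ∑ m ∈ f.support, (coeff m f) • (monD k m g)

/-- The apolar perpendicular of a space `L` of quadratic forms: all quadratic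
forms `q` with `⟨q, f⟩ = q(∂)(f) = 0` for all `f ∈ L`. -/
def perpSet (L : Submodule k (MvPolynomial (Fin 4) k)) : Set (MvPolynomial (Fin 4) k) :=
  {q | q.IsHomogeneous 2 ∧ ∀ f ∈ L, diffOp q f = 0}

/-- `q : Fin 7 → k[x]₂` is a basis of `L^⊥`. -/
def IsPerpBasis (L : Submodule k (MvPolynomial (Fin 4) k))
    (q : Fin 7 → MvPolynomial (Fin 4) k) : Prop :=
  LinearIndependent k q ∧
    (Submodule.span k (Set.range q) : Set (MvPolynomial (Fin 4) k)) = perpSet L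

/-- `K(L)`: the space of homogeneous cubics `C ∈ k[y₀,…,y₆]` with `C(q₀,…,q₆) = 0`,
for a basis `q₀,…,q₆` of `L^⊥`; i.e. cubic hypersurfaces through the projected
Veronese `X_L`. -/
noncomputable def cubicRelations (q : Fin 7 → MvPolynomial (Fin 4) k) :
    Submodule k (MvPolynomial (Fin 7) k) :=
  (homogeneousSubmodule (Fin 7) k 3) ⊓ LinearMap.ker (aeval q).toLinearMap

/-- The symmetric Gram matrix of a quadratic form (characteristic ≠ 2). -/
def gram (q : MvPolynomial (Fin 4) k) : Matrix (Fin 4) (Fin 4) k :=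
  Matrix.of fun i j =>
    if i = j then coeff (Finsupp.single i 2) q
    else coeff (Finsupp.single i 1 + Finsupp.single j 1) q / 2

/-- The directional derivative `D_v = Σᵢ vᵢ ∂/∂xᵢ`. -/
noncomputable def dirDeriv (v : Fin 4 → k) (F : MvPolynomial (Fin 4) k) :
    MvPolynomial (Fin 4) k :=
  ∑ i, v i • pderiv i F


lemma nsj_single_mulVec {D : Type*} [CommRing D] {n : Type*} [Fintype n] [DecidableEq n]
    (i j : n) (c : D) (x : n → D) :
    (Matrix.single i j c).mulVec x = Pi.single i (c * x j) := by
  ext l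
  simp only [Matrix.mulVec, dotProduct, Matrix.single_apply, Pi.single_apply]
  by_cases h : l = i
  · subst h; simp
  · simp [h, Ne.symm h]

/-- three independent kernel vectors over a domain -/
lemma nsj_three {D : Type*} [CommRing D] [IsDomain D] {n : Type*} [Fintype n] [DecidableEq n] [hne : Nonempty n]
    (T : Matrix n n D)
    (h : ∀ (c d : D) (i j i' j' : n), (T + Matrix.single i j c + Matrix.single i' j' d).det = 0) :
    ∃ (v w u : n → D) (j j' j'' : n), T.mulVec v = 0 ∧ T.mulVec w = 0 ∧ T.mulVec u = 0 ∧
      v j ≠ 0 ∧ w j = 0 ∧ w j' ≠ 0 ∧ u j = 0 ∧ u j' = 0 ∧ u j'' ≠ 0 := by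
  obtain ⟨n0⟩ := hne
  have h0 : T.det = 0 := by simpa using h 0 0 n0 n0 n0 n0
  have h1 : ∀ i j, (T + Matrix.single i j 1).det = 0 := fun i j => by
    simpa using h 1 0 i j n0 n0
  obtain ⟨v, hv, hTv⟩ := Matrix.exists_mulVec_eq_zero_iff.2 h0
  obtain ⟨ξ, hξ, hTξ⟩ := Matrix.exists_vecMul_eq_zero_iff.2 h0
  obtain ⟨j, hj⟩ := Function.ne_iff.1 hv
  obtain ⟨i, hi⟩ := Function.ne_iff.1 hξ
  simp only [Pi.zero_apply] at hi hj
  have key : ∀ ζ x : n → D, Matrix.vecMul ζ T = 0 → dotProduct ζ (T.mulVec x) = 0 := by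
    intro ζ x hz
    rw [Matrix.dotProduct_mulVec, hz, zero_dotProduct]
  have key2 : ∀ ζ x : n → D, T.mulVec x = 0 → dotProduct (Matrix.vecMul ζ T) x = 0 := by
    intro ζ x hz
    rw [← Matrix.dotProduct_mulVec, hz, dotProduct_zero]
  obtain ⟨w, hw, hTw⟩ := Matrix.exists_mulVec_eq_zero_iff.2 (h1 i j)
  rw [Matrix.add_mulVec, nsj_single_mulVec] at hTw
  have hwj : w j = 0 := by
    have := congrArg (dotProduct ξ) hTw
    rw [dotProduct_add, key _ _ hTξ] at this
    simpa [hi] using this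
  have hTw' : T.mulVec w = 0 := by simpa [hwj] using hTw
  obtain ⟨η, hη, hTη⟩ := Matrix.exists_vecMul_eq_zero_iff.2 (h1 i j)
  have hη2 : Matrix.vecMul η (Matrix.single i j 1) = Pi.single j (η i) := by
    ext l
    simp only [Matrix.vecMul, dotProduct, Matrix.single_apply, Pi.single_apply]
    by_cases h : l = j
    · subst h; simp
    · simp [h, Ne.symm h]
  rw [Matrix.vecMul_add, hη2] at hTη
  have hηi : η i = 0 := by
    have := congrArg (fun t => dotProduct t v) hTη
    simp only [add_dotProduct] at this
    rw [key2 _ _ hTv] at this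
    simpa [hj] using this
  have hTη' : Matrix.vecMul η T = 0 := by simpa [hηi] using hTη
  obtain ⟨j', hj'⟩ := Function.ne_iff.1 hw
  obtain ⟨i', hi'⟩ := Function.ne_iff.1 hη
  simp only [Pi.zero_apply] at hi' hj'
  obtain ⟨u, hu, hTu⟩ := Matrix.exists_mulVec_eq_zero_iff.2 (h 1 1 i j i' j')
  rw [Matrix.add_mulVec, Matrix.add_mulVec, nsj_single_mulVec, nsj_single_mulVec] at hTu
  have huj' : u j' = 0 := by
    have := congrArg (dotProduct η) hTu
    rw [dotProduct_add, dotProduct_add, key _ _ hTη'] at this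
    simpa [hi', hηi] using this
  have huj : u j = 0 := by
    have := congrArg (dotProduct ξ) hTu
    rw [dotProduct_add, dotProduct_add, key _ _ hTξ] at this
    simpa [hi, huj'] using this
  obtain ⟨j'', hj''⟩ := Function.ne_iff.1 hu
  exact ⟨v, w, u, j, j', j'', hTv, hTw', by simpa [huj, huj'] using hTu, hj, hwj, hj', huj, huj', hj''⟩

lemma nsj_cube0 {R : Type*} [CommRing R] [IsDomain R] {n : Type*} [Fintype n] [DecidableEq n]
    [Nonempty n]
    (T : Matrix n n R) (p : R) (hp : Prime p)
    (h : ∀ (c d : R) (i j i' j' : n), p ∣ (T + Matrix.single i j c + Matrix.single i' j' d).det) :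
    p ^ 3 ∣ T.det := by
  set I := Ideal.span {p} with hI
  have _ : I.IsPrime := (Ideal.span_singleton_prime hp.ne_zero).2 hp
  let π := Ideal.Quotient.mk I
  have hπ : ∀ x, π x = 0 ↔ p ∣ x := fun x => by
    rw [Ideal.Quotient.eq_zero_iff_mem, hI, Ideal.mem_span_singleton]
  have hs : Function.Surjective π := Ideal.Quotient.mk_surjective
  obtain ⟨v, w, u, j, j', j'', hv, hw, hu, h1, h2, h3, h4, h5, h6⟩ :=
    nsj_three (T.map π) (by
      intro c d i j i' j'
      obtain ⟨c, rfl⟩ := hs c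
      obtain ⟨d, rfl⟩ := hs d
      have := (hπ _).2 (h c d i j i' j')
      rw [RingHom.map_det] at this
      convert this using 2
      ext a b
      simp [Matrix.single_apply, apply_ite π])
  have lift : ∀ f : n → R ⧸ I, ∃ g : n → R, ∀ i, π (g i) = f i := fun f =>
    ⟨fun i => (hs (f i)).choose, fun i => (hs (f i)).choose_spec⟩
  obtain ⟨v, hv'⟩ := lift v
  obtain ⟨w, hw'⟩ := lift w
  obtain ⟨u, hu'⟩ := lift u
  have hjj' : j' ≠ j := by rintro rfl; exact h3 h2
  have hjj'' : j'' ≠ j := by rintro rfl; exact h6 h4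
  have hj'j'' : j'' ≠ j' := by rintro rfl; exact h6 h5
  let P : Matrix n n R := Matrix.of fun a b =>
    if b = j then v a else if b = j' then w a else if b = j'' then u a else if a = b then 1 else 0
  have hP : ¬ p ∣ P.det := by
    rw [← hπ, RingHom.map_det]
    intro h0
    obtain ⟨x, hx, hPx⟩ := Matrix.exists_mulVec_eq_zero_iff.2 h0
    apply hx
    have row : ∀ a, ∑ b, π (P a b) * x b = 0 := fun a => by
      simpa [Matrix.mulVec, dotProduct] using congrFun hPx a
    have e : ∀ a, ∑ b, π (P a b) * x b = π (v a) * x j + π (w a) * x j' + π (u a) * x j''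
        + (if a = j ∨ a = j' ∨ a = j'' then 0 else x a) := by
      intro a
      have : ∀ b, π (P a b) * x b = (if b = j then π (v a) * x b else 0) +
          (if b = j' then π (w a) * x b else 0) + (if b = j'' then π (u a) * x b else 0) +
          (if b = a then (if a = j ∨ a = j' ∨ a = j'' then 0 else x a) else 0) := by
        intro b
        simp only [P, Matrix.of_apply]
        by_cases b1 : b = j
        · subst b1
          simp only [if_true, hjj'.symm, hjj''.symm, if_false]
          split_ifs <;> simp_all
        by_cases b2 : b = j'
        · subst b2
          simp only [if_true, b1, hj'j''.symm, if_false]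
          split_ifs <;> simp_all
        by_cases b3 : b = j''
        · subst b3
          simp only [if_true, b1, b2, if_false]
          split_ifs <;> simp_all
        simp only [b1, b2, b3, if_false]
        by_cases b4 : a = b
        · subst b4; simp [b1, b2, b3]
        · simp [b4, Ne.symm b4]
      rw [Finset.sum_congr rfl (fun b _ => this b)]
      simp [Finset.sum_add_distrib]
    have r1 := row j
    rw [e] at r1
    simp only [hv', hw', hu', h2, h4, true_or, if_true] at r1
    have xj : x j = 0 := by simpa [h1] using r1
    have r2 := row j'
    rw [e] at r2
    simp only [hv', hw', hu', h5, xj, true_or, or_true, if_true] at r2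
    have xj' : x j' = 0 := by simpa [h3] using r2
    have r3 := row j''
    rw [e] at r3
    simp only [hv', hw', hu', xj, xj', or_true, if_true] at r3
    have xj'' : x j'' = 0 := by simpa [h6] using r3
    ext a
    have r := row a
    rw [e] at r
    simp only [xj, xj', xj'', mul_zero, zero_add] at r
    split_ifs at r with hc
    · rcases hc with rfl | rfl | rfl <;> assumption
    · exact r
  let d : n → R := fun b => if b = j ∨ b = j' ∨ b = j'' then p else 1
  have hd : ∏ b, d b = p ^ 3 := by
    have : (Finset.univ.filter fun b => b = j ∨ b = j' ∨ b = j'') = {j, j', j''} := by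
      ext; simp
    simp only [d]
    rw [Finset.prod_ite, this]
    simp only [Finset.prod_const, one_pow, mul_one]
    congr 1
    rw [Finset.card_eq_three]
    exact ⟨j, j', j'', hjj'.symm, hjj''.symm, hj'j''.symm, rfl⟩
  have hcol : ∀ a b, ∃ q, (T * P) a b = q * d b := by
    intro a b
    have gen : ∀ f : n → R, (∀ g, (T.map π).mulVec g = 0 → (∀ i, π (f i) = g i) →
        p ∣ ∑ l, T a l * f l) := by
      intro f g hg hf
      rw [← hπ, map_sum]
      have := congrFun hg a
      simpa [Matrix.mulVec, dotProduct, hf] using this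
    by_cases b1 : b = j
    · obtain ⟨q, hq⟩ := gen v _ hv hv'
      exact ⟨q, by simp [Matrix.mul_apply, P, d, b1, hq, mul_comm]⟩
    by_cases b2 : b = j'
    · obtain ⟨q, hq⟩ := gen w _ hw hw'
      exact ⟨q, by simp [Matrix.mul_apply, P, d, b2, hjj', hq, mul_comm]⟩
    by_cases b3 : b = j''
    · obtain ⟨q, hq⟩ := gen u _ hu hu'
      exact ⟨q, by simp [Matrix.mul_apply, P, d, b3, hjj'', hj'j'', hq, mul_comm]⟩
    · exact ⟨(T * P) a b, by simp [d, b1, b2, b3]⟩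
  choose Q hQ using hcol
  have hTP : T * P = Matrix.of Q * Matrix.diagonal d := by
    ext a b
    rw [Matrix.mul_diagonal, hQ]; rfl
  have hdet : T.det * P.det = (Matrix.of Q).det * p ^ 3 := by
    rw [← Matrix.det_mul, hTP, Matrix.det_mul, Matrix.det_diagonal, hd]
  have := Dvd.intro_left _ hdet.symm
  exact hp.pow_dvd_of_dvd_mul_right 3 hP this

lemma nsj_cube {k : Type} [Field k] [IsAlgClosed k] {τ : Type} [Finite τ] {n : Type*} [Fintype n]
    [DecidableEq n] [Nonempty n] (T : Matrix n n (MvPolynomial τ k)) (p : MvPolynomial τ k) (hp : Prime p)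
    (hV : ∀ z : τ → k, eval z p = 0 → ∀ j j' : n, ∃ x : n → k, x ≠ 0 ∧ x j = 0 ∧ x j' = 0 ∧
      (T.map (eval z)).mulVec x = 0) : p ^ 3 ∣ T.det := by
  apply nsj_cube0 T p hp
  intro c d i j i' j'
  set g := (T + Matrix.single i j c + Matrix.single i' j' d).det with hg
  have hprime : (Ideal.span {p}).IsPrime := (Ideal.span_singleton_prime hp.ne_zero).2 hp
  have : g ∈ vanishingIdeal k (zeroLocus k (Ideal.span {p})) := by
    rw [mem_vanishingIdeal_iff]
    intro z hz
    have hz' := (mem_zeroLocus_iff.1 hz) p (Ideal.mem_span_singleton_self p)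
    rw [aeval_eq_eval] at hz' ⊢
    obtain ⟨x, hx, h1, h2, h3⟩ := hV z hz' j j'
    change eval z g = 0
    rw [hg, RingHom.map_det]
    apply Matrix.exists_mulVec_eq_zero_iff.1
    refine ⟨x, hx, ?_⟩
    have e : (eval z).mapMatrix (T + Matrix.single i j c + Matrix.single i' j' d) =
      T.map (eval z) + Matrix.single i j (eval z c) + Matrix.single i' j' (eval z d) := by
      ext a b
      simp [Matrix.single_apply, apply_ite (eval z)]
    rw [e, Matrix.add_mulVec, Matrix.add_mulVec, nsj_single_mulVec, nsj_single_mulVec, h1, h2, h3]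
    simp
  rw [vanishingIdeal_zeroLocus_eq_radical, hprime.radical] at this
  exact Ideal.mem_span_singleton.1 this

lemma nsj_rad_cube {R : Type*} [CommRing R] [IsDomain R] [UniqueFactorizationMonoid R]
    (F μ : R) (hF : F ≠ 0) (h : ∀ p, Prime p → p ∣ F → p ^ 3 ∣ μ) :
    ∃ r, r ^ 3 ∣ μ ∧ r ∣ F ∧ ∃ n, F ∣ r ^ n := by
  classical
  let _ : StrongNormalizationMonoid R := UniqueFactorizationMonoid.strongNormalizationMonoid
  refine ⟨UniqueFactorizationMonoid.radical F, ?_, UniqueFactorizationMonoid.radical_dvd_self,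
    UniqueFactorizationMonoid.exists_dvd_radical_self_pow hF⟩
  rw [UniqueFactorizationMonoid.radical, ← Finset.prod_pow]
  apply Finset.prod_dvd_of_isRelPrime
  · intro a ha b hb hab
    rw [Finset.mem_coe, UniqueFactorizationMonoid.mem_primeFactors] at ha hb
    apply IsRelPrime.pow
    have pa := UniqueFactorizationMonoid.prime_of_normalized_factor _ ha
    have pb := UniqueFactorizationMonoid.prime_of_normalized_factor _ hb
    change IsRelPrime a b
    rw [pa.irreducible.isRelPrime_iff_not_dvd]
    intro hd
    apply hab
    have := pa.associated_of_dvd pb hd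
    have h1 := UniqueFactorizationMonoid.normalize_normalized_factor _ ha
    have h2 := UniqueFactorizationMonoid.normalize_normalized_factor _ hb
    exact (h1.symm.trans (normalize_eq_normalize this.dvd this.symm.dvd)).trans h2
  · intro a ha
    rw [UniqueFactorizationMonoid.mem_primeFactors] at ha
    exact h a (UniqueFactorizationMonoid.prime_of_normalized_factor _ ha)
      (UniqueFactorizationMonoid.dvd_of_mem_normalizedFactors ha)

lemma nsj_finrank_hom (k : Type) [Field k] (σ : Type) [Fintype σ] (d : ℕ) :
    Module.finrank k (homogeneousSubmodule σ k d) = (Fintype.card σ).multichoose d := by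
  classical
  rw [homogeneousSubmodule_eq_finsupp_supported]
  rw [LinearEquiv.finrank_eq (AddMonoidAlgebra.supportedEquivFinsupp (R := k) (S := k)
    {s : σ →₀ ℕ | s.degree = d})]
  have e : {s : σ →₀ ℕ | s.degree = d} ≃ Sym σ d := by
    refine Equiv.trans (Equiv.subtypeEquivRight ?_) (Sym.equivNatSum σ d).symm
    intro s
    exact Iff.rfl
  let _ : Fintype {s : σ →₀ ℕ | s.degree = d} := Fintype.ofEquiv _ e.symm
  rw [Module.finrank_finsupp_self, Fintype.card_congr e, Sym.card_sym_eq_multichoose]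

instance nsj_finite_hom (k : Type) [Field k] (σ : Type) [Finite σ] (d : ℕ) :
    Module.Finite k (homogeneousSubmodule σ k d) :=
  Module.Finite.iff_fg.2 (homogeneousSubmodule_fg σ k d)

abbrev NY := Sym2 (Fin 4)


/-- derivative in the constant direction `m` -/
def nD (m : NY → k) : Derivation k (MvPolynomial NY k) (MvPolynomial NY k) :=
  mkDerivation k (fun s => C (m s))

lemma nD_eq (m : NY → k) (p : MvPolynomial NY k) : nD m p = ∑ s, m s • pderiv s p := by
  have : nD m = ∑ s, m s • (pderiv s : Derivation k (MvPolynomial NY k) (MvPolynomial NY k)) := by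
    apply MvPolynomial.derivation_ext
    intro i
    rw [nD, mkDerivation_X]
    rw [← Derivation.coeFnAddMonoidHom_apply, map_sum]
    simp only [Finset.sum_apply, Derivation.coeFnAddMonoidHom_apply, Derivation.smul_apply,
      pderiv_X, Pi.single_apply, smul_ite, smul_zero]
    simp [MvPolynomial.smul_eq_C_mul]
  rw [this, ← Derivation.coeFnAddMonoidHom_apply, map_sum]
  simp

lemma nsj_chain {B : Type*} [CommRing B] [Algebra k B] (m : NY → k) (g : B)
    (f : NY → Polynomial B) (hf : ∀ s, Polynomial.derivative (f s) = Polynomial.C (g * algebraMap k B (m s)))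
    (p : MvPolynomial NY k) :
    Polynomial.derivative (aeval f p) = Polynomial.C g * aeval f (nD m p) := by
  induction p using MvPolynomial.induction_on with
  | C a =>
    rw [aeval_C, show nD m (C a) = 0 from Derivation.map_algebraMap _ a,
      IsScalarTower.algebraMap_apply k B (Polynomial B)]
    simp
  | add p q hp hq => simp [hp, hq, mul_add]
  | mul_X p i hp =>
    have h : nD m (X i : MvPolynomial NY k) = C (m i) := mkDerivation_X _ _ _
    rw [map_mul, Polynomial.derivative_mul, hp, Derivation.leibniz, h, aeval_X, hf]
    simp only [smul_eq_mul, map_add, map_mul, aeval_X, aeval_C]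
    rw [IsScalarTower.algebraMap_apply k B (Polynomial B)]
    simp only [Polynomial.algebraMap_eq]
    ring

lemma nsj_transl1 {B : Type*} [CommRing B] [Algebra k B] (h2 : (2 : k) ≠ 0) (h3 : (3 : k) ≠ 0)
    (m : NY → k) (p : MvPolynomial NY k) (d : ℕ) (hd : d ≤ 3) (hp : p.IsHomogeneous d) (hD : nD m p = 0)
    (y : NY → B) (g : B) :
    aeval (fun s => y s + g * algebraMap k B (m s)) p = aeval y p := by
  set f : NY → Polynomial B := fun s => Polynomial.C (y s) + Polynomial.X * Polynomial.C (g * algebraMap k B (m s))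
    with hf
  have hder : Polynomial.derivative (aeval f p) = 0 := by
    rw [nsj_chain m g f (by intro s; simp [hf]) p, hD]; simp
  have hdeg : (aeval f p).natDegree ≤ 3 := by
    have e : aeval f p = aeval f (MvPolynomial.map (algebraMap k B) p) := by
      rw [MvPolynomial.aeval_map_algebraMap]
    rw [e]
    have := MvPolynomial.aeval_natDegree_le (m := 3) (n := 1) (MvPolynomial.map (algebraMap k B) p)
      ((hp.map _).totalDegree_le.trans hd) f (by
        intro i
        simp only [hf]
        compute_degree)
    simpa using this
  have hu : ∀ n : ℕ, 1 ≤ n → n ≤ 3 → ∀ b : B, b * (n : B) = 0 → b = 0 := by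
    intro n h1 h3' b hb
    have hn : (n : k) ≠ 0 := by
      interval_cases n <;> simp_all
    have : IsUnit (n : B) := by
      have := (IsUnit.mk0 _ hn).map (algebraMap k B)
      simpa using this
    exact (this.mul_left_eq_zero).1 hb
  have hc : ∀ n, 1 ≤ n → (aeval f p).coeff n = 0 := by
    intro n hn
    by_cases hn3 : n ≤ 3
    · apply hu n hn hn3
      have := congrArg (fun q => Polynomial.coeff q (n - 1)) hder
      simp only [Polynomial.coeff_derivative, Polynomial.coeff_zero] at this
      have e : n - 1 + 1 = n := by omega
      rw [e] at this
      rw [← this]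
      congr 1
      exact_mod_cast (congrArg (Nat.cast : ℕ → B) e).symm
    · exact Polynomial.coeff_eq_zero_of_natDegree_lt (by omega)
  have hconst : aeval f p = Polynomial.C ((aeval f p).coeff 0) := by
    ext n
    rcases Nat.eq_zero_or_pos n with rfl | h
    · simp
    · rw [hc n h, Polynomial.coeff_C, if_neg (by omega)]
  have ev : ∀ t : B, Polynomial.eval t (aeval f p) = aeval (fun s => y s + t * (g * algebraMap k B (m s))) p := by
    intro t
    have : Polynomial.eval t (aeval f p) = ((Polynomial.aeval t).restrictScalars k : Polynomial B →ₐ[k] B) (aeval f p) := by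
      simp [Polynomial.aeval_def, Polynomial.eval₂_eq_eval_map]
    rw [this, ← AlgHom.comp_apply, MvPolynomial.comp_aeval]
    congr 1
    congr 1
    funext s
    simp [hf]
  have e1 := ev 1
  have e0 := ev 0
  rw [hconst] at e1 e0
  simp only [Polynomial.eval_C, one_mul, zero_mul, add_zero] at e1 e0
  rw [← e1, ← e0]

lemma nsj_transl {B : Type*} [CommRing B] [Algebra k B] (h2 : (2 : k) ≠ 0) (h3 : (3 : k) ≠ 0)
    {ι : Type*} (t : Finset ι)
    (m : ι → NY → k) (p : MvPolynomial NY k) (d : ℕ) (hd : d ≤ 3) (hp : p.IsHomogeneous d)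
    (hD : ∀ i ∈ t, nD (m i) p = 0)
    (y : NY → B) (g : ι → B) :
    aeval (fun s => y s + ∑ i ∈ t, g i * algebraMap k B (m i s)) p = aeval y p := by
  classical
  induction t using Finset.induction_on with
  | empty => simp
  | insert a t ha ih =>
    refine Eq.trans ?_ (ih (fun i hi => hD i (Finset.mem_insert_of_mem hi)))
    refine Eq.trans ?_ (nsj_transl1 h2 h3 (m a) p d hd hp (hD a (Finset.mem_insert_self _ _)) _ (g a))
    congr 2
    funext s
    rw [Finset.sum_insert ha]; ring

def nver (k : Type) [Field k] : NY → MvPolynomial (Fin 4) k :=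
  Sym2.lift ⟨fun i j => X i * X j, fun _ _ => mul_comm _ _⟩

def nKp (z : Fin 3 → NY → k) : Submodule k (MvPolynomial NY k) :=
  homogeneousSubmodule NY k 3 ⊓ LinearMap.ker (aeval (nver k)).toLinearMap ⊓
    ⨅ i, LinearMap.ker (nD (z i)).toLinearMap

lemma mem_nKp (z : Fin 3 → NY → k) (p : MvPolynomial NY k) :
    p ∈ nKp z ↔ p.IsHomogeneous 3 ∧ aeval (nver k) p = 0 ∧ ∀ i, nD (z i) p = 0 := by
  simp [nKp, Submodule.mem_iInf, and_assoc]

instance nsj_finite_nKp (z : Fin 3 → NY → k) : Module.Finite k (nKp z) :=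
  Submodule.finiteDimensional_of_le (S₂ := homogeneousSubmodule NY k 3)
    (inf_le_left.trans inf_le_left)

instance nsj_finite_cub (q : Fin 7 → MvPolynomial (Fin 4) k) : Module.Finite k (cubicRelations q) :=
  Submodule.finiteDimensional_of_le (S₂ := homogeneousSubmodule (Fin 7) k 3) inf_le_left

lemma nver_hom (s : NY) : (nver k s).IsHomogeneous 2 := by
  induction s using Sym2.ind with
  | _ i j =>
    change (X i * X j : MvPolynomial (Fin 4) k).IsHomogeneous (1 + 1)
    exact (isHomogeneous_X _ _).mul (isHomogeneous_X _ _)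

lemma nsj_card_NY : Fintype.card NY = 10 := by decide

lemma nsj_dual (z : Fin 3 → NY → k) (hz : LinearIndependent k z) (a : Fin 7 → NY → k)
    (ha : LinearIndependent k a) (haz : ∀ i j, ∑ s, a i s * z j s = 0) :
    ∃ (m : Fin 7 → NY → k) (b : Fin 3 → NY → k),
      (∀ i i', ∑ s, a i s * m i' s = if i = i' then 1 else 0) ∧
      ∀ s t, (∑ i, m i s * a i t) + ∑ j, b j t * z j s = if s = t then 1 else 0 := by
  classical
  let α : (NY → k) →ₗ[k] (Fin 7 → k) := (Matrix.of a).mulVecLin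
  have hα : ∀ y i, α y i = ∑ s, a i s * y s := fun y i => rfl
  have hr : Module.finrank k (LinearMap.range α) = 7 := by
    have : (Matrix.of a).rank = Fintype.card (Fin 7) := LinearIndependent.rank_matrix (M := Matrix.of a) ha
    simpa [Matrix.rank] using this
  have hsurj : LinearMap.range α = ⊤ := by
    apply Submodule.eq_top_of_finrank_eq
    simp [hr]
  obtain ⟨β, hβ⟩ := α.exists_rightInverse_of_surjective hsurj
  have hker : Module.finrank k (LinearMap.ker α) = 3 := by
    have := LinearMap.finrank_range_add_finrank_ker α
    rw [hr, Module.finrank_fintype_fun_eq_card, nsj_card_NY] at this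
    omega
  have hle : Submodule.span k (Set.range z) ≤ LinearMap.ker α := by
    rw [Submodule.span_le]
    rintro _ ⟨j, rfl⟩
    rw [SetLike.mem_coe, LinearMap.mem_ker]
    ext i
    rw [hα, haz]; rfl
  have heq : Submodule.span k (Set.range z) = LinearMap.ker α := by
    apply Submodule.eq_of_le_of_finrank_eq hle
    rw [hker, finrank_span_eq_card hz]; simp
  have hβ' : ∀ x, α (β x) = x := fun x => by
    have := congrArg (fun f => f x) hβ; simpa using this
  have hmem : ∀ t, ∃ c : Fin 3 → k, ∑ j, c j • z j =
      Pi.single t 1 - ∑ i, a i t • β (Pi.single i 1) := by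
    intro t
    have h : Pi.single t 1 - ∑ i, a i t • β (Pi.single i 1) ∈ LinearMap.ker α := by
      rw [LinearMap.mem_ker]
      ext i
      simp only [map_sub, map_sum, map_smul, hβ']
      simp [hα, Pi.single_apply]
    rw [← heq] at h
    exact (Submodule.mem_span_range_iff_exists_fun k).1 h
  choose c hc using hmem
  refine ⟨fun i => β (Pi.single i 1), fun j t => c t j, ?_, ?_⟩
  · intro i i'
    rw [← hα, hβ']
    simp [Pi.single_apply]
  · intro s t
    have := congrFun (hc t) s
    simp only [Finset.sum_apply, Pi.smul_apply, smul_eq_mul, Pi.sub_apply, Pi.single_apply] at this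
    rw [this]
    simp [mul_comm]

lemma nsj_exists_perp (z : Fin 3 → NY → k) (hz : LinearIndependent k z) :
    ∃ a : Fin 7 → NY → k, LinearIndependent k a ∧ ∀ i j, ∑ s, a i s * z j s = 0 := by
  let α : (NY → k) →ₗ[k] (Fin 3 → k) := (Matrix.of z).mulVecLin
  have hα : ∀ y i, α y i = ∑ s, z i s * y s := fun y i => rfl
  have hr : Module.finrank k (LinearMap.range α) = 3 := by
    have : (Matrix.of z).rank = Fintype.card (Fin 3) := LinearIndependent.rank_matrix (M := Matrix.of z) hz
    simpa [Matrix.rank] using this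
  have hker : Module.finrank k (LinearMap.ker α) = 7 := by
    have := LinearMap.finrank_range_add_finrank_ker α
    rw [hr, Module.finrank_fintype_fun_eq_card, nsj_card_NY] at this
    omega
  let b := Module.finBasisOfFinrankEq k (LinearMap.ker α) hker
  refine ⟨fun i => (b i : NY → k), ?_, ?_⟩
  · have := b.linearIndependent.map' (LinearMap.ker α).subtype (by simp)
    exact this
  · intro i j
    have h := (b i).2
    rw [LinearMap.mem_ker] at h
    have := congrFun h j
    rw [hα] at this
    rw [← Pi.zero_apply (M := fun _ => k) j, ← this]
    exact Finset.sum_congr rfl fun s _ => mul_comm _ _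

def nq (a : Fin 7 → NY → k) : Fin 7 → MvPolynomial (Fin 4) k := fun i => ∑ s, a i s • nver k s

lemma nsj_smulX_hom {σ : Type} [Fintype σ] (a : σ → k) : (∑ s, a s • (X s : MvPolynomial σ k)).IsHomogeneous 1 := by
  rw [← mem_homogeneousSubmodule]
  exact Submodule.sum_mem _ fun s _ => Submodule.smul_mem _ _ (isHomogeneous_X _ _)

lemma nsj_aeval_hom {σ τ : Type} (f : σ → MvPolynomial τ k) (hf : ∀ s, (f s).IsHomogeneous 1)
    {p : MvPolynomial σ k} {d : ℕ} (hp : p.IsHomogeneous d) : (aeval f p).IsHomogeneous d := by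
  have := hp.aeval f hf
  simpa using this

lemma nsj_der_aeval {σ : Type} (D : Derivation k (MvPolynomial NY k) (MvPolynomial NY k))
    (f : σ → MvPolynomial NY k) (hf : ∀ s, D (f s) = 0) (p : MvPolynomial σ k) : D (aeval f p) = 0 := by
  induction p using MvPolynomial.induction_on with
  | C a => rw [aeval_C]; exact D.map_algebraMap a
  | add p q hp hq => rw [map_add, map_add, hp, hq, add_zero]
  | mul_X p i hp => rw [map_mul, aeval_X, Derivation.leibniz, hp, hf]; simp

lemma nsj_iso (h2 : (2 : k) ≠ 0) (h3 : (3 : k) ≠ 0) (z : Fin 3 → NY → k)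
    (hz : LinearIndependent k z) (a : Fin 7 → NY → k)
    (ha : LinearIndependent k a) (haz : ∀ i j, ∑ s, a i s * z j s = 0) :
    Module.finrank k (cubicRelations (nq a)) = Module.finrank k (nKp z) := by
  classical
  obtain ⟨m, b, hm, hb⟩ := nsj_dual z hz a ha haz
  let Φ : MvPolynomial (Fin 7) k →ₐ[k] MvPolynomial NY k := aeval (fun i => ∑ s, a i s • X s)
  let Ψ : MvPolynomial NY k →ₐ[k] MvPolynomial (Fin 7) k := aeval (fun s => ∑ i, m i s • X i)
  have hΨΦ : ∀ p, Ψ (Φ p) = p := by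
    intro p
    have : Ψ.comp Φ = AlgHom.id k _ := by
      apply MvPolynomial.algHom_ext
      intro i
      simp only [AlgHom.comp_apply, Φ, Ψ, aeval_X, map_sum, map_smul, AlgHom.id_apply]
      simp only [Finset.smul_sum, smul_smul]
      rw [Finset.sum_comm]
      simp only [← Finset.sum_smul, hm]
      simp
    exact DFunLike.congr_fun this p
  have hΦΨ : ∀ p ∈ nKp z, Φ (Ψ p) = p := by
    intro p hp
    obtain ⟨h1, -, h4⟩ := (mem_nKp z p).1 hp
    have := nsj_transl h2 h3 Finset.univ z p 3 le_rfl h1 (fun i _ => h4 i)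
      (fun s => Φ (∑ i, m i s • X i)) (fun j => ∑ t, b j t • X t)
    have e : (fun s => Φ (∑ i, m i s • X i) + ∑ j, (∑ t, b j t • X t) * algebraMap k (MvPolynomial NY k) (z j s))
        = X := by
      funext s
      simp only [Φ, map_sum, map_smul, aeval_X, Finset.smul_sum, smul_smul, Finset.sum_mul]
      rw [Finset.sum_comm, Finset.sum_comm (s := Finset.univ (α := Fin 3)), ← Finset.sum_add_distrib]
      have : ∀ t, (∑ i, (m i s * a i t) • (X t : MvPolynomial NY k)) +
          ∑ j, b j t • (X t : MvPolynomial NY k) * algebraMap k (MvPolynomial NY k) (z j s)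
          = (if s = t then 1 else 0 : k) • (X t : MvPolynomial NY k) := by
        intro t
        rw [← hb, add_smul, Finset.sum_smul, Finset.sum_smul]
        congr 1
        apply Finset.sum_congr rfl
        intro j _
        rw [mul_comm (b j t), mul_smul, Algebra.smul_def (z j s), mul_comm]
      rw [Finset.sum_congr rfl fun t _ => this t]
      simp
    rw [e, aeval_X_left_apply] at this
    refine Eq.trans ?_ this.symm
    change Φ (aeval _ p) = _
    rw [← AlgHom.comp_apply, MvPolynomial.comp_aeval]
  have hq : ∀ p, aeval (nver k) (Φ p) = aeval (nq a) p := by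
    intro p
    rw [← AlgHom.comp_apply, MvPolynomial.comp_aeval]
    congr 2
    funext i
    simp [nq]
  have mΦ : ∀ p ∈ cubicRelations (nq a), Φ p ∈ nKp z := by
    rintro p ⟨h1, h4⟩
    rw [mem_nKp]
    refine ⟨nsj_aeval_hom _ (fun i => nsj_smulX_hom _) h1, ?_, ?_⟩
    · rw [hq]; exact h4
    · intro j
      apply nsj_der_aeval
      intro i
      rw [nD_eq]
      simp only [map_sum, Derivation.map_smul, pderiv_X, Pi.single_apply, smul_ite, smul_zero, Finset.sum_ite_eq', Finset.mem_univ, if_true]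
      have := haz i j
      rw [show (0 : MvPolynomial NY k) = (0 : k) • 1 by simp, ← this, Finset.sum_smul]
      apply Finset.sum_congr rfl
      intro s _
      simp only [Finset.sum_ite_eq, Finset.mem_univ, if_true, smul_smul, mul_comm]
  have mΨ : ∀ p ∈ nKp z, Ψ p ∈ cubicRelations (nq a) := by
    intro p hp
    obtain ⟨h1, h4, h5⟩ := (mem_nKp z p).1 hp
    refine ⟨nsj_aeval_hom _ (fun i => nsj_smulX_hom _) h1, ?_⟩
    change aeval (nq a) (Ψ p) = 0
    rw [← hq, hΦΨ p hp, h4]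
  let e : cubicRelations (nq a) ≃ₗ[k] nKp z :=
    { toFun := fun p => ⟨Φ p, mΦ p p.2⟩
      invFun := fun p => ⟨Ψ p, mΨ p p.2⟩
      map_add' := fun x y => by ext1; simp
      map_smul' := fun c x => by ext1; simp
      left_inv := fun p => by ext1; exact hΨΦ p
      right_inv := fun p => by ext1; exact hΦΨ p p.2 }
  exact e.finrank_eq

abbrev NZ := Fin 3 × NY

def nev (z : Fin 3 → NY → k) : MvPolynomial NZ k →+* k := eval (fun i : NZ => z i.1 i.2)

lemma nsj_mat {V W V2 : Type} [AddCommGroup V] [Module k V] [AddCommGroup W] [Module k W]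
    [AddCommGroup V2] [Module k V2] {n : ℕ} (b : Module.Basis (Fin n) k V) (α : V →ₗ[k] W)
    (D : NY → V →ₗ[k] V2) (π : V2 →ₗ[k] (Fin 36 → k)) (z0 : Fin 3 → NY → k)
    (hinj : ∀ v, α v = 0 → ∑ s, z0 0 s • D s v = 0 → ∑ s, z0 1 s • D s v = 0 →
      π (∑ s, z0 2 s • D s v) = 0 → v = 0) :
    ∃ T : Matrix (Fin 36 ⊕ Fin n) (Fin 36 ⊕ Fin n) (MvPolynomial NZ k),
      nev z0 T.det = 1 ∧
      (∀ z v, α v = 0 → (∀ i, ∑ s, z i s • D s v = 0) →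
        (T.map (nev z)).mulVec (Sum.elim 0 (b.repr v)) = 0) ∧
      (∀ (S : Type) [CommRing S] (φ : MvPolynomial NZ k →+* Polynomial S),
        (∀ c, (φ (C c)).natDegree = 0) → (∀ s, (φ (X (0, s))).natDegree = 0) →
        (∀ s, (φ (X (1, s))).natDegree = 0) → (∀ s, (φ (X (2, s))).natDegree ≤ 1) →
        (φ T.det).natDegree ≤ 36) := by
  classical
  let Λ : V →ₗ[k] (W × V2 × V2) × (Fin 36 → k) :=
    LinearMap.prod (LinearMap.prod α (LinearMap.prod (∑ s, z0 0 s • D s) (∑ s, z0 1 s • D s)))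
      (π ∘ₗ (∑ s, z0 2 s • D s))
  have hΛ : LinearMap.ker Λ = ⊥ := by
    rw [LinearMap.ker_eq_bot']
    intro v hv
    change ((α v, (∑ s, z0 0 s • D s) v, (∑ s, z0 1 s • D s) v), π ((∑ s, z0 2 s • D s) v)) = 0 at hv
    simp only [Prod.mk_eq_zero, LinearMap.sum_apply, LinearMap.smul_apply] at hv
    exact hinj v hv.1.1 hv.1.2.1 hv.1.2.2 hv.2
  obtain ⟨Pj, hPj⟩ := Λ.exists_leftInverse_of_injective hΛ
  let i1 : W →ₗ[k] (W × V2 × V2) × (Fin 36 → k) := LinearMap.inl k _ _ ∘ₗ LinearMap.inl k _ _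
  let i2 : V2 →ₗ[k] (W × V2 × V2) × (Fin 36 → k) :=
    LinearMap.inl k _ _ ∘ₗ LinearMap.inr k _ _ ∘ₗ LinearMap.inl k _ _
  let i3 : V2 →ₗ[k] (W × V2 × V2) × (Fin 36 → k) :=
    LinearMap.inl k _ _ ∘ₗ LinearMap.inr k _ _ ∘ₗ LinearMap.inr k _ _
  let i4 : (Fin 36 → k) →ₗ[k] (W × V2 × V2) × (Fin 36 → k) := LinearMap.inr k _ _
  let e := Pi.basisFun k (Fin 36)
  let N0 := LinearMap.toMatrix b b (Pj ∘ₗ i1 ∘ₗ α)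
  let N1 := fun s => LinearMap.toMatrix b b (Pj ∘ₗ i2 ∘ₗ D s)
  let N2 := fun s => LinearMap.toMatrix b b (Pj ∘ₗ i3 ∘ₗ D s)
  let Y := LinearMap.toMatrix e b (Pj ∘ₗ i4)
  let G := fun s => LinearMap.toMatrix b e (π ∘ₗ D s)
  let cm : ∀ {m n : Type}, Matrix m n k → Matrix m n (MvPolynomial NZ k) := fun M => M.map C
  let T : Matrix (Fin 36 ⊕ Fin n) (Fin 36 ⊕ Fin n) (MvPolynomial NZ k) :=
    Matrix.fromBlocks 1 (-∑ s, (X (2, s) : MvPolynomial NZ k) • cm (G s)) (cm Y)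
      (cm N0 + ∑ s, (X (0, s) : MvPolynomial NZ k) • cm (N1 s) + ∑ s, (X (1, s) : MvPolynomial NZ k) • cm (N2 s))
  have hTz : ∀ z, T.map (nev z) = Matrix.fromBlocks 1 (-∑ s, z 2 s • G s) Y
      (N0 + ∑ s, z 0 s • N1 s + ∑ s, z 1 s • N2 s) := by
    intro z
    have h1 : ∀ (i : Fin 3) {m n : Type} (M : NY → Matrix m n k),
        (∑ s, (X (i, s) : MvPolynomial NZ k) • cm (M s)).map (nev z) = ∑ s, z i s • M s := by
      intro i m n M
      ext a c
      simp [Matrix.sum_apply, cm, nev]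
    have h0 : ∀ {m n : Type} (M : Matrix m n k), (cm M).map (nev z) = M := by
      intro m n M; ext a c; simp [cm, nev]
    simp only [T, Matrix.fromBlocks_map]
    congr 1
    · simp
    · rw [← h1]; ext a c; simp
    · rw [h0]
    · rw [← h1 0, ← h1 1]
      nth_rewrite 2 [← h0 N0]
      ext a c; simp
  refine ⟨T, ?_, ?_, ?_⟩
  · rw [RingHom.map_det, RingHom.mapMatrix_apply, hTz, Matrix.det_fromBlocks_one₁₁]
    rw [Matrix.mul_neg, sub_neg_eq_add]
    have : N0 + ∑ s, z0 0 s • N1 s + ∑ s, z0 1 s • N2 s + Y * ∑ s, z0 2 s • G s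
        = LinearMap.toMatrix b b (Pj ∘ₗ Λ) := by
      simp only [N0, N1, N2, Y, G, ← map_smul, ← map_sum, ← map_add, ← LinearMap.toMatrix_comp]
      congr 1
      ext v
      simp only [LinearMap.add_apply, LinearMap.sum_apply, LinearMap.smul_apply, LinearMap.comp_apply,
        ← map_smul, ← map_sum, ← map_add]
      congr 1
      simp only [map_smul]
      change ((α v, 0), 0) + (((0 : W), (∑ s, z0 0 s • D s v), (0 : V2)), (0 : Fin 36 → k)) +
        (((0 : W), (0 : V2), (∑ s, z0 1 s • D s v)), (0 : Fin 36 → k)) + (0, π ((∑ s, z0 2 s • D s v))) =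
        ((α v, (∑ s, z0 0 s • D s) v, (∑ s, z0 1 s • D s) v), π ((∑ s, z0 2 s • D s) v))
      simp
    rw [this, hPj]
    simp
  · intro z v h0 hv
    rw [hTz]
    rw [Matrix.fromBlocks_mulVec]
    have hb : ∀ {U : Type} [AddCommGroup U] [Module k U] {m : ℕ} (c : Module.Basis (Fin m) k U) (f : V →ₗ[k] U),
        (LinearMap.toMatrix b c f).mulVec (b.repr v) = c.repr (f v) := by
      intro U _ _ m c f
      exact LinearMap.toMatrix_mulVec_repr b c f v
    have e1 : ∑ s, z 2 s • G s = LinearMap.toMatrix b e (π ∘ₗ ∑ s, z 2 s • D s) := by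
      simp only [G, ← map_smul, ← map_sum]
      congr 1; ext v; simp
    have e2 : N0 + ∑ s, z 0 s • N1 s + ∑ s, z 1 s • N2 s = LinearMap.toMatrix b b
       (Pj ∘ₗ i1 ∘ₗ α + Pj ∘ₗ i2 ∘ₗ (∑ s, z 0 s • D s) + Pj ∘ₗ i3 ∘ₗ (∑ s, z 1 s • D s)) := by
      simp only [N0, N1, N2, ← map_smul, ← map_sum, ← map_add]
      congr 1; ext v; simp
    funext j
    have q1 : (Sum.elim (0 : Fin 36 → k) (b.repr v)) ∘ Sum.inl = 0 := rfl
    have q2 : (Sum.elim (0 : Fin 36 → k) (b.repr v)) ∘ Sum.inr = b.repr v := rfl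
    rw [q1, q2, e1, e2, Matrix.neg_mulVec, hb, hb]
    have a0 := hv 0
    have a1 := hv 1
    have a2 := hv 2
    have r1 : (π ∘ₗ ∑ s, z 2 s • D s) v = 0 := by
      simp only [LinearMap.comp_apply, LinearMap.sum_apply, LinearMap.smul_apply, a2, map_zero]
    have r2 : (Pj ∘ₗ i1 ∘ₗ α + Pj ∘ₗ i2 ∘ₗ (∑ s, z 0 s • D s) + Pj ∘ₗ i3 ∘ₗ (∑ s, z 1 s • D s)) v = 0 := by
      simp only [LinearMap.add_apply, LinearMap.comp_apply, LinearMap.sum_apply, LinearMap.smul_apply, a0, a1, h0, map_zero, add_zero]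
    rw [r1, r2]
    cases j <;> simp
  · intro S _ φ hC hX0 hX1 hX2
    have hCm : ∀ {m n : Type} (M : Matrix m n k) i j, (φ (cm M i j)).natDegree = 0 := fun M i j => hC _
    have hsum : ∀ (i : Fin 3) (d : ℕ) (hd : ∀ s, (φ (X (i, s))).natDegree ≤ d) {m n : Type} (M : NY → Matrix m n k) a c,
        (φ ((∑ s, (X (i, s) : MvPolynomial NZ k) • cm (M s)) a c)).natDegree ≤ d := by
      intro i d hd m n M a c
      rw [Matrix.sum_apply, map_sum]
      apply Polynomial.natDegree_sum_le_of_forall_le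
      intro s _
      rw [Matrix.smul_apply, smul_eq_mul, map_mul]
      refine Polynomial.natDegree_mul_le.trans ?_
      rw [hCm, add_zero]; exact hd s
    let rd : Fin 36 ⊕ Fin n → ℕ := Sum.elim (fun _ => 1) (fun _ => 0)
    have hrow : ∀ a c, (φ (T a c)).natDegree ≤ rd a := by
      rintro (a | a) (c | c)
      · simp only [T, Matrix.fromBlocks_apply₁₁, rd, Sum.elim_inl, Matrix.one_apply]
        split_ifs <;> simp
      · simp only [T, Matrix.fromBlocks_apply₁₂, rd, Sum.elim_inl, Matrix.neg_apply, map_neg, Polynomial.natDegree_neg]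
        exact hsum 2 1 hX2 G a c
      · simp only [T, Matrix.fromBlocks_apply₂₁, rd, Sum.elim_inr]
        exact (hCm _ _ _).le
      · simp only [T, Matrix.fromBlocks_apply₂₂, rd, Sum.elim_inr, Matrix.add_apply, map_add]
        refine Polynomial.natDegree_add_le_of_degree_le (Polynomial.natDegree_add_le_of_degree_le (hCm _ _ _).le ?_) ?_
        · exact hsum 0 0 (fun s => (hX0 s).le) N1 a c
        · exact hsum 1 0 (fun s => (hX1 s).le) N2 a c
    rw [Matrix.det_apply, map_sum]
    apply Polynomial.natDegree_sum_le_of_forall_le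
    intro σ _
    have : (φ (∏ i, T (σ i) i)).natDegree ≤ 36 := by
      rw [map_prod]
      refine (Polynomial.natDegree_prod_le _ _).trans ?_
      refine (Finset.sum_le_sum fun i _ => hrow _ _).trans ?_
      rw [Equiv.sum_comp σ rd]
      simp [rd]
    rcases Int.units_eq_one_or (Equiv.Perm.sign σ) with h | h <;> rw [h] <;> simpa [map_neg, Polynomial.natDegree_neg] using this

lemma nsj_pi (h2 : (2 : k) ≠ 0) (h3 : (3 : k) ≠ 0) (A : Fin 2 → NY → k) (hA : LinearIndependent k A) :
    ∃ π : MvPolynomial NY k →ₗ[k] (Fin 36 → k), ∀ p : MvPolynomial NY k, p.IsHomogeneous 2 →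
      (∀ i, nD (A i) p = 0) → π p = 0 → p = 0 := by
  classical
  obtain ⟨S', hS'⟩ := Submodule.exists_isCompl (Submodule.span k (Set.range A))
  have hf : Module.finrank k S' = 8 := by
    have := Submodule.finrank_add_eq_of_isCompl hS'
    rw [finrank_span_eq_card hA, Module.finrank_fintype_fun_eq_card, nsj_card_NY] at this
    simp at this; omega
  let e := Module.finBasisOfFinrankEq k S' hf
  have hdec : ∀ t : NY, ∃ (c : Fin 2 → k) (d : Fin 8 → k), ∀ s,
      (∑ i, d i * (e i : NY → k) s) + ∑ j, c j * A j s = if s = t then 1 else 0 := by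
    intro t
    have : (Pi.single t 1 : NY → k) ∈ Submodule.span k (Set.range A) ⊔ S' := by
      rw [hS'.sup_eq_top]; trivial
    obtain ⟨x, hx, y, hy, hxy⟩ := Submodule.mem_sup.1 this
    obtain ⟨c, hc⟩ := (Submodule.mem_span_range_iff_exists_fun k).1 hx
    refine ⟨c, e.repr ⟨y, hy⟩, fun s => ?_⟩
    have h1 := congrArg (fun v : S' => (v : NY → k) s) (e.sum_repr ⟨y, hy⟩)
    simp only [Submodule.coe_sum, Submodule.coe_smul, Finset.sum_apply, Pi.smul_apply, smul_eq_mul] at h1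
    have h4 := congrFun hc s
    simp only [Finset.sum_apply, Pi.smul_apply, smul_eq_mul] at h4
    have h5 := congrFun hxy s
    rw [h1, h4, add_comm]
    simpa [Pi.single_apply] using h5
  choose c d hcd using hdec
  have hfin : Module.finrank k (homogeneousSubmodule (Fin 8) k 2) = 36 := by
    rw [nsj_finrank_hom, Fintype.card_fin, Nat.multichoose_eq]; decide
  let bb := Module.finBasisOfFinrankEq k _ hfin
  let sub : MvPolynomial NY k →ₐ[k] MvPolynomial (Fin 8) k := aeval (fun s => ∑ i, (e i : NY → k) s • X i)
  let hc : MvPolynomial (Fin 8) k →ₗ[k] homogeneousSubmodule (Fin 8) k 2 :=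
    (homogeneousComponent 2).codRestrict _ (fun p => homogeneousComponent_isHomogeneous 2 p)
  refine ⟨bb.equivFun.toLinearMap ∘ₗ hc ∘ₗ sub.toLinearMap, ?_⟩
  intro p hp hD h0
  have h1 : hc (sub p) = 0 := by
    have : bb.equivFun (hc (sub p)) = 0 := h0
    simpa using this
  have hsp : (sub p).IsHomogeneous 2 := nsj_aeval_hom _ (fun i => nsj_smulX_hom _) hp
  have h4 : sub p = 0 := by
    have := congrArg Subtype.val h1
    change homogeneousComponent 2 (sub p) = 0 at this
    rwa [homogeneousComponent_of_mem hsp, if_pos rfl] at this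
  let bk : MvPolynomial (Fin 8) k →ₐ[k] MvPolynomial NY k := aeval (fun i => ∑ t, d t i • X t)
  have := nsj_transl h2 h3 Finset.univ A p 2 (by norm_num) hp (fun i _ => hD i)
    (fun s => bk (∑ i, (e i : NY → k) s • X i)) (fun j => ∑ t, c t j • X t)
  have e1 : (fun s => bk (∑ i, (e i : NY → k) s • X i) +
      ∑ j, (∑ t, c t j • X t) * algebraMap k (MvPolynomial NY k) (A j s)) = X := by
    funext s
    simp only [bk, map_sum, map_smul, aeval_X, Finset.smul_sum, smul_smul, Finset.sum_mul]
    rw [Finset.sum_comm, Finset.sum_comm (s := Finset.univ (α := Fin 2)), ← Finset.sum_add_distrib]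
    have : ∀ t, (∑ i, ((e i : NY → k) s * d t i) • (X t : MvPolynomial NY k)) +
        ∑ j, c t j • (X t : MvPolynomial NY k) * algebraMap k (MvPolynomial NY k) (A j s)
        = (if s = t then 1 else 0 : k) • (X t : MvPolynomial NY k) := by
      intro t
      rw [← hcd, add_smul, Finset.sum_smul, Finset.sum_smul]
      congr 1
      · exact Finset.sum_congr rfl fun i _ => by rw [mul_comm]
      · apply Finset.sum_congr rfl
        intro j _
        rw [mul_comm (c t j), mul_smul, Algebra.smul_def (A j s), mul_comm]
    rw [Finset.sum_congr rfl fun t _ => this t]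
    simp
  rw [e1, aeval_X_left_apply] at this
  rw [this]
  have h5 : bk (sub p) = aeval (fun s => bk (∑ i, (e i : NY → k) s • X i)) p := by
    change bk (aeval _ p) = _
    rw [← AlgHom.comp_apply, MvPolynomial.comp_aeval]
  rw [← h5, h4, map_zero]

lemma nD_comm (a b : NY → k) (p : MvPolynomial NY k) : nD a (nD b p) = nD b (nD a p) := by
  have hc : ∀ s t, pderiv s (pderiv t p) = pderiv t (pderiv s p) := fun s t => by
    have : ⁅(pderiv s : Derivation k (MvPolynomial NY k) (MvPolynomial NY k)), pderiv t⁆ = (0 : Derivation k (MvPolynomial NY k) _) := by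
      apply MvPolynomial.derivation_ext
      intro i
      rw [Derivation.commutator_apply, pderiv_X, pderiv_X]
      simp only [Pi.single_apply]
      split_ifs <;> simp
    have h := DFunLike.congr_fun this p
    rw [Derivation.commutator_apply] at h
    exact sub_eq_zero.1 h
  rw [nD_eq a, nD_eq b, nD_eq b, nD_eq a]
  simp only [map_sum, Derivation.map_smul, Finset.smul_sum]
  rw [Finset.sum_comm]
  refine Finset.sum_congr rfl fun s _ => Finset.sum_congr rfl fun t _ => ?_
  rw [hc, smul_comm]

lemma nD_hom (a : NY → k) {p : MvPolynomial NY k} {d : ℕ} (hp : p.IsHomogeneous d) :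
    (nD a p).IsHomogeneous (d - 1) := by
  rw [nD_eq, ← mem_homogeneousSubmodule]
  exact Submodule.sum_mem _ fun s _ => Submodule.smul_mem _ _ hp.pderiv

lemma nsj_T (h2 : (2 : k) ≠ 0) (h3 : (3 : k) ≠ 0) (z0 : Fin 3 → NY → k)
    (hz0 : LinearIndependent k ![z0 0, z0 1]) {U : Type} [AddCommGroup U] [Module k U]
    (l : homogeneousSubmodule NY k 3 →ₗ[k] U)
    (hl : ∀ v : homogeneousSubmodule NY k 3, (v : MvPolynomial NY k) ∈ nKp z0 → l v = 0 → v = 0) :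
    ∃ (n : ℕ) (b : Module.Basis (Fin n) k (homogeneousSubmodule NY k 3))
      (T : Matrix (Fin 36 ⊕ Fin n) (Fin 36 ⊕ Fin n) (MvPolynomial NZ k)),
      nev z0 T.det = 1 ∧
      (∀ z (v : homogeneousSubmodule NY k 3), (v : MvPolynomial NY k) ∈ nKp z → l v = 0 →
        (T.map (nev z)).mulVec (Sum.elim 0 (b.repr v)) = 0) ∧
      (∀ (S : Type) [CommRing S] (φ : MvPolynomial NZ k →+* Polynomial S),
        (∀ c, (φ (C c)).natDegree = 0) → (∀ s, (φ (X (0, s))).natDegree = 0) →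
        (∀ s, (φ (X (1, s))).natDegree = 0) → (∀ s, (φ (X (2, s))).natDegree ≤ 1) →
        (φ T.det).natDegree ≤ 36) := by
  obtain ⟨π, hπ⟩ := nsj_pi h2 h3 _ hz0
  let V := homogeneousSubmodule NY k 3
  let D : NY → V →ₗ[k] MvPolynomial NY k := fun s => (pderiv s).toLinearMap ∘ₗ V.subtype
  have hD : ∀ (a : NY → k) (v : V), ∑ s, a s • D s v = nD a v := fun a v => (nD_eq a v).symm
  let α : V →ₗ[k] MvPolynomial (Fin 4) k × U := LinearMap.prod ((aeval (nver k)).toLinearMap ∘ₗ V.subtype) l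
  have hα : ∀ v : V, α v = (aeval (nver k) (v : MvPolynomial NY k), l v) := fun v => rfl
  obtain ⟨T, hT1, hT2, hT3⟩ := nsj_mat (Module.finBasis k V) α D π z0 (by
    intro v h0 ha hb hc
    rw [hD] at ha hb hc
    rw [hα, Prod.mk_eq_zero] at h0
    refine hl v ?_ h0.2
    rw [mem_nKp]
    refine ⟨v.2, h0.1, ?_⟩
    have h5 : nD (z0 2) (v : MvPolynomial NY k) = 0 := by
      apply hπ _ (nD_hom _ v.2) _ hc
      intro i
      fin_cases i
      · change nD (z0 0) _ = 0
        rw [nD_comm, ha, map_zero]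
      · change nD (z0 1) _ = 0
        rw [nD_comm, hb, map_zero]
    intro i
    fin_cases i
    exacts [ha, hb, h5])
  refine ⟨_, Module.finBasis k V, T, hT1, ?_, hT3⟩
  intro z v hv hlv
  apply hT2
  · obtain ⟨-, h4, -⟩ := (mem_nKp z _).1 hv
    rw [hα, h4, hlv]; rfl
  · intro i
    rw [hD]
    exact ((mem_nKp z _).1 hv).2.2 i

lemma nsj_exists_small {V : Type*} [AddCommGroup V] [Module k V] [Module.Finite k V]
    (h : 3 ≤ Module.finrank k V) (f : V →ₗ[k] (Fin 2 → k)) : ∃ v : V, v ≠ 0 ∧ f v = 0 := by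
  have h1 := LinearMap.finrank_range_add_finrank_ker f
  have h2 := Submodule.finrank_le (LinearMap.range f)
  rw [Module.finrank_fintype_fun_eq_card, Fintype.card_fin] at h2
  have : LinearMap.ker f ≠ ⊥ := by
    intro h0
    rw [h0, finrank_bot] at h1
    omega
  obtain ⟨v, hv, hv0⟩ := Submodule.exists_mem_ne_zero_of_ne_bot this
  exact ⟨v, hv0, hv⟩

lemma nsj_small_map {V : Type*} [AddCommGroup V] [Module k V] (K : Submodule k V) [Module.Finite k K]
    (h : Module.finrank k K ≤ 2) : ∃ l : V →ₗ[k] (Fin 2 → k), ∀ v ∈ K, l v = 0 → v = 0 := by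
  obtain ⟨r, hr⟩ := K.subtype.exists_leftInverse_of_injective K.ker_subtype
  let b := Module.finBasis k K
  refine ⟨Function.ExtendByZero.linearMap k (Fin.castLE h) ∘ₗ b.equivFun.toLinearMap ∘ₗ r, fun v hv h0 => ?_⟩
  have h6 : r v = ⟨v, hv⟩ := DFunLike.congr_fun hr (⟨v, hv⟩ : K)
  have h7 : b.equivFun (r v) = 0 := by
    funext i
    have := congrFun h0 (Fin.castLE h i)
    change Function.extend (Fin.castLE h) (b.equivFun (r v)) 0 (Fin.castLE h i) = 0 at this
    rwa [(Fin.castLE_injective h).extend_apply] at this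
  rw [h6, LinearEquiv.map_eq_zero_iff] at h7
  exact congrArg Subtype.val h7

lemma nKp_le (z : Fin 3 → NY → k) : nKp z ≤ homogeneousSubmodule NY k 3 :=
  inf_le_left.trans inf_le_left

/-- polynomials vanishing on a locus of bad points, semicontinuity -/
lemma nsj_semicont (h2 : (2 : k) ≠ 0) (h3 : (3 : k) ≠ 0) (z0 : Fin 3 → NY → k)
    (hz0 : LinearIndependent k ![z0 0, z0 1]) (hf : Module.finrank k (nKp z0) < 3) :
    ∃ g : MvPolynomial NZ k, nev z0 g ≠ 0 ∧ ∀ z, 3 ≤ Module.finrank k (nKp z) → nev z g = 0 := by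
  let V := homogeneousSubmodule NY k 3
  have hex : ∃ l : V →ₗ[k] (Fin 2 → k), ∀ v : V, (v : MvPolynomial NY k) ∈ nKp z0 → l v = 0 → v = 0 := by
    let K : Submodule k V := (nKp z0).comap V.subtype
    have hK : Module.finrank k K = Module.finrank k (nKp z0) :=
      (Submodule.comapSubtypeEquivOfLe (nKp_le z0)).finrank_eq
    exact nsj_small_map K (by omega)
  obtain ⟨l, hl⟩ := hex
  obtain ⟨n, b, T, hT1, hT2, -⟩ := nsj_T h2 h3 z0 hz0 l hl
  refine ⟨T.det, by rw [hT1]; exact one_ne_zero, fun z hz => ?_⟩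
  let K : Submodule k V := (nKp z).comap V.subtype
  have hK : Module.finrank k K = Module.finrank k (nKp z) :=
    (Submodule.comapSubtypeEquivOfLe (nKp_le z)).finrank_eq
  obtain ⟨v, hv0, hv⟩ := nsj_exists_small (V := K) (by rw [hK]; exact hz) (l ∘ₗ K.subtype)
  rw [RingHom.map_det, RingHom.mapMatrix_apply]
  apply Matrix.exists_mulVec_eq_zero_iff.1
  refine ⟨_, ?_, hT2 z v v.2 hv⟩
  intro h0
  apply hv0
  have : b.repr v = 0 := by
    ext i
    exact congrFun h0 (Sum.inr i)
  simpa using this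

def nln (A B P Q : NY → k) (t : k) : Fin 3 → NY → k := ![A, B, fun s => P s + t * Q s]

def nphi (k : Type) [Field k] : MvPolynomial NZ k →+* Polynomial (MvPolynomial (Fin 4 × NY) k) :=
  eval₂Hom (Polynomial.C.comp C) (fun i => ![Polynomial.C (X (0, i.2)), Polynomial.C (X (1, i.2)),
    Polynomial.C (X (2, i.2)) + Polynomial.X * Polynomial.C (X (3, i.2))] i.1)

lemma nphi_ev (A B P Q : NY → k) (t : k) (g : MvPolynomial NZ k) :
    ((nphi k g).map (eval (fun i : Fin 4 × NY => (![A, B, P, Q] : Fin 4 → NY → k) i.1 i.2))).eval t = nev (nln A B P Q t) g := by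
  have : ((Polynomial.evalRingHom t).comp (Polynomial.mapRingHom (eval (fun i : Fin 4 × NY => (![A, B, P, Q] : Fin 4 → NY → k) i.1 i.2)))).comp (nphi k)
      = nev (nln A B P Q t) := by
    apply MvPolynomial.ringHom_ext
    · intro r; simp [nphi, nev]
    · rintro ⟨i, s⟩
      fin_cases i
      · simp [nphi, nev, nln]
      · simp [nphi, nev, nln]
      · simp [nphi, nev, nln]; ring
  exact RingHom.congr_fun this g

lemma nsj_engine [IsAlgClosed k] (h2 : (2 : k) ≠ 0) (h3 : (3 : k) ≠ 0) (F : MvPolynomial NZ k)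
    (hF : ∀ z, nev z F = 0 → 3 ≤ Module.finrank k (nKp z))
    (A0 B0 P Q : NY → k) (t0 : k) (ht0 : nev (nln A0 B0 P Q t0) F ≠ 0)
    (t : Fin 12 → k) (ht : Function.Injective t) (htF : ∀ i, nev (nln A0 B0 P Q (t i)) F = 0)
    (A B C0 C1 : NY → k) (hAB : LinearIndependent k ![A, B]) (h0 : nKp ![A, B, C0] = ⊥)
    (h1 : nev ![A, B, C1] F ≠ 0) : nKp ![A, B, C1] = ⊥ := by
  classical
  let V := homogeneousSubmodule NY k 3
  obtain ⟨n, b, T, hT1, hT2, hT3⟩ := nsj_T h2 h3 ![A, B, C0] hAB (0 : V →ₗ[k] k) (by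
    intro v hv _
    rw [h0, Submodule.mem_bot] at hv
    exact Subtype.ext hv)
  have hF0 : F ≠ 0 := by rintro rfl; simp at ht0
  have hcube : ∀ p, Prime p → p ∣ F → p ^ 3 ∣ T.det := by
    intro p hp hpF
    apply nsj_cube T p hp
    intro z hz j j'
    have hz3 : 3 ≤ Module.finrank k (nKp (fun i s => z (i, s))) := by
      apply hF
      obtain ⟨c, rfl⟩ := hpF
      rw [map_mul]
      have : nev (fun i s => z (i, s)) p = eval z p := rfl
      rw [this, hz, zero_mul]
    let K : Submodule k V := (nKp (fun i s => z (i, s))).comap V.subtype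
    have hK : Module.finrank k K = Module.finrank k (nKp (fun i s => z (i, s))) :=
      (Submodule.comapSubtypeEquivOfLe (nKp_le _)).finrank_eq
    let emb : V →ₗ[k] (Fin 36 ⊕ Fin n → k) :=
      { toFun := fun v => Sum.elim 0 (b.repr v)
        map_add' := fun x y => by funext i; cases i <;> simp
        map_smul' := fun c x => by funext i; cases i <;> simp }
    obtain ⟨v, hv0, hv⟩ := nsj_exists_small (V := K) (by rw [hK]; exact hz3)
      ((LinearMap.pi ![LinearMap.proj j, LinearMap.proj j'] : (Fin 36 ⊕ Fin n → k) →ₗ[k] (Fin 2 → k)) ∘ₗ emb ∘ₗ K.subtype)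
    have hTv := hT2 (fun i s => z (i, s)) v v.2 rfl
    have q1 : emb v j = 0 := congrFun hv 0
    have q2 : emb v j' = 0 := congrFun hv 1
    refine ⟨emb v, ?_, q1, q2, hTv⟩
    intro h0
    apply hv0
    have : b.repr v = 0 := by
      ext i
      exact congrFun h0 (Sum.inr i)
    simpa using this
  obtain ⟨r, ⟨e, he⟩, hrF, m, hFr⟩ := nsj_rad_cube F T.det hF0 hcube
  have hdegT : (nphi k T.det).natDegree ≤ 36 := by
    apply hT3
    · intro c; simp [nphi]
    · intro c; simp [nphi]
    · intro c; simp [nphi]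
    · intro c
      simp only [nphi, coe_eval₂Hom, eval₂_X]
      change (Polynomial.C _ + Polynomial.X * Polynomial.C _ : Polynomial _).natDegree ≤ 1
      rw [Polynomial.X_mul_C, add_comm]
      exact Polynomial.natDegree_linear_le
  have hTz : nev (nln A B C0 (C1 - C0) 0) T.det = 1 := by
    rw [← hT1]; congr 2; simp [nln]
  have hphi0 : nphi k T.det ≠ 0 := by
    intro h
    have := nphi_ev A B C0 (C1 - C0) 0 T.det
    rw [h, hTz] at this
    simp at this
  have hz1 : nln A B C0 (C1 - C0) 1 = ![A, B, C1] := by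
    simp only [nln]
    congr 3
    funext s; simp
  rw [he, map_mul, map_pow] at hphi0 hdegT
  have hr0 : nphi k r ≠ 0 := by rintro h; simp [h] at hphi0
  have he0 : nphi k e ≠ 0 := by rintro h; simp [h] at hphi0
  rw [Polynomial.natDegree_mul (pow_ne_zero _ hr0) he0, Polynomial.natDegree_pow] at hdegT
  have hr12 : 12 ≤ (nphi k r).natDegree := by
    by_contra hlt
    set r0 := (nphi k r).map (eval (fun i : Fin 4 × NY => (![A0, B0, P, Q] : Fin 4 → NY → k) i.1 i.2)) with hr0def
    have hev : ∀ x, r0.eval x = nev (nln A0 B0 P Q x) r := fun x => nphi_ev A0 B0 P Q x r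
    have hr00 : r0 = 0 := by
      apply Polynomial.eq_zero_of_natDegree_lt_card_of_eval_eq_zero r0 ht
      · intro i
        rw [hev]
        obtain ⟨c, hc⟩ := hFr
        have := congrArg (nev (nln A0 B0 P Q (t i))) hc
        rw [map_pow, map_mul, htF, zero_mul] at this
        exact eq_zero_of_pow_eq_zero this
      · rw [Fintype.card_fin]
        exact lt_of_le_of_lt Polynomial.natDegree_map_le (not_le.1 hlt)
    apply ht0
    obtain ⟨c, hc⟩ := hrF
    rw [hc, map_mul, ← hev, hr00]; simp
  have hdege : (nphi k e).natDegree = 0 := by omega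
  have hee : nev (nln A B C0 (C1 - C0) 1) e = nev (nln A B C0 (C1 - C0) 0) e := by
    rw [← nphi_ev, ← nphi_ev, Polynomial.eq_C_of_natDegree_eq_zero hdege]
    simp
  have hmu : nev ![A, B, C1] T.det ≠ 0 := by
    rw [he, map_mul, map_pow]
    refine mul_ne_zero (pow_ne_zero _ ?_) ?_
    · intro h
      obtain ⟨c, hc⟩ := hrF
      apply h1
      rw [hc, map_mul, h, zero_mul]
    · rw [← hz1, hee]
      intro h
      rw [he, map_mul, h, mul_zero] at hTz
      exact zero_ne_one hTz
  rw [eq_bot_iff]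
  intro v hv
  rw [Submodule.mem_bot]
  by_contra hne
  apply hmu
  rw [RingHom.map_det, RingHom.mapMatrix_apply]
  apply Matrix.exists_mulVec_eq_zero_iff.1
  refine ⟨_, ?_, hT2 _ ⟨v, nKp_le _ hv⟩ hv rfl⟩
  intro h0
  apply hne
  have : b.repr ⟨v, nKp_le _ hv⟩ = 0 := by
    ext i
    exact congrFun h0 (Sum.inr i)
  have := b.repr.map_eq_zero_iff.1 this
  exact congrArg Subtype.val this

lemma nsj_ker_bound {S V W : Type*} [AddCommGroup S] [Module k S] [AddCommGroup V] [Module k V]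
    [AddCommGroup W] [Module k W] [Module.Finite k S] [Module.Finite k V]
    (ev : S →ₗ[k] V) (r : V →ₗ[k] W) (E : Submodule k W) [Module.Finite k E] (m N d : ℕ)
    (hS : Module.finrank k V ≤ Module.finrank k S)
    (hE : Module.finrank k E ≤ m) (h : ∀ x, r (ev x) ∈ E) (hN : N ≤ Module.finrank k (LinearMap.range r))
    (hd : m + d ≤ N) : d ≤ Module.finrank k (LinearMap.ker ev) := by
  have h1 := LinearMap.finrank_range_add_finrank_ker r
  have h2 := LinearMap.finrank_range_add_finrank_ker ev
  let r' := r.domRestrict (LinearMap.range ev)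
  have h3 := LinearMap.finrank_range_add_finrank_ker r'
  have h4 : Module.finrank k (LinearMap.range r') ≤ m := by
    refine le_trans (Submodule.finrank_mono (t := E) ?_) hE
    rintro _ ⟨⟨_, x, rfl⟩, rfl⟩
    exact h x
  have h5 : Module.finrank k (LinearMap.ker r') ≤ Module.finrank k (LinearMap.ker r) := by
    let j : LinearMap.ker r' →ₗ[k] LinearMap.ker r :=
      LinearMap.codRestrict _ ((LinearMap.range ev).subtype ∘ₗ (LinearMap.ker r').subtype) (fun x => x.2)
    apply LinearMap.finrank_le_finrank_of_injective (f := j)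
    intro x y hxy
    have := congrArg Subtype.val hxy
    exact Subtype.ext (Subtype.ext this)
  omega

lemma nsj_hom_span {l : ℕ} (g : Fin l → Polynomial k) (E : Submodule k (Polynomial k))
    (hE : ∀ d : Fin l →₀ ℕ, d.degree = 3 → (d.prod fun i n => g i ^ n) ∈ E)
    (p : MvPolynomial (Fin l) k) (hp : p.IsHomogeneous 3) : aeval g p ∈ E := by
  rw [p.as_sum, map_sum]
  apply Submodule.sum_mem
  intro d hd
  rw [aeval_monomial, ← Algebra.smul_def]
  apply Submodule.smul_mem
  apply hE
  have := hp (mem_support_iff.1 hd)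
  rwa [Finsupp.degree_eq_weight_one]

lemma nsj_LB (q : Fin 7 → MvPolynomial (Fin 4) k) (hqh : ∀ i, (q i).IsHomogeneous 2)
    (c : Fin 4 → Polynomial k) (N : ℕ)
    (hN : ∀ n < N, ∃ f : MvPolynomial (Fin 4) k, f.IsHomogeneous 6 ∧ aeval c f = Polynomial.X ^ n)
    (l : ℕ) (g : Fin l → Polynomial k) (hq : ∀ i, aeval c (q i) ∈ Submodule.span k (Set.range g))
    (B : Finset (Polynomial k))
    (hB : ∀ d : Fin l →₀ ℕ, d.degree = 3 → (d.prod fun i n => g i ^ n) ∈ Submodule.span k (B : Set (Polynomial k)))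
    (hcard : B.card + 3 ≤ N) : 3 ≤ Module.finrank k (cubicRelations q) := by
  let S := homogeneousSubmodule (Fin 7) k 3
  let V := homogeneousSubmodule (Fin 4) k 6
  have hmem : ∀ x : S, aeval q (x : MvPolynomial (Fin 7) k) ∈ V := by
    intro x
    have : (x : MvPolynomial (Fin 7) k).IsHomogeneous 3 := x.2
    exact this.aeval q hqh
  let ev : S →ₗ[k] V := LinearMap.codRestrict V ((aeval q).toLinearMap ∘ₗ S.subtype) hmem
  let r : V →ₗ[k] Polynomial k := (aeval c).toLinearMap ∘ₗ V.subtype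
  let E := Submodule.span k (B : Set (Polynomial k))
  have hfin : Module.finrank k (cubicRelations q) = Module.finrank k (LinearMap.ker ev) := by
    have hle : cubicRelations q ≤ S := inf_le_left
    rw [← (Submodule.comapSubtypeEquivOfLe hle).finrank_eq]
    have : (cubicRelations q).comap S.subtype = LinearMap.ker ev := by
      ext x
      rw [Submodule.mem_comap, LinearMap.mem_ker, ← Subtype.coe_inj]
      change _ ∈ S ∧ aeval q (x : MvPolynomial (Fin 7) k) = 0 ↔ aeval q (x : MvPolynomial (Fin 7) k) = 0
      exact ⟨fun h => h.2, fun h => ⟨x.2, h⟩⟩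
    rw [this]
  rw [hfin]
  choose u hu using fun i => (Submodule.mem_span_range_iff_exists_fun k).1 (hq i)
  refine nsj_ker_bound ev r E B.card N 3 ?_ (finrank_span_finset_le_card B) ?_ ?_ hcard
  · change Module.finrank k (homogeneousSubmodule (Fin 4) k 6) ≤ Module.finrank k (homogeneousSubmodule (Fin 7) k 3)
    rw [nsj_finrank_hom, nsj_finrank_hom, Fintype.card_fin, Fintype.card_fin, Nat.multichoose_eq, Nat.multichoose_eq]
    decide
  · intro x
    change aeval c (aeval q (x : MvPolynomial (Fin 7) k)) ∈ E
    have h1 : aeval c (aeval q (x : MvPolynomial (Fin 7) k)) =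
        aeval g (aeval (fun i => ∑ j, u i j • (X j : MvPolynomial (Fin l) k)) (x : MvPolynomial (Fin 7) k)) := by
      rw [← AlgHom.comp_apply, ← AlgHom.comp_apply, MvPolynomial.comp_aeval, MvPolynomial.comp_aeval]
      congr 2
      funext i
      rw [← hu i]
      simp
    rw [h1]
    apply nsj_hom_span g E hB
    exact nsj_aeval_hom _ (fun i => nsj_smulX_hom _) x.2
  · choose f hf1 hf2 using fun n : Fin N => hN n n.2
    have hli : LinearIndependent k (fun n : Fin N => (⟨r ⟨f n, hf1 n⟩, LinearMap.mem_range_self _ _⟩ : LinearMap.range r)) := by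
      apply LinearIndependent.of_comp (LinearMap.range r).subtype
      have : (LinearMap.range r).subtype ∘ (fun n : Fin N => (⟨r ⟨f n, hf1 n⟩, LinearMap.mem_range_self _ _⟩ : LinearMap.range r))
          = (fun n : ℕ => (Polynomial.monomial n (1 : k))) ∘ (fun n : Fin N => (n : ℕ)) := by
        funext n
        change aeval c (f n) = Polynomial.monomial n 1
        rw [hf2, Polynomial.X_pow_eq_monomial]
      rw [this]
      have hb := (Polynomial.basisMonomials k).linearIndependent
      rw [Polynomial.coe_basisMonomials] at hb
      exact hb.comp _ Fin.val_injective
    have := hli.fintype_card_le_finrank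
    simpa using this

abbrev nBad (z : Fin 3 → NY → k) : Prop := 3 ≤ Module.finrank k (nKp z)

lemma nD_mem_span (z : Fin 3 → NY → k) (m : NY → k) (hm : m ∈ Submodule.span k (Set.range z))
    (p : MvPolynomial NY k) (hp : ∀ i, nD (z i) p = 0) : nD m p = 0 := by
  induction hm using Submodule.span_induction with
  | mem x hx => obtain ⟨i, rfl⟩ := hx; exact hp i
  | zero => rw [nD_eq]; simp
  | add x y _ _ hx hy =>
    rw [nD_eq] at *
    simp only [Pi.add_apply, add_smul, Finset.sum_add_distrib, hx, hy, add_zero]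
  | smul c x _ hx =>
    rw [nD_eq] at *
    simp only [Pi.smul_apply, smul_eq_mul, mul_smul, ← Finset.smul_sum, hx, smul_zero]

lemma nKp_anti (z z' : Fin 3 → NY → k) (h : ∀ i, z i ∈ Submodule.span k (Set.range z')) :
    nKp z' ≤ nKp z := by
  intro p hp
  rw [mem_nKp] at *
  exact ⟨hp.1, hp.2.1, fun i => nD_mem_span z' _ (h i) p hp.2.2⟩

lemma nBad_anti {z z' : Fin 3 → NY → k} (h : ∀ i, z i ∈ Submodule.span k (Set.range z'))
    (hb : nBad z') : nBad z :=
  le_trans hb (Submodule.finrank_mono (nKp_anti z z' h))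

def ncc {R : Type} [CommSemiring R] (c : Fin 4 → R) : NY → R :=
  Sym2.lift ⟨fun i j => c i * c j, fun _ _ => mul_comm _ _⟩

def nuv {R : Type} [CommSemiring R] (u v : Fin 4 → R) : NY → R :=
  Sym2.lift ⟨fun i j => u i * v j + u j * v i, fun _ _ => add_comm _ _⟩

lemma nver_mk (i j : Fin 4) : nver k s(i, j) = X i * X j := rfl
lemma ncc_mk {R : Type} [CommSemiring R] (c : Fin 4 → R) (i j : Fin 4) : ncc c s(i, j) = c i * c j := rfl
lemma nuv_mk {R : Type} [CommSemiring R] (u v : Fin 4 → R) (i j : Fin 4) :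
    nuv u v s(i, j) = u i * v j + u j * v i := rfl

lemma nver_aeval (c : Fin 4 → Polynomial k) (s : NY) : aeval c (nver k s) = ncc c s := by
  induction s using Sym2.ind with
  | _ i j =>
    rw [nver_mk, ncc_mk, map_mul, aeval_X, aeval_X]

lemma nq_aeval (c : Fin 4 → Polynomial k) (a : Fin 7 → NY → k) (i : Fin 7) :
    aeval c (nq a i) = ∑ s, a i s • ncc c s := by
  simp only [nq, map_sum, map_smul, nver_aeval]

lemma nq_hom (a : Fin 7 → NY → k) (i : Fin 7) : (nq a i).IsHomogeneous 2 := by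
  rw [nq, ← mem_homogeneousSubmodule]
  exact Submodule.sum_mem _ fun s _ => Submodule.smul_mem _ _ (nver_hom s)

lemma nsj_exists_coords {n : ℕ} (u : Fin n → Fin 4 → k) (hu : LinearIndependent k u) :
    ∃ l : Fin n → Fin 4 → k, ∀ i j, ∑ x, l i x * u j x = if i = j then 1 else 0 := by
  classical
  let f : (Fin n → k) →ₗ[k] (Fin 4 → k) := Fintype.linearCombination k u
  obtain ⟨g, hg⟩ := f.exists_leftInverse_of_injective (LinearMap.ker_eq_bot.2 hu.fintypeLinearCombination_injective)
  refine ⟨fun i x => g (Pi.single x 1) i, fun i j => ?_⟩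
  have h1 : g (u j) = Pi.single j 1 := by
    have := DFunLike.congr_fun hg (Pi.single j 1)
    simpa [f, Fintype.linearCombination_apply_single] using this
  have h2 : u j = ∑ x, u j x • (Pi.single x 1 : Fin 4 → k) := by
    funext y; simp [Finset.sum_apply, Pi.single_apply]
  have h3 := congrFun h1 i
  rw [h2, map_sum, Finset.sum_apply] at h3
  simp only [map_smul, Pi.smul_apply, smul_eq_mul] at h3
  rw [Finset.sum_congr rfl fun x _ => mul_comm (g (Pi.single x 1) i) (u j x), h3]
  simp [Pi.single_apply]

lemma nsj_lin_hom {σ : Type} [Fintype σ] (l : σ → k) : (∑ x, l x • (X x : MvPolynomial σ k)).IsHomogeneous 1 :=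
  nsj_smulX_hom l

lemma nsj_plane (α β γ : k) (h : ¬ (α = 0 ∧ β = 0 ∧ γ = 0)) :
    ∃ g : Fin 2 → Polynomial k, ∀ f0 f1 f2 : k, α * f0 + β * f1 + γ * f2 = 0 →
      Polynomial.C f0 + Polynomial.C f1 * Polynomial.X + Polynomial.C f2 * Polynomial.X ^ 2 ∈
        Submodule.span k (Set.range g) := by
  have key : ∀ (g : Fin 2 → Polynomial k) (p : Polynomial k) (x y : k), p = x • g 0 + y • g 1 →
      p ∈ Submodule.span k (Set.range g) := by
    rintro g p x y rfl
    exact Submodule.add_mem _ (Submodule.smul_mem _ _ (Submodule.subset_span ⟨0, rfl⟩))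
      (Submodule.smul_mem _ _ (Submodule.subset_span ⟨1, rfl⟩))
  by_cases hα : α = 0
  · by_cases hβ : β = 0
    · have hγ : γ ≠ 0 := fun h' => h ⟨hα, hβ, h'⟩
      refine ⟨![1, Polynomial.X], fun f0 f1 f2 hf => key _ _ f0 f1 ?_⟩
      have : f2 = 0 := by
        rw [hα, hβ] at hf; simpa [hγ] using hf
      simp [this, Polynomial.smul_eq_C_mul]
    · refine ⟨![1 - Polynomial.C (α / β) * Polynomial.X, Polynomial.X ^ 2 - Polynomial.C (γ / β) * Polynomial.X],
        fun f0 f1 f2 hf => key _ _ f0 f2 ?_⟩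
      have : f1 = - f0 * (α / β) - f2 * (γ / β) := by field_simp; linear_combination hf
      simp only [this, Polynomial.smul_eq_C_mul, Matrix.cons_val_zero, Matrix.cons_val_one, map_sub, map_mul, map_neg]
      ring
  · refine ⟨![Polynomial.X - Polynomial.C (β / α), Polynomial.X ^ 2 - Polynomial.C (γ / α)],
      fun f0 f1 f2 hf => key _ _ f1 f2 ?_⟩
    have : f0 = - f1 * (β / α) - f2 * (γ / α) := by field_simp; linear_combination hf
    simp only [this, Polynomial.smul_eq_C_mul, Matrix.cons_val_zero, Matrix.cons_val_one, map_sub, map_mul, map_neg]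
    ring

lemma nsj_bad_rank2 (h2 : (2 : k) ≠ 0) (h3 : (3 : k) ≠ 0) (z : Fin 3 → NY → k)
    (hz : LinearIndependent k z) (u w : Fin 4 → k) (huw : LinearIndependent k ![u, w]) (α β γ : k)
    (hne : ¬ (α = 0 ∧ β = 0 ∧ γ = 0))
    (hM : (fun s => α * ncc u s + β * nuv u w s + γ * ncc w s) ∈ Submodule.span k (Set.range z)) :
    nBad z := by
  classical
  obtain ⟨a, ha, haz⟩ := nsj_exists_perp z hz
  unfold nBad
  rw [← nsj_iso h2 h3 z hz a ha haz]
  obtain ⟨g, hg⟩ := nsj_plane α β γ hne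
  obtain ⟨l, hl⟩ := nsj_exists_coords _ huw
  let c : Fin 4 → Polynomial k := fun i => Polynomial.C (u i) + Polynomial.C (w i) * Polynomial.X
  let B : Finset (Polynomial k) := (Finset.range 4).image fun n => g 0 ^ n * g 1 ^ (3 - n)
  have hlc : ∀ i, aeval c (∑ x, l i x • (X x : MvPolynomial (Fin 4) k)) =
      Polynomial.C (∑ x, l i x * u x) + Polynomial.C (∑ x, l i x * w x) * Polynomial.X := by
    intro i
    simp only [map_sum, map_smul, aeval_X, c, Finset.sum_mul, ← Finset.sum_add_distrib]
    refine Finset.sum_congr rfl fun x _ => ?_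
    rw [Polynomial.smul_eq_C_mul, map_mul, map_mul]; ring
  have hperp : ∀ i, ∑ s, a i s * (α * ncc u s + β * nuv u w s + γ * ncc w s) = 0 := by
    intro i
    obtain ⟨d, hd⟩ := (Submodule.mem_span_range_iff_exists_fun k).1 hM
    have : ∀ s, α * ncc u s + β * nuv u w s + γ * ncc w s = ∑ j, d j * z j s := by
      intro s
      have := congrFun hd s
      simpa [Finset.sum_apply] using this.symm
    simp only [this, Finset.mul_sum]
    rw [Finset.sum_comm]
    apply Finset.sum_eq_zero
    intro j _
    rw [← mul_zero (d j), ← haz i j, Finset.mul_sum]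
    exact Finset.sum_congr rfl fun s _ => by ring
  refine nsj_LB (nq a) (nq_hom a) c 7 ?_ 2 g ?_ B ?_ ?_
  · intro n hn
    refine ⟨(∑ x, l 0 x • X x) ^ (6 - n) * (∑ x, l 1 x • X x) ^ n, ?_, ?_⟩
    · have := ((nsj_lin_hom (l 0)).pow (6 - n)).mul ((nsj_lin_hom (l 1)).pow n)
      rwa [show 1 * (6 - n) + 1 * n = 6 by omega] at this
    · have e1 := hl 0 0
      have e2 := hl 0 1
      have e3 := hl 1 0
      have e4 := hl 1 1
      simp only [Matrix.cons_val_zero, Matrix.cons_val_one] at e1 e2 e3 e4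
      rw [map_mul, map_pow, map_pow, hlc, hlc, e1, e2, e3, e4]
      simp
  · intro i
    rw [nq_aeval]
    have : ∑ s, a i s • ncc c s = Polynomial.C (∑ s, a i s * ncc u s) + Polynomial.C (∑ s, a i s * nuv u w s) * Polynomial.X
      + Polynomial.C (∑ s, a i s * ncc w s) * Polynomial.X ^ 2 := by
      simp only [map_sum, Finset.sum_mul, ← Finset.sum_add_distrib]
      refine Finset.sum_congr rfl fun s _ => ?_
      rw [Polynomial.smul_eq_C_mul]
      induction s using Sym2.ind with
      | _ x y =>
        rw [ncc_mk, ncc_mk, ncc_mk, nuv_mk]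
        simp only [c, map_mul, map_add]; ring
    rw [this]
    apply hg
    rw [← hperp i]
    simp only [mul_add, Finset.sum_add_distrib, Finset.mul_sum]
    congr 1
    · congr 1
      · exact Finset.sum_congr rfl fun s _ => by ring
      · exact Finset.sum_congr rfl fun s _ => by ring
    · exact Finset.sum_congr rfl fun s _ => by ring
  · intro d hd
    apply Submodule.subset_span
    rw [Finsupp.degree_eq_sum, Fin.sum_univ_two] at hd
    rw [Finsupp.prod_fintype _ _ (by simp), Fin.prod_univ_two]
    simp only [B, Finset.coe_image, Set.mem_image, Finset.mem_coe, Finset.mem_range]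
    exact ⟨d 0, by omega, by rw [show 3 - d 0 = d 1 by omega]⟩
  · have : B.card ≤ 4 := Finset.card_image_le.trans (by simp)
    omega

lemma nsj_extend (S : Submodule k (NY → k)) (h : Module.finrank k S ≤ 3) :
    ∃ z : Fin 3 → NY → k, LinearIndependent k z ∧ S ≤ Submodule.span k (Set.range z) := by
  have key : ∀ n (S : Submodule k (NY → k)), Module.finrank k S + n = 3 → ∃ S', S ≤ S' ∧ Module.finrank k S' = 3 := by
    intro n
    induction n with
    | zero => exact fun S h => ⟨S, le_rfl, h⟩
    | succ n ih =>
      intro S hS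
      have : S ≠ ⊤ := by
        rintro rfl
        rw [finrank_top, Module.finrank_fintype_fun_eq_card, nsj_card_NY] at hS
        omega
      obtain ⟨v, hv⟩ := SetLike.exists_not_mem_of_ne_top S this
      have h1 : Module.finrank k (S ⊔ Submodule.span k {v} : Submodule k (NY → k)) + n = 3 := by
        have := Submodule.finrank_sup_span_singleton hv
        omega
      obtain ⟨S', h3, h4⟩ := ih _ h1
      exact ⟨S', le_sup_left.trans h3, h4⟩
  obtain ⟨S', h1, h2⟩ := key (3 - Module.finrank k S) S (by omega)
  let b := Module.finBasisOfFinrankEq k S' h2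
  refine ⟨fun i => b i, b.linearIndependent.map' S'.subtype (by simp), ?_⟩
  refine h1.trans (le_of_eq ?_)
  have := congrArg (Submodule.map S'.subtype) b.span_eq
  rw [Submodule.map_span, Submodule.map_top, Submodule.range_subtype, ← Set.range_comp] at this
  exact this.symm

lemma nsj_bad_dep (h2 : (2 : k) ≠ 0) (h3 : (3 : k) ≠ 0) (z : Fin 3 → NY → k)
    (hz : ¬ LinearIndependent k z) : nBad z := by
  let e : Fin 4 → k := Pi.single 0 1
  let f : Fin 4 → k := Pi.single 1 1
  have hle : Module.finrank k (Submodule.span k (Set.range z)) ≤ 2 := by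
    by_contra h
    apply hz
    rw [linearIndependent_iff_card_le_finrank_span]
    simp only [Fintype.card_fin]
    unfold Set.finrank; omega
  obtain ⟨z', hz', hS⟩ := nsj_extend (Submodule.span k (Set.range z) ⊔ Submodule.span k {ncc e}) (by
    refine (Submodule.finrank_add_le_finrank_add_finrank _ _).trans ?_
    have := finrank_span_le_card (R := k) ({ncc e} : Set (NY → k))
    simp only [Set.toFinset_singleton, Finset.card_singleton] at this
    omega)
  apply nBad_anti (z' := z')
  · intro i
    exact hS (Submodule.mem_sup_left (Submodule.subset_span ⟨i, rfl⟩))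
  · apply nsj_bad_rank2 h2 h3 z' hz' e f ?_ 1 0 0 (by simp)
    · have : (fun s => 1 * ncc e s + 0 * nuv e f s + 0 * ncc f s) = ncc e := by funext s; simp
      rw [this]
      exact hS (Submodule.mem_sup_right (Submodule.mem_span_singleton_self _))
    · have hb := (Pi.basisFun k (Fin 4)).linearIndependent
      have := hb.comp ![0, 1] (by decide)
      convert this using 1
      funext i; fin_cases i <;> simp [e, f, Pi.basisFun_apply]

lemma nsj_bad_uv (h2 : (2 : k) ≠ 0) (h3 : (3 : k) ≠ 0) (A B : NY → k) (u v : Fin 4 → k) (s t : k) :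
    nBad ![A, B, fun i => nuv u v i + s * A i + t * B i] := by
  set z : Fin 3 → NY → k := ![A, B, fun i => nuv u v i + s * A i + t * B i] with hzdef
  by_cases hz : LinearIndependent k z
  · have hM : nuv u v ∈ Submodule.span k (Set.range z) := by
      rw [Submodule.mem_span_range_iff_exists_fun]
      refine ⟨![-s, -t, 1], ?_⟩
      funext i
      simp [Fin.sum_univ_three, hzdef]
      ring
    by_cases huv : LinearIndependent k ![u, v]
    · apply nsj_bad_rank2 h2 h3 z hz u v huv 0 1 0 (by simp)
      convert hM using 2; simp
    · rw [LinearIndependent.pair_iff] at huv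
      push Not at huv
      obtain ⟨x, y, hxy, hne⟩ := huv
      have hfin : ∀ w : Fin 4 → k, w ≠ 0 → ∀ c : k, c ≠ 0 → (fun i => c * ncc w i) ∈ Submodule.span k (Set.range z) → nBad z := by
        intro w hw c hc hmem
        have hex : ∃ w', LinearIndependent k ![w, w'] := by
          have : Submodule.span k {w} ≠ ⊤ := by
            intro h
            have h1 := finrank_span_le_card (R := k) ({w} : Set (Fin 4 → k))
            rw [h, finrank_top, Module.finrank_fintype_fun_eq_card] at h1
            simp at h1
          obtain ⟨w', hw'⟩ := SetLike.exists_not_mem_of_ne_top _ this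
          refine ⟨w', ?_⟩
          rw [LinearIndependent.pair_iff' hw]
          intro a ha
          exact hw' (Submodule.mem_span_singleton.2 ⟨a, ha⟩)
        obtain ⟨w', hw'⟩ := hex
        apply nsj_bad_rank2 h2 h3 z hz w w' hw' c 0 0 (by simp [hc])
        convert hmem using 2; simp
      have hM0 : nuv u v ≠ 0 := by
        intro h0
        have := hz.ne_zero
        rw [linearIndependent_iff'] at hz
        have h5 := hz Finset.univ ![-s, -t, 1] (by
          funext i
          have := congrFun h0 i
          simp [Fin.sum_univ_three, hzdef, this]; ring) 2 (Finset.mem_univ _)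
        simp at h5
      by_cases hy : y = 0
      · have hx : x ≠ 0 := fun h => hne h hy
        have hu : u = 0 := by
          rw [hy] at hxy; simpa [hx] using hxy
        exact absurd (by funext i; induction i using Sym2.ind with | _ i j => simp [nuv, hu]) hM0
      · have hv : v = fun i => (-x / y) * u i := by
          funext i
          have := congrFun hxy i
          simp at this
          field_simp
          linear_combination this
        have e : nuv u v = fun i => (2 * (-x / y)) * ncc u i := by
          funext i
          induction i using Sym2.ind with
          | _ i j =>
            rw [nuv_mk, ncc_mk, hv]; ring
        rw [e] at hM hM0
        apply hfin u ?_ _ ?_ hM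
        · rintro rfl
          exact hM0 (by funext i; induction i using Sym2.ind with | _ i j => simp [ncc])
        · intro h; rw [h] at hM0
          exact hM0 (by funext i; simp)
  · exact nsj_bad_dep h2 h3 z hz

def nLam (c : ℕ → k) : Polynomial k →ₗ[k] k := (Polynomial.basisMonomials k).constr k c

lemma nLam_X (c : ℕ → k) (n : ℕ) : nLam c (Polynomial.X ^ n) = c n := by
  have := (Polynomial.basisMonomials k).constr_basis k c n
  rw [Polynomial.coe_basisMonomials] at this
  rw [Polynomial.X_pow_eq_monomial]; exact this

def nAA (c : ℕ → k) : Submodule k (Polynomial k) :=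
  Polynomial.degreeLT k 7 ⊓ ⨅ i : Fin 3, LinearMap.ker (nLam c ∘ₗ LinearMap.mulLeft k (Polynomial.X ^ (i : ℕ)))

lemma mem_nAA (c : ℕ → k) (p : Polynomial k) : p ∈ nAA c ↔ p ∈ Polynomial.degreeLT k 7 ∧
    ∀ i : Fin 3, nLam c (Polynomial.X ^ (i : ℕ) * p) = 0 := by
  simp [nAA, Submodule.mem_iInf]

instance nsj_finite_degLT (n : ℕ) : Module.Finite k (Polynomial.degreeLT k n) :=
  Module.Finite.equiv (Polynomial.degreeLTEquiv k n).symm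

lemma nsj_finrank_degLT (n : ℕ) : Module.finrank k (Polynomial.degreeLT k n) = n := by
  rw [(Polynomial.degreeLTEquiv k n).finrank_eq]; simp

instance (c : ℕ → k) : Module.Finite k (nAA c) :=
  Submodule.finiteDimensional_of_le (S₂ := Polynomial.degreeLT k 7) inf_le_left

lemma nAA_finrank (c : ℕ → k)
    (hr : ∀ l : Fin 3 → k, (∀ n ≤ 6, ∑ i : Fin 3, l i * c (i + n) = 0) → l = 0) :
    Module.finrank k (nAA c) = 4 := by
  let D := Polynomial.degreeLT k 7
  let f : D →ₗ[k] (Fin 3 → k) :=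
    LinearMap.pi (fun i : Fin 3 => nLam c ∘ₗ LinearMap.mulLeft k (Polynomial.X ^ (i : ℕ)) ∘ₗ D.subtype)
  have hf : ∀ (p : D) i, f p i = nLam c (Polynomial.X ^ (i : ℕ) * (p : Polynomial k)) := fun p i => rfl
  have hsurj : LinearMap.range f = ⊤ := by
    by_contra hne
    obtain ⟨φ, hφ, hφ2⟩ := Submodule.exists_le_ker_of_lt_top _ (lt_top_iff_ne_top.2 hne)
    apply hφ
    have h0 := hr (fun i => φ (Pi.single i 1)) (by
      intro n hn
      have hmem : (Polynomial.X ^ n : Polynomial k) ∈ D := by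
        rw [Polynomial.mem_degreeLT]
        exact lt_of_le_of_lt (Polynomial.degree_X_pow_le n) (by exact_mod_cast (by omega : n < 7))
      have h1 : φ (f ⟨_, hmem⟩) = 0 := hφ2 ⟨_, rfl⟩
      have h2 : f ⟨_, hmem⟩ = ∑ i : Fin 3, c (i + n) • (Pi.single i 1 : Fin 3 → k) := by
        funext j
        rw [hf, ← pow_add, nLam_X]
        simp [Finset.sum_apply, Pi.single_apply]
      rw [h2, map_sum] at h1
      rw [← h1]
      refine Finset.sum_congr rfl fun i _ => ?_
      rw [map_smul, smul_eq_mul, mul_comm])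
    apply LinearMap.pi_ext'
    intro i
    ext
    have := congrFun h0 i
    simpa using this
  have h1 := LinearMap.finrank_range_add_finrank_ker f
  rw [hsurj, finrank_top, Module.finrank_fintype_fun_eq_card, Fintype.card_fin] at h1
  have h2 : Module.finrank k D = 7 := nsj_finrank_degLT 7
  have h3 : Module.finrank k (nAA c) = Module.finrank k (LinearMap.ker f) := by
    have hle : nAA c ≤ D := inf_le_left
    rw [← (Submodule.comapSubtypeEquivOfLe hle).finrank_eq]
    have : (nAA c).comap D.subtype = LinearMap.ker f := by
      ext x
      rw [Submodule.mem_comap, LinearMap.mem_ker, mem_nAA]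
      constructor
      · intro h; funext i; exact h.2 i
      · intro h; exact ⟨x.2, fun i => congrFun h i⟩
    rw [this]
  omega

/-- a subspace of dimension 4 containing 4 independent vectors is their span -/
lemma nsj_le_span {V : Type*} [AddCommGroup V] [Module k V] (S : Submodule k V) [Module.Finite k S]
    (hS : Module.finrank k S = 4) (g : Fin 4 → V) (hg : LinearIndependent k g) (hgS : ∀ i, g i ∈ S) :
    S ≤ Submodule.span k (Set.range g) := by
  have h1 : Submodule.span k (Set.range g) ≤ S := by
    rw [Submodule.span_le]; rintro _ ⟨i, rfl⟩; exact hgS i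
  apply le_of_eq
  symm
  apply Submodule.eq_of_le_of_finrank_eq h1
  rw [hS, finrank_span_eq_card hg]; simp

lemma nsj_mulXdeg (p : Polynomial k) (n m j : ℕ) (hp : p ∈ Polynomial.degreeLT k n) (h : j + n ≤ m) :
    Polynomial.X ^ j * p ∈ Polynomial.degreeLT k m := by
  rw [Polynomial.mem_degreeLT] at *
  rcases eq_or_ne p 0 with rfl | h0
  · simp
  · rw [Polynomial.degree_eq_natDegree h0] at hp
    have : p.natDegree < n := by exact_mod_cast hp
    rw [Polynomial.degree_mul, Polynomial.degree_X_pow, Polynomial.degree_eq_natDegree h0]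
    exact_mod_cast (by omega : j + p.natDegree < m)

lemma nsj_two {V W : Type*} [AddCommGroup V] [Module k V] [AddCommGroup W] [Module k W] [Module.Finite k V]
    (f : V →ₗ[k] W) (h : 2 ≤ Module.finrank k (LinearMap.ker f)) :
    ∃ a b : V, f a = 0 ∧ f b = 0 ∧ ∀ x y : k, x • a + y • b = 0 → x = 0 ∧ y = 0 := by
  obtain ⟨v, hv⟩ := exists_linearIndependent_of_le_finrank h
  refine ⟨v 0, v 1, (v 0).2, (v 1).2, fun x y hxy => ?_⟩
  rw [linearIndependent_iff'] at hv
  have := hv Finset.univ ![x, y] (by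
        rw [Fin.sum_univ_two]
        apply Subtype.ext
        exact hxy)
  exact ⟨this 0 (Finset.mem_univ _), this 1 (Finset.mem_univ _)⟩

lemma nsj_hankel (c : ℕ → k)
    (hr : ∀ l : Fin 3 → k, (∀ n ≤ 6, ∑ i : Fin 3, l i * c (i + n) = 0) → l = 0) :
    ∃ (g : Fin 4 → Polynomial k) (B : Finset (Polynomial k)), B.card ≤ 16 ∧
      (∀ p ∈ nAA c, p ∈ Submodule.span k (Set.range g)) ∧
      ∀ d : Fin 4 →₀ ℕ, d.degree = 3 → (d.prod fun i n => g i ^ n) ∈ Submodule.span k (B : Set (Polynomial k)) := by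
  classical
  have hfr := nAA_finrank c hr
  by_cases hcase : ∃ h : Polynomial k, h ≠ 0 ∧ h ∈ Polynomial.degreeLT k 5 ∧ ∀ i < 5, nLam c (Polynomial.X ^ i * h) = 0
  · obtain ⟨h, h0, hdeg, hh⟩ := hcase
    have hmem : ∀ j : ℕ, j < 3 → Polynomial.X ^ j * h ∈ nAA c := by
      intro j hj
      rw [mem_nAA]
      refine ⟨nsj_mulXdeg h 5 7 j hdeg (by omega), fun i => ?_⟩
      rw [← mul_assoc, ← pow_add]
      exact hh _ (by omega)
    let g3 : Fin 3 → Polynomial k := fun j => Polynomial.X ^ (j : ℕ) * h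
    have hli : LinearIndependent k g3 := by
      rw [Fintype.linearIndependent_iff]
      intro l hl
      have : (∑ i, Polynomial.C (l i) * Polynomial.X ^ (i : ℕ)) * h = 0 := by
        rw [← hl, Finset.sum_mul]
        refine Finset.sum_congr rfl fun i _ => ?_
        rw [Polynomial.smul_eq_C_mul, mul_assoc]
      have h1 := (mul_eq_zero.1 this).resolve_right h0
      intro i
      have h2 := congrArg (fun p => Polynomial.coeff p (i : ℕ)) h1
      rw [Fin.sum_univ_three] at h2
      fin_cases i <;> simpa [Polynomial.coeff_X, Polynomial.coeff_C, Polynomial.coeff_X_pow, Polynomial.coeff_one] using h2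
    have hex : ∃ w ∈ nAA c, w ∉ Submodule.span k (Set.range g3) := by
      by_contra hcon
      push Not at hcon
      have h1 : nAA c ≤ Submodule.span k (Set.range g3) := hcon
      have hfin : Module.Finite k (Submodule.span k (Set.range g3)) :=
        Module.Finite.span_of_finite k (Set.finite_range _)
      have h2 := Submodule.finrank_mono h1
      rw [hfr, finrank_span_eq_card hli] at h2
      simp at h2
    obtain ⟨w, hw, hws⟩ := hex
    let g : Fin 4 → Polynomial k := Fin.snoc (α := fun _ => Polynomial k) g3 w
    have hg : LinearIndependent k g := by
      rw [linearIndependent_finSnoc]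
      exact ⟨hli, hws⟩
    let B : Finset (Polynomial k) := ((Finset.range 4).sigma fun a => Finset.range (2 * a + 1)).image
      fun x => h ^ x.1 * w ^ (3 - x.1) * Polynomial.X ^ x.2
    refine ⟨g, B, Finset.card_image_le.trans (by decide), ?_, ?_⟩
    · apply nsj_le_span (nAA c) hfr g hg
      intro i
      refine Fin.lastCases ?_ (fun j => ?_) i
      · change w ∈ nAA c
        exact hw
      · rw [show g (Fin.castSucc j) = g3 j from Fin.snoc_castSucc (α := fun _ => Polynomial k) _ _ _]
        exact hmem j j.2
    · intro d hd
      apply Submodule.subset_span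
      rw [Finsupp.degree_eq_sum, Fin.sum_univ_four] at hd
      rw [Finsupp.prod_fintype _ _ (by simp), Fin.prod_univ_four]
      have e0 : g 0 = h := by change Polynomial.X ^ 0 * h = h; simp
      have e1 : g 1 = Polynomial.X * h := by change Polynomial.X ^ 1 * h = _; simp
      have e2 : g 2 = Polynomial.X ^ 2 * h := rfl
      have e3 : g 3 = w := rfl
      rw [e0, e1, e2, e3]
      simp only [B, Finset.coe_image, Set.mem_image, Finset.mem_coe, Finset.mem_sigma, Finset.mem_range]
      refine ⟨⟨d 0 + d 1 + d 2, d 1 + 2 * d 2⟩, ⟨by dsimp only; omega, by dsimp only; omega⟩, ?_⟩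
      dsimp only
      rw [show 3 - (d 0 + d 1 + d 2) = d 3 by omega]
      ring
  · push Not at hcase
    let D := Polynomial.degreeLT k 6
    let f : D →ₗ[k] (Fin 4 → k) :=
      LinearMap.pi (fun i : Fin 4 => nLam c ∘ₗ LinearMap.mulLeft k (Polynomial.X ^ (i : ℕ)) ∘ₗ D.subtype)
    have hf : ∀ (p : D) i, f p i = nLam c (Polynomial.X ^ (i : ℕ) * (p : Polynomial k)) := fun p i => rfl
    have hker : 2 ≤ Module.finrank k (LinearMap.ker f) := by
      have h1 := LinearMap.finrank_range_add_finrank_ker f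
      have h2 : Module.finrank k D = 6 := nsj_finrank_degLT 6
      have h3 := Submodule.finrank_le (LinearMap.range f)
      rw [Module.finrank_fintype_fun_eq_card, Fintype.card_fin] at h3
      omega
    obtain ⟨a', b', ha', hb', hab'⟩ := nsj_two f hker
    obtain ⟨a, haD⟩ := a'
    obtain ⟨b, hbD⟩ := b'
    have hab : ∀ x y : k, x • a + y • b = 0 → x = 0 ∧ y = 0 := by
      intro x y hxy
      exact hab' x y (Subtype.ext hxy)
    have hza : ∀ i < 4, nLam c (Polynomial.X ^ i * a) = 0 := fun i hi => congrFun ha' ⟨i, hi⟩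
    have hzb : ∀ i < 4, nLam c (Polynomial.X ^ i * b) = 0 := fun i hi => congrFun hb' ⟨i, hi⟩
    have hmem : ∀ p ∈ D, (∀ i < 4, nLam c (Polynomial.X ^ i * p) = 0) → ∀ j < 2, Polynomial.X ^ j * p ∈ nAA c := by
      intro p hp hp2 j hj
      rw [mem_nAA]
      refine ⟨nsj_mulXdeg p 6 7 j hp (by omega), fun i => ?_⟩
      rw [← mul_assoc, ← pow_add]
      exact hp2 _ (by omega)
    let g : Fin 4 → Polynomial k := ![a, Polynomial.X * a, b, Polynomial.X * b]
    have hg : LinearIndependent k g := by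
      rw [Fintype.linearIndependent_iff]
      intro l hl
      rw [Fin.sum_univ_four] at hl
      change l 0 • a + l 1 • (Polynomial.X * a) + l 2 • b + l 3 • (Polynomial.X * b) = 0 at hl
      let p := l 1 • a + l 3 • b
      have hp1 : Polynomial.X * p = (-l 0) • a + (-l 2) • b := by
        simp only [p, Polynomial.smul_eq_C_mul, map_neg] at hl ⊢
        linear_combination hl
      have hz' : ∀ x y : k, ∀ i < 4, nLam c (Polynomial.X ^ i * (x • a + y • b)) = 0 := by
        intro x y i hi
        rw [mul_add, mul_smul_comm, mul_smul_comm, map_add, map_smul, map_smul]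
        have e1 : nLam c (Polynomial.X ^ i * a) = 0 := hza i hi
        have e2 : nLam c (Polynomial.X ^ i * b) = 0 := hzb i hi
        rw [e1, e2]; simp
      have hp0 : p = 0 := by
        by_contra hp0
        have hXD : Polynomial.X * p ∈ D := by
          rw [hp1]; exact D.add_mem (D.smul_mem _ haD) (D.smul_mem _ hbD)
        have hp5 : p ∈ Polynomial.degreeLT k 5 := by
          have hXD' := Polynomial.mem_degreeLT.1 hXD
          rw [Polynomial.mem_degreeLT]
          rw [Polynomial.degree_mul, Polynomial.degree_X, Polynomial.degree_eq_natDegree hp0] at hXD'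
          rw [Polynomial.degree_eq_natDegree hp0]
          have : 1 + p.natDegree < 6 := by exact_mod_cast hXD'
          exact_mod_cast (by omega : p.natDegree < 5)
        obtain ⟨i, hi, hne⟩ := hcase p hp0 hp5
        apply hne
        rcases Nat.eq_zero_or_pos i with rfl | hpos
        · exact hz' _ _ 0 (by omega)
        · obtain ⟨i', rfl⟩ : ∃ i', i = i' + 1 := ⟨i - 1, by omega⟩
          rw [pow_succ, mul_assoc, hp1]
          exact hz' _ _ i' (by omega)
      have q1 := hab _ _ hp0
      rw [hp0, mul_zero] at hp1
      have q2 := hab _ _ hp1.symm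
      intro i
      fin_cases i
      · simpa using q2.1
      · exact q1.1
      · simpa using q2.2
      · exact q1.2
    let B : Finset (Polynomial k) := (Finset.range 4 ×ˢ Finset.range 4).image
      fun x => a ^ x.1 * b ^ (3 - x.1) * Polynomial.X ^ x.2
    refine ⟨g, B, Finset.card_image_le.trans (by decide), ?_, ?_⟩
    · apply nsj_le_span (nAA c) hfr g hg
      intro i
      fin_cases i
      · change a ∈ nAA c
        simpa using hmem a haD hza 0 (by omega)
      · change Polynomial.X * a ∈ nAA c
        simpa using hmem a haD hza 1 (by omega)
      · change b ∈ nAA c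
        simpa using hmem b hbD hzb 0 (by omega)
      · change Polynomial.X * b ∈ nAA c
        simpa using hmem b hbD hzb 1 (by omega)
    · intro d hd
      apply Submodule.subset_span
      rw [Finsupp.degree_eq_sum, Fin.sum_univ_four] at hd
      rw [Finsupp.prod_fintype _ _ (by simp), Fin.prod_univ_four]
      change a ^ d 0 * (Polynomial.X * a) ^ d 1 * b ^ d 2 * (Polynomial.X * b) ^ d 3 ∈ _
      simp only [B, Finset.coe_image, Set.mem_image, Finset.mem_coe, Finset.mem_product, Finset.mem_range]
      refine ⟨⟨d 0 + d 1, d 1 + d 3⟩, ⟨by dsimp only; omega, by dsimp only; omega⟩, ?_⟩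
      dsimp only
      rw [show 3 - (d 0 + d 1) = d 2 + d 3 by omega]
      ring

lemma nsj_coordM (e : Fin 4 → Fin 4 → k) (he : LinearIndependent k e) :
    ∃ l : Fin 4 → Fin 4 → k, (∀ i j, ∑ x, l i x * e j x = if i = j then 1 else 0) ∧
      ∀ (A : NY → k) x y, A s(x, y) =
        ∑ j, ∑ m, (∑ x', ∑ y', A s(x', y') * e j x' * e m y') * (l j x * l m y) := by
  classical
  obtain ⟨l, hl⟩ := nsj_exists_coords _ he
  have hle : ∀ x y, ∑ j, e j x * l j y = if x = y then 1 else 0 := by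
    have h1 : (Matrix.of l) * (Matrix.of e).transpose = 1 := by
      ext i j
      rw [Matrix.mul_apply, Matrix.one_apply, ← hl]; rfl
    have h4 := mul_eq_one_comm.1 h1
    intro x y
    have := congrFun (congrFun h4 x) y
    rw [Matrix.mul_apply, Matrix.one_apply] at this
    exact this
  refine ⟨l, hl, fun A x y => ?_⟩
  simp only [Finset.sum_mul]
  have h1 : ∀ j m : Fin 4, ∀ x' y' : Fin 4, A s(x', y') * e j x' * e m y' * (l j x * l m y) =
    A s(x', y') * ((e j x' * l j x) * (e m y' * l m y)) := fun j m x' y' => by ring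
  simp only [h1]
  have h5 : ∀ j : Fin 4, ∑ m : Fin 4, ∑ x', ∑ y', A s(x', y') * ((e j x' * l j x) * (e m y' * l m y))
     = ∑ x', ∑ y', ∑ m : Fin 4, A s(x', y') * ((e j x' * l j x) * (e m y' * l m y)) := by
    intro j
    rw [Finset.sum_comm]
    exact Finset.sum_congr rfl fun x' _ => Finset.sum_comm
  simp only [h5]
  simp only [← Finset.mul_sum, hle]
  rw [Finset.sum_comm]
  have h6 : ∀ x' , ∑ j : Fin 4, ∑ y' : Fin 4, A s(x', y') * ((e j x' * l j x) * (if y' = y then 1 else 0))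
     = A s(x', y) * (if x' = x then 1 else 0) := by
    intro x'
    simp only [mul_ite, mul_one, mul_zero, Finset.sum_ite_eq', Finset.mem_univ, if_true]
    rw [← Finset.mul_sum, hle]; simp
  simp only [h6]
  simp

lemma nsj_bad_hankel (h2 : (2 : k) ≠ 0) (h3 : (3 : k) ≠ 0) (A : Fin 3 → NY → k)
    (hA : LinearIndependent k A) (e : Fin 4 → Fin 4 → k) (he : LinearIndependent k e) (c : ℕ → k)
    (hc : ∀ (i : Fin 3) (j l : Fin 4), ∑ x, ∑ y, A i s(x, y) * e j x * e l y = c (i + (j + l))) : nBad A := by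
  classical
  obtain ⟨a, ha, haz⟩ := nsj_exists_perp A hA
  unfold nBad
  rw [← nsj_iso h2 h3 A hA a ha haz]
  obtain ⟨l, hl, hco⟩ := nsj_coordM e he
  have hinv : ∀ (i : Fin 3) x y, A i s(x, y) = ∑ j : Fin 4, ∑ m : Fin 4, c (i + (j + m)) * (l j x * l m y) := by
    intro i x y
    rw [hco (A i)]
    simp only [hc]
  let cv : Fin 4 → Polynomial k := fun x => ∑ j : Fin 4, Polynomial.C (l j x) * Polynomial.X ^ (j : ℕ)
  have hr : ∀ m : Fin 3 → k, (∀ n ≤ 6, ∑ i : Fin 3, m i * c (i + n) = 0) → m = 0 := by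
    intro m hm
    rw [Fintype.linearIndependent_iff] at hA
    funext i
    apply hA m
    funext s
    induction s using Sym2.ind with
    | _ x y =>
      simp only [Finset.sum_apply, Pi.smul_apply, smul_eq_mul, hinv, Finset.mul_sum, Pi.zero_apply]
      rw [Finset.sum_comm]
      apply Finset.sum_eq_zero; intro j _
      rw [Finset.sum_comm]
      apply Finset.sum_eq_zero; intro n _
      simp only [← mul_assoc, ← Finset.sum_mul]
      rw [hm _ (by omega)]; simp
  obtain ⟨g, B, hB16, hg, hB⟩ := nsj_hankel c hr
  have hcc : ∀ x y, cv x * cv y = ∑ j : Fin 4, ∑ m : Fin 4, (l j x * l m y) • Polynomial.X ^ ((j : ℕ) + m) := by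
    intro x y
    simp only [cv, Finset.sum_mul_sum]
    refine Finset.sum_congr rfl fun j _ => Finset.sum_congr rfl fun m _ => ?_
    rw [Polynomial.smul_eq_C_mul, map_mul, pow_add]; ring
  refine nsj_LB (nq a) (nq_hom a) cv 19 ?_ 4 g ?_ B hB (by omega)
  · intro n hn
    let lf : Fin 4 → MvPolynomial (Fin 4) k := fun j => ∑ x, e j x • X x
    have hlf : ∀ j, aeval cv (lf j) = Polynomial.X ^ (j : ℕ) := by
      intro j
      simp only [lf, map_sum, map_smul, aeval_X, cv, Finset.smul_sum]
      rw [Finset.sum_comm]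
      have : ∀ i : Fin 4, ∑ x, e j x • (Polynomial.C (l i x) * Polynomial.X ^ (i : ℕ)) =
        Polynomial.C (if i = j then 1 else 0) * Polynomial.X ^ (i : ℕ) := by
        intro i
        rw [← hl, map_sum, Finset.sum_mul]
        refine Finset.sum_congr rfl fun x _ => ?_
        rw [Polynomial.smul_eq_C_mul, map_mul]; ring
      simp only [this]
      rw [Finset.sum_eq_single j]
      · simp
      · intro b _ hb; simp [hb]
      · simp
    have hlh : ∀ j, (lf j).IsHomogeneous 1 := fun j => nsj_lin_hom _
    obtain ⟨x, r, hxr, hr3, hx⟩ : ∃ x r : ℕ, n = 3 * x + r ∧ r < 3 ∧ x ≤ 6 := ⟨n / 3, n % 3, by omega, by omega, by omega⟩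
    by_cases hx6 : x = 6
    · refine ⟨lf 3 ^ 6, ?_, ?_⟩
      · have := (hlh 3).pow 6; rwa [one_mul] at this
      · rw [map_pow, hlf, ← pow_mul]; congr 1
        change 3 * 6 = n
        omega
    · refine ⟨lf 3 ^ x * lf ⟨r, by omega⟩ * lf 0 ^ (5 - x), ?_, ?_⟩
      · have := (((hlh 3).pow x).mul (hlh ⟨r, by omega⟩)).mul ((hlh 0).pow (5 - x))
        rwa [show 1 * x + 1 + 1 * (5 - x) = 6 by omega] at this
      · rw [map_mul, map_mul, map_pow, map_pow, hlf, hlf, hlf, ← pow_mul]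
        simp [← pow_add, hxr]
  · intro i
    apply hg
    rw [nq_aeval, mem_nAA]
    constructor
    · apply Submodule.sum_mem
      intro s _
      apply Submodule.smul_mem
      induction s using Sym2.ind with
      | _ x y =>
        rw [ncc_mk, hcc]
        refine Submodule.sum_mem _ fun j _ => Submodule.sum_mem _ fun m _ => Submodule.smul_mem _ _ ?_
        rw [Polynomial.mem_degreeLT]
        refine lt_of_le_of_lt (Polynomial.degree_X_pow_le _) ?_
        exact_mod_cast (by omega : (j : ℕ) + m < 7)
    · intro n
      rw [← haz i n, Finset.mul_sum, map_sum]
      refine Finset.sum_congr rfl fun s _ => ?_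
      rw [mul_smul_comm, map_smul, smul_eq_mul]
      congr 1
      induction s using Sym2.ind with
      | _ x y =>
        rw [ncc_mk, hcc, hinv, Finset.mul_sum, map_sum]
        refine Finset.sum_congr rfl fun j _ => ?_
        rw [Finset.mul_sum, map_sum]
        refine Finset.sum_congr rfl fun m _ => ?_
        rw [mul_smul_comm, map_smul, ← pow_add, nLam_X, smul_eq_mul, mul_comm]

lemma nsj_K {n : Type} [Fintype n] [DecidableEq n] (S : Matrix n n k) (v : n → k)
    (hv : Matrix.vecMul v S = 0) (j : n) (hj : v j ≠ 0)
    (hd : (S.submatrix (Subtype.val : {i // i ≠ j} → n) Subtype.val).det = 0) :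
    ∃ x : n → k, x ≠ 0 ∧ x j = 0 ∧ S.mulVec x = 0 := by
  obtain ⟨x', hx0, hx⟩ := Matrix.exists_mulVec_eq_zero_iff.2 hd
  let x : n → k := fun i => if h : i ≠ j then x' ⟨i, h⟩ else 0
  have hxj : x j = 0 := by simp [x]
  have hxi : ∀ i : {i // i ≠ j}, x i = x' i := fun i => by simp [x, i.2]
  have h1 : ∀ i, S.mulVec x i = ∑ l : {i // i ≠ j}, S i l * x' l := by
    intro i
    rw [Matrix.mulVec, dotProduct, ← Fintype.sum_subtype_add_sum_subtype (fun l => l ≠ j)]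
    rw [add_eq_left.2]
    · exact Finset.sum_congr rfl fun l _ => by rw [hxi]
    · apply Finset.sum_eq_zero
      rintro ⟨l, hl⟩ _
      have : l = j := not_not.1 hl
      subst this
      rw [hxj, mul_zero]
  have h2 : ∀ i, i ≠ j → S.mulVec x i = 0 := by
    intro i hi
    rw [h1]
    exact congrFun hx ⟨i, hi⟩
  refine ⟨x, ?_, hxj, ?_⟩
  · intro h
    apply hx0
    funext i
    rw [← hxi, h]; rfl
  · have h3 : v ⬝ᵥ S.mulVec x = 0 := by
      rw [Matrix.dotProduct_mulVec, hv, zero_dotProduct]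
    rw [dotProduct, Finset.sum_eq_single j (fun b _ hb => by rw [h2 b hb, mul_zero]) (by simp)] at h3
    funext i
    by_cases hi : i = j
    · rw [hi]; exact (mul_eq_zero.1 h3).resolve_left hj
    · exact h2 i hi

lemma nsj_skew {n : Type} [Fintype n] [DecidableEq n] (h2 : (2 : k) ≠ 0) (S : Matrix n n k)
    (hS : S.transpose = -S) (hn : Odd (Fintype.card n)) : S.det = 0 := by
  have h1 : S.det = - S.det := by
    conv_lhs => rw [← Matrix.det_transpose, hS, Matrix.det_neg, hn.neg_one_pow]
    ring
  have : 2 * S.det = 0 := by linear_combination h1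
  exact (mul_eq_zero.1 this).resolve_left h2

lemma nsj_pencil [IsAlgClosed k] {n : Type} [Fintype n] [DecidableEq n] [Nonempty n] (A B : Matrix n n k) :
    ∃ s t : k, ¬ (s = 0 ∧ t = 0) ∧ (s • A + t • B).det = 0 := by
  by_cases hB : B.det = 0
  · exact ⟨0, 1, by simp, by simpa using hB⟩
  · obtain ⟨c, hc⟩ := Module.End.exists_eigenvalue (Matrix.toLin' (B⁻¹ * A))
    obtain ⟨v, hv⟩ := hc.exists_hasEigenvector
    refine ⟨1, -c, by simp, ?_⟩
    rw [← Matrix.exists_mulVec_eq_zero_iff]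
    refine ⟨v, hv.2, ?_⟩
    have h1 := hv.apply_eq_smul
    rw [Matrix.toLin'_apply, ← Matrix.mulVec_mulVec] at h1
    have h3 : A.mulVec v = c • B.mulVec v := by
      rw [← Matrix.mulVec_smul, ← h1, Matrix.mulVec_mulVec, Matrix.mul_nonsing_inv _ (Ne.isUnit hB), Matrix.one_mulVec]
    rw [Matrix.add_mulVec, Matrix.smul_mulVec, Matrix.smul_mulVec, h3]
    simp

/-- abstract compatible pairs: injectivity -/
lemma nsj_phi_inj [IsAlgClosed k] (μ : (Fin 3 → k) →ₗ[k] Matrix (Fin 4) (Fin 4) k)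
    (hs : ∀ m, (μ m).transpose = μ m)
    (hN : ∀ m, m ≠ 0 → ∀ n1 n2, (μ m).mulVec n1 = 0 → (μ m).mulVec n2 = 0 →
      ∃ x y : k, ¬ (x = 0 ∧ y = 0) ∧ x • n1 + y • n2 = 0)
    (φ : (Fin 3 → k) →ₗ[k] (Fin 4 → k)) (hφ : φ ≠ 0)
    (hc : ∀ m n, (μ m).mulVec (φ n) = (μ n).mulVec (φ m)) (m : Fin 3 → k) (hm : φ m = 0) : m = 0 := by
  by_contra hm0
  have h1 : ∀ n, (μ m).mulVec (φ n) = 0 := fun n => by rw [hc, hm, Matrix.mulVec_zero]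
  obtain ⟨n0, hn0⟩ : ∃ n0, φ n0 ≠ 0 := by
    by_contra h
    push Not at h
    exact hφ (LinearMap.ext h)
  set w := φ n0 with hw
  have h2 : ∀ n, φ n ∈ Submodule.span k {w} := by
    intro n
    obtain ⟨x, y, hxy, h⟩ := hN m hm0 (φ n) w (h1 n) (h1 n0)
    have hx : x ≠ 0 := by
      rintro rfl
      rw [zero_smul, zero_add] at h
      exact hxy ⟨rfl, (smul_eq_zero.1 h).resolve_right hn0⟩
    rw [Submodule.mem_span_singleton]
    refine ⟨-(x⁻¹ * y), ?_⟩
    have : φ n = x⁻¹ • (x • φ n) := by rw [smul_smul, inv_mul_cancel₀ hx, one_smul]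
    rw [this, eq_neg_of_add_eq_zero_left h]
    module
  have h3 : 2 ≤ Module.finrank k (LinearMap.ker φ) := by
    have e1 := LinearMap.finrank_range_add_finrank_ker φ
    have e2 : Module.finrank k (LinearMap.range φ) ≤ Module.finrank k (Submodule.span k {w}) := by
      apply Submodule.finrank_mono
      rintro _ ⟨n, rfl⟩
      exact h2 n
    rw [finrank_span_singleton hn0] at e2
    rw [Module.finrank_fintype_fun_eq_card, Fintype.card_fin] at e1
    omega
  obtain ⟨p1, p2, hp1, hp2, hp⟩ := nsj_two φ h3
  obtain ⟨j, hj⟩ : ∃ j, w j ≠ 0 := Function.ne_iff.1 hn0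
  have : Nonempty {i : Fin 4 // i ≠ j} := ⟨⟨j + 1, by simp⟩⟩
  obtain ⟨s, t, hst, hdet⟩ := nsj_pencil
    ((μ p1).submatrix (Subtype.val : {i : Fin 4 // i ≠ j} → Fin 4) Subtype.val)
    ((μ p2).submatrix (Subtype.val : {i : Fin 4 // i ≠ j} → Fin 4) Subtype.val)
  have hp0 : s • p1 + t • p2 ≠ 0 := fun h => hst (hp s t h)
  have hw0 : (μ (s • p1 + t • p2)).mulVec w = 0 := by
    rw [hw, hc, map_add, map_smul, map_smul, hp1, hp2]; simp
  obtain ⟨x, hx0, hxj, hx⟩ := nsj_K (μ (s • p1 + t • p2)) w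
    (by rw [← Matrix.mulVec_transpose, hs]; exact hw0) j hj (by
      rw [map_add, map_smul, map_smul]; exact hdet)
  obtain ⟨a, b, hab, h⟩ := hN _ hp0 w x hw0 hx
  have ha : a = 0 := by
    have := congrFun h j
    simp only [Pi.add_apply, Pi.smul_apply, hxj, smul_eq_mul, mul_zero, add_zero, Pi.zero_apply] at this
    exact (mul_eq_zero.1 this).resolve_right hj
  apply hab
  refine ⟨ha, ?_⟩
  rw [ha, zero_smul, zero_add] at h
  exact (smul_eq_zero.1 h).resolve_right hx0

lemma nsj_root [IsAlgClosed k] (x y z : k) : ∃ r : k, r ^ 3 - z * r ^ 2 - y * r - x = 0 := by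
  obtain ⟨r, hr⟩ := IsAlgClosed.exists_root
    (Polynomial.X ^ 3 - Polynomial.C z * Polynomial.X ^ 2 - Polynomial.C y * Polynomial.X - Polynomial.C x) (by
      have : (Polynomial.X ^ 3 - Polynomial.C z * Polynomial.X ^ 2 - Polynomial.C y * Polynomial.X - Polynomial.C x).degree = 3 := by
        compute_degree!
      rw [this]; decide)
  exact ⟨r, by simpa [Polynomial.IsRoot] using hr⟩

lemma nsj_root2 [IsAlgClosed k] (x y : k) : ∃ r : k, r ^ 2 - y * r - x = 0 := by
  obtain ⟨r, hr⟩ := IsAlgClosed.exists_root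
    (Polynomial.X ^ 2 - Polynomial.C y * Polynomial.X - Polynomial.C x) (by
      have : (Polynomial.X ^ 2 - Polynomial.C y * Polynomial.X - Polynomial.C x).degree = 2 := by
        compute_degree!
      rw [this]; decide)
  exact ⟨r, by simpa [Polynomial.IsRoot] using hr⟩

/-- Kronecker normal form of a `3 × 4` pencil without eigenvectors -/
lemma nsj_kron [IsAlgClosed k] (φ ψ : (Fin 3 → k) →ₗ[k] (Fin 4 → k))
    (h : ∀ x y : k, ∀ m, x • φ m + y • ψ m = 0 → m = 0 ∨ (x = 0 ∧ y = 0)) :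
    ∃ a : Fin 3 → Fin 3 → k, LinearIndependent k a ∧ φ (a 1) = ψ (a 0) ∧ φ (a 2) = ψ (a 1) ∧
      LinearIndependent k ![φ (a 0), φ (a 1), φ (a 2), ψ (a 2)] := by
  have hφ : ∀ m, φ m = 0 → m = 0 := fun m hm => by
    rcases h 1 0 m (by simp [hm]) with h | h
    · exact h
    · simp at h
  have hψ : ∀ m, ψ m = 0 → m = 0 := fun m hm => by
    rcases h 0 1 m (by simp [hm]) with h | h
    · exact h
    · simp at h
  have heig : ∀ (r : k) m, ψ m = r • φ m → m = 0 := fun r m hm => by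
    rcases h (-r) 1 m (by rw [hm]; module) with h | h
    · exact h
    · simp at h
  let V := Fin 3 → k
  let H : (V × V × V) →ₗ[k] ((Fin 4 → k) × (Fin 4 → k)) :=
    LinearMap.prod (φ ∘ₗ LinearMap.fst k V V ∘ₗ LinearMap.snd k V (V × V) - ψ ∘ₗ LinearMap.fst k V (V × V))
      (φ ∘ₗ LinearMap.snd k V V ∘ₗ LinearMap.snd k V (V × V) - ψ ∘ₗ LinearMap.fst k V V ∘ₗ LinearMap.snd k V (V × V))
  have hker : LinearMap.ker H ≠ ⊥ := by
    apply LinearMap.ker_ne_bot_of_finrank_lt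
    simp [V]
  obtain ⟨⟨a0, a1, a2⟩, hmem, hne⟩ := Submodule.exists_mem_ne_zero_of_ne_bot hker
  have hH : φ a1 - ψ a0 = 0 ∧ φ a2 - ψ a1 = 0 := Prod.mk.inj hmem
  have q1 : φ a1 = ψ a0 := sub_eq_zero.1 hH.1
  have q2 : φ a2 = ψ a1 := sub_eq_zero.1 hH.2
  have n0 : a0 ≠ 0 := by
    rintro rfl
    rw [map_zero] at q1
    have := hφ _ q1
    subst this
    rw [map_zero] at q2
    have := hφ _ q2
    subst this
    exact hne rfl
  have hli : ∀ x y z : k, x • a0 + y • a1 + z • a2 = 0 → x = 0 ∧ y = 0 ∧ z = 0 := by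
    have key1 : ∀ x y : k, x • a0 + y • a1 = 0 → x = 0 ∧ y = 0 := by
      intro x y hxy
      have hy : y = 0 := by
        by_contra hy
        apply n0
        apply heig (-(y⁻¹ * x))
        rw [← q1, ← map_smul]
        congr 1
        have : a1 = y⁻¹ • (y • a1) := by rw [smul_smul, inv_mul_cancel₀ hy, one_smul]
        rw [this, eq_neg_of_add_eq_zero_right hxy]; module
      rw [hy, zero_smul, add_zero] at hxy
      exact ⟨(smul_eq_zero.1 hxy).resolve_right n0, hy⟩
    intro x y z hxyz
    have hz : z = 0 := by
      by_contra hz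
      have ha2 : a2 = (-(z⁻¹ * x)) • a0 + (-(z⁻¹ * y)) • a1 := by
        have : a2 = z⁻¹ • (z • a2) := by rw [smul_smul, inv_mul_cancel₀ hz, one_smul]
        rw [this, eq_neg_of_add_eq_zero_right hxyz]; module
      generalize -(z⁻¹ * x) = x' at ha2
      generalize -(z⁻¹ * y) = y' at ha2
      obtain ⟨r, hr⟩ := nsj_root2 x' y'
      have hx' : x' = r * (r - y') := by linear_combination -hr
      have := heig r ((r - y') • a0 + a1) (by
        rw [map_add, map_smul, ← q1, ← q2, ha2, ← map_smul, ← map_add, ← map_smul]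
        congr 1
        rw [hx']; module)
      have := key1 (r - y') 1 (by rw [one_smul]; exact this)
      exact one_ne_zero this.2
    rw [hz, zero_smul, add_zero] at hxyz
    exact ⟨(key1 _ _ hxyz).1, (key1 _ _ hxyz).2, hz⟩
  refine ⟨![a0, a1, a2], ?_, q1, q2, ?_⟩
  · rw [Fintype.linearIndependent_iff]
    intro g hg
    rw [Fin.sum_univ_three] at hg
    obtain ⟨e0, e1, e2⟩ := hli _ _ _ hg
    intro i; fin_cases i <;> assumption
  · change LinearIndependent k ![φ a0, φ a1, φ a2, ψ a2]
    have hz : ∀ x y z : k, ψ a2 ≠ φ (x • a0 + y • a1 + z • a2) := by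
      intro x y z hxyz
      obtain ⟨r, hr⟩ := nsj_root x y z
      have hx' : x = r * (r * (r - z) - y) := by linear_combination -hr
      have := heig r ((r * (r - z) - y) • a0 + (r - z) • a1 + a2) (by
        rw [map_add, map_add, map_smul, map_smul, ← q1, ← q2, hxyz, ← map_smul, ← map_smul, ← map_add, ← map_add, ← map_smul]
        congr 1
        rw [hx']; module)
      have := hli (r * (r - z) - y) (r - z) 1 (by rw [one_smul (M := k) a2]; exact this)
      exact one_ne_zero this.2.2
    rw [Fintype.linearIndependent_iff]
    intro g hg
    rw [Fin.sum_univ_four] at hg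
    change g 0 • φ a0 + g 1 • φ a1 + g 2 • φ a2 + g 3 • ψ a2 = 0 at hg
    have h3 : g 3 = 0 := by
      by_contra h3
      apply hz (-((g 3)⁻¹ * g 0)) (-((g 3)⁻¹ * g 1)) (-((g 3)⁻¹ * g 2))
      have : ψ a2 = (g 3)⁻¹ • (g 3 • ψ a2) := by rw [smul_smul, inv_mul_cancel₀ h3, one_smul]
      rw [this, eq_neg_of_add_eq_zero_right hg]
      simp only [map_add, map_smul]; module
    rw [h3, zero_smul, add_zero, ← map_smul, ← map_smul, ← map_smul, ← map_add, ← map_add] at hg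
    obtain ⟨e0, e1, e2⟩ := hli _ _ _ (hφ _ hg)
    intro i; fin_cases i <;> assumption

/-- the 12 × 12 skew matrix of a net -/
def nS {R : Type} [CommRing R] (z : Fin 3 → NY → R) : Matrix (Fin 3 × Fin 4) (Fin 3 × Fin 4) R :=
  Matrix.of fun p q =>
    if q.1 = p.1 then 0 else if q.1 = p.1 + 1 then z (p.1 + 2) s(p.2, q.2) else - z (p.1 + 1) s(p.2, q.2)

lemma nS_skew {R : Type} [CommRing R] (z : Fin 3 → NY → R) : (nS z).transpose = - nS z := by
  ext ⟨i, a⟩ ⟨j, b⟩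
  simp only [nS, Matrix.transpose_apply, Matrix.neg_apply, Matrix.of_apply, Sym2.eq_swap (a := b) (b := a)]
  fin_cases i <;> fin_cases j <;> simp

def nmu (z : Fin 3 → NY → k) : (Fin 3 → k) →ₗ[k] Matrix (Fin 4) (Fin 4) k where
  toFun m := Matrix.of fun x y => ∑ i, m i * z i s(x, y)
  map_add' m n := by ext; simp [add_mul, Finset.sum_add_distrib]
  map_smul' c m := by ext; simp [Finset.mul_sum, mul_assoc]

def nmat (m : NY → k) : Matrix (Fin 4) (Fin 4) k := Matrix.of fun x y => m s(x, y)

lemma nmu_eq (z : Fin 3 → NY → k) (m : Fin 3 → k) : nmu z m = ∑ i, m i • nmat (z i) := by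
  ext x y
  simp [nmu, nmat, Matrix.sum_apply]

lemma nS_mulVec (z : Fin 3 → NY → k) (v : Fin 3 × Fin 4 → k) (hv : (nS z).mulVec v = 0) (i j : Fin 3) :
    (nmat (z i)).mulVec (fun b => v (j, b)) = (nmat (z j)).mulVec (fun b => v (i, b)) := by
  have h : ∀ i a, (∑ b, z (i + 2) s(a, b) * v (i + 1, b)) = ∑ b, z (i + 1) s(a, b) * v (i + 2, b) := by
    intro i a
    have h1 := congrFun hv (i, a)
    rw [Matrix.mulVec, dotProduct, Fintype.sum_prod_type, Fin.sum_univ_three] at h1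
    fin_cases i <;> simp [nS, Finset.sum_neg_distrib] at h1 ⊢ <;> linear_combination h1
  funext a
  change ∑ b, z i s(a, b) * v (j, b) = ∑ b, z j s(a, b) * v (i, b)
  have e0 := h 0 a
  have e1 := h 1 a
  have e2 := h 2 a
  simp only [zero_add, Fin.reduceAdd] at e0 e1 e2
  fin_cases i <;> fin_cases j <;> first | rfl | exact e0 | exact e0.symm | exact e1 | exact e1.symm | exact e2 | exact e2.symm

lemma nsj_bad_ker (h2 : (2 : k) ≠ 0) (h3 : (3 : k) ≠ 0) (z : Fin 3 → NY → k) (hz : LinearIndependent k z)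
    (m : Fin 3 → k) (hm : m ≠ 0) (n1 n2 : Fin 4 → k) (h1 : (nmu z m).mulVec n1 = 0) (h1' : (nmu z m).mulVec n2 = 0)
    (hn : LinearIndependent k ![n1, n2]) : nBad z := by
  obtain ⟨e1, he1⟩ := exists_linearIndependent_cons_of_lt_finrank hn (by simp)
  obtain ⟨e0, he⟩ := exists_linearIndependent_cons_of_lt_finrank he1 (by simp)
  obtain ⟨l, hl, hco⟩ := nsj_coordM _ he
  set e : Fin 4 → Fin 4 → k := Fin.cons e0 (Fin.cons e1 ![n1, n2]) with hedef
  let A : NY → k := fun s => ∑ i, m i * z i s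
  have hA : ∀ j, j = 2 ∨ j = 3 → ∀ x', ∑ y', A s(x', y') * e j y' = 0 := by
    rintro j (rfl | rfl) x'
    · exact congrFun h1 x'
    · exact congrFun h1' x'
  have hB1 : ∀ j n, n = 2 ∨ n = 3 → ∑ x', ∑ y', A s(x', y') * e j x' * e n y' = 0 := by
    intro j n hn
    apply Finset.sum_eq_zero; intro x' _
    have := congrArg (fun t => e j x' * t) (hA n hn x')
    simp only [Finset.mul_sum, mul_zero] at this
    rw [← this]
    exact Finset.sum_congr rfl fun _ _ => by ring
  have hsym : ∀ j n, ∑ x', ∑ y', A s(x', y') * e j x' * e n y' = ∑ x', ∑ y', A s(x', y') * e n x' * e j y' := by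
    intro j n
    rw [Finset.sum_comm]
    refine Finset.sum_congr rfl fun x _ => Finset.sum_congr rfl fun y _ => ?_
    rw [Sym2.eq_swap]; ring
  have hAe := hco A
  set b : Fin 4 → Fin 4 → k := fun j n => ∑ x', ∑ y', A s(x', y') * e j x' * e n y' with hb
  have hAf : A = fun s => b 0 0 * ncc (l 0) s + b 0 1 * nuv (l 0) (l 1) s + b 1 1 * ncc (l 1) s := by
    funext s
    induction s using Sym2.ind with
    | _ x y =>
      rw [hAe, ncc_mk, ncc_mk, nuv_mk]
      change ∑ j, ∑ n, b j n * (l j x * l n y) = _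
      have c1 : ∀ j, b j 2 = 0 := fun j => hB1 j 2 (Or.inl rfl)
      have c2 : ∀ j, b j 3 = 0 := fun j => hB1 j 3 (Or.inr rfl)
      have c3 : ∀ j n, b j n = b n j := hsym
      simp only [Fin.sum_univ_four, c1, c2, c3 2, c3 3]
      rw [c3 1 0]; ring
  have hA0 : A ≠ 0 := by
    intro h0
    apply hm
    funext i
    refine Fintype.linearIndependent_iff.1 hz m ?_ i
    rw [← h0]
    funext s
    simp [A, Finset.sum_apply]
  refine nsj_bad_rank2 h2 h3 z hz (l 0) (l 1) ?_ (b 0 0) (b 0 1) (b 1 1) ?_ ?_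
  · rw [Fintype.linearIndependent_iff]
    intro g hg
    rw [Fin.sum_univ_two] at hg
    have hgx : ∀ x, g 0 * l 0 x + g 1 * l 1 x = 0 := fun x => congrFun hg x
    have key : ∀ j, g 0 * (∑ x, l 0 x * e j x) + g 1 * (∑ x, l 1 x * e j x) = 0 := by
      intro j
      rw [Finset.mul_sum, Finset.mul_sum, ← Finset.sum_add_distrib]
      apply Finset.sum_eq_zero; intro x _
      linear_combination (e j x) * hgx x
    intro i
    fin_cases i
    · have := key 0
      rw [hl, hl] at this; simpa using this
    · have := key 1
      rw [hl, hl] at this; simpa using this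
  · rintro ⟨e1, e2, e3⟩
    apply hA0
    rw [hAf, e1, e2, e3]; funext s; simp
  · rw [← hAf]
    have : A = ∑ i, m i • z i := by funext s; simp [A, Finset.sum_apply]
    rw [this]
    exact Submodule.sum_mem _ fun i _ => Submodule.smul_mem _ _ (Submodule.subset_span ⟨i, rfl⟩)

lemma nsj_hankel_idx (b : Fin 3 → Fin 4 → Fin 4 → k) (hs : ∀ i j l, b i j l = b i l j)
    (hr : ∀ (i : Fin 2) (j : Fin 3) l, b i.succ j.castSucc l = b i.castSucc j.succ l) :
    ∃ c : ℕ → k, ∀ i j l, b i j l = c (i + (j + l)) := by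
  have r00 := fun l => hr 0 0 l
  have r01 := fun l => hr 0 1 l
  have r02 := fun l => hr 0 2 l
  have r10 := fun l => hr 1 0 l
  have r11 := fun l => hr 1 1 l
  have r12 := fun l => hr 1 2 l
  change ∀ l, b 1 0 l = b 0 1 l at r00
  change ∀ l, b 1 1 l = b 0 2 l at r01
  change ∀ l, b 1 2 l = b 0 3 l at r02
  change ∀ l, b 2 0 l = b 1 1 l at r10
  change ∀ l, b 2 1 l = b 1 2 l at r11
  change ∀ l, b 2 2 l = b 1 3 l at r12
  have t0 : ∀ i, b i 3 0 = b i 0 3 := fun i => hs i 3 0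
  have t1 : ∀ i, b i 3 1 = b i 1 3 := fun i => hs i 3 1
  have t2 : ∀ i, b i 3 2 = b i 2 3 := fun i => hs i 3 2
  have u1 : b 0 1 0 = b 0 0 1 := hs _ _ _
  have u2 : b 0 2 0 = b 0 0 2 := hs _ _ _
  have u3 : b 0 2 1 = b 0 1 2 := hs _ _ _
  have w1 : b 0 1 1 = b 0 0 2 := by rw [← r00, hs, r01, u2]
  have w2 : b 0 1 2 = b 0 0 3 := by rw [← r00, hs, r02, t0]
  have w3 : b 0 2 2 = b 0 1 3 := by rw [← r01, hs, r02, t1]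
  refine ⟨fun n => if n = 0 then b 0 0 0 else if n = 1 then b 0 0 1 else if n = 2 then b 0 0 2 else
    if n = 3 then b 0 0 3 else if n = 4 then b 0 1 3 else if n = 5 then b 0 2 3 else if n = 6 then b 0 3 3 else
    if n = 7 then b 1 3 3 else b 2 3 3, fun i j l => ?_⟩
  fin_cases i <;> fin_cases j <;> fin_cases l <;>
    simp [r00, r01, r02, r10, r11, r12, t0, t1, t2, u1, u2, u3, w1, w2, w3]

lemma nsj_bad_det [IsAlgClosed k] (h2 : (2 : k) ≠ 0) (h3 : (3 : k) ≠ 0) (z : Fin 3 → NY → k)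
    (hdet : (nS z).det = 0) : nBad z := by
  classical
  by_cases hz : LinearIndependent k z
  swap
  · exact nsj_bad_dep h2 h3 z hz
  by_contra hbad
  have hN : ∀ m, m ≠ 0 → ∀ n1 n2, (nmu z m).mulVec n1 = 0 → (nmu z m).mulVec n2 = 0 →
      ∃ x y : k, ¬ (x = 0 ∧ y = 0) ∧ x • n1 + y • n2 = 0 := by
    intro m hm n1 n2 e1 e2
    by_contra hcon
    push Not at hcon
    apply hbad
    apply nsj_bad_ker h2 h3 z hz m hm n1 n2 e1 e2
    rw [Fintype.linearIndependent_iff]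
    intro g hg
    rw [Fin.sum_univ_two] at hg
    by_contra hne
    refine hcon (g 0) (g 1) (fun h0 => ?_) hg
    by_contra h1
    exact hne fun i => by fin_cases i <;> assumption
  have hs : ∀ m, (nmu z m).transpose = nmu z m := by
    intro m
    ext x y
    simp [nmu, Sym2.eq_swap (a := x) (b := y)]
  let ph : (Fin 3 × Fin 4 → k) → ((Fin 3 → k) →ₗ[k] (Fin 4 → k)) := fun v =>
    Fintype.linearCombination k (fun i => fun b => v (i, b))
  have hph : ∀ v i, ph v (Pi.single i 1) = fun b => v (i, b) := by
    intro v i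
    simp [ph, Fintype.linearCombination_apply_single]
  have hphne : ∀ v, v ≠ 0 → ph v ≠ 0 := by
    intro v hv h0
    apply hv
    funext ⟨i, b⟩
    have := congrFun (hph v i) b
    rw [h0] at this
    exact this.symm
  have hphc : ∀ v, (nS z).mulVec v = 0 → ∀ m n, (nmu z m).mulVec (ph v n) = (nmu z n).mulVec (ph v m) := by
    intro v hv m n
    have e : ∀ m n, (nmu z m).mulVec (ph v n) = ∑ i, ∑ j, (m i * n j) • (nmat (z i)).mulVec (fun b => v (j, b)) := by
      intro m n
      rw [nmu_eq, Fintype.linearCombination_apply, Matrix.sum_mulVec]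
      refine Finset.sum_congr rfl fun i _ => ?_
      rw [Matrix.mulVec_sum]
      refine Finset.sum_congr rfl fun j _ => ?_
      rw [Matrix.smul_mulVec, Matrix.mulVec_smul, smul_smul]
    rw [e, e, Finset.sum_comm]
    refine Finset.sum_congr rfl fun i _ => Finset.sum_congr rfl fun j _ => ?_
    rw [nS_mulVec z v hv j i, mul_comm]
  have hinj : ∀ v, v ≠ 0 → (nS z).mulVec v = 0 → ∀ m, ph v m = 0 → m = 0 := fun v hv hv0 m hm =>
    nsj_phi_inj (nmu z) hs hN (ph v) (hphne v hv) (hphc v hv0) m hm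
  obtain ⟨v, hv, hv0⟩ := Matrix.exists_mulVec_eq_zero_iff.2 hdet
  obtain ⟨j, hj⟩ : ∃ j, v j ≠ 0 := Function.ne_iff.1 hv
  obtain ⟨x, hx, hxj, hx0⟩ := nsj_K (nS z) v (by
      rw [← Matrix.mulVec_transpose, nS_skew, Matrix.neg_mulVec, hv0, neg_zero]) j hj (by
      apply nsj_skew h2
      · rw [Matrix.transpose_submatrix, nS_skew]; rfl
      · have hcard : Fintype.card {i // i ≠ j} = 11 := by
          rw [Fintype.card_subtype_compl, Fintype.card_subtype_eq]
          simp
        rw [hcard]; decide)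
  have hlin : ∀ s t : k, ∀ m, ph (s • v + t • x) m = s • ph v m + t • ph x m := by
    intro s t m
    simp only [ph, Fintype.linearCombination_apply, Finset.smul_sum]
    rw [← Finset.sum_add_distrib]
    refine Finset.sum_congr rfl fun i _ => ?_
    funext b
    simp only [Pi.smul_apply, Pi.add_apply, smul_eq_mul]; ring
  have hkr : ∀ s t : k, ∀ m, s • ph v m + t • ph x m = 0 → m = 0 ∨ (s = 0 ∧ t = 0) := by
    intro s t m hm
    by_cases h0 : s • v + t • x = 0
    · right
      have hs0 : s = 0 := by
        have := congrFun h0 j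
        simp only [Pi.add_apply, Pi.smul_apply, hxj, smul_eq_mul, mul_zero, add_zero, Pi.zero_apply] at this
        exact (mul_eq_zero.1 this).resolve_right hj
      refine ⟨hs0, ?_⟩
      rw [hs0, zero_smul, zero_add] at h0
      exact (smul_eq_zero.1 h0).resolve_right hx
    · left
      apply hinj _ h0 _ m
      · rw [hlin, hm]
      · rw [Matrix.mulVec_add, Matrix.mulVec_smul, Matrix.mulVec_smul, hv0, hx0]; simp
  obtain ⟨a, ha, q1, q2, he⟩ := nsj_kron (ph v) (ph x) hkr
  set e : Fin 4 → Fin 4 → k := ![ph v (a 0), ph v (a 1), ph v (a 2), ph x (a 2)] with hedef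
  let A : Fin 3 → NY → k := fun i s => ∑ j, a i j * z j s
  have hAe : ∀ i, nmu z (a i) = nmat (A i) := fun i => rfl
  have hAz : ∀ i, A i = Fintype.linearCombination k z (a i) := by
    intro i; funext s; simp [A, Fintype.linearCombination_apply, Finset.sum_apply]
  have hA : LinearIndependent k A := by
    have h1 := ha.map' (Fintype.linearCombination k z)
      (LinearMap.ker_eq_bot.2 hz.fintypeLinearCombination_injective)
    have : A = (Fintype.linearCombination k z) ∘ a := funext hAz
    rw [this]; exact h1
  have hsp : Submodule.span k (Set.range A) = Submodule.span k (Set.range z) := by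
    apply Submodule.eq_of_le_of_finrank_eq
    · rw [Submodule.span_le]
      rintro _ ⟨i, rfl⟩
      rw [hAz, Fintype.linearCombination_apply]
      exact Submodule.sum_mem _ fun i _ => Submodule.smul_mem _ _ (Submodule.subset_span ⟨i, rfl⟩)
    · rw [finrank_span_eq_card hA, finrank_span_eq_card hz]
  have hrule : ∀ (i : Fin 2) (j : Fin 3), (nmu z (a i.succ)).mulVec (e j.castSucc) = (nmu z (a i.castSucc)).mulVec (e j.succ) := by
    intro i j
    have p1 : e j.castSucc = ph v (a j) := by fin_cases j <;> rfl
    have p2 : e j.succ = ph x (a j) := by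
      fin_cases j
      · exact q1
      · exact q2
      · rfl
    have p3 : ph v (a i.succ) = ph x (a i.castSucc) := by
      fin_cases i
      · exact q1
      · exact q2
    rw [p1, p2, hphc v hv0, p3, hphc x hx0]
  obtain ⟨c, hc⟩ := nsj_hankel_idx (fun i j l => ∑ x', ∑ y', A i s(x', y') * e j x' * e l y')
    (by
      intro i j l
      rw [Finset.sum_comm]
      refine Finset.sum_congr rfl fun x _ => Finset.sum_congr rfl fun y _ => ?_
      rw [Sym2.eq_swap]; ring)
    (by
      intro i j l
      have t : ∀ i j, ∑ x', ∑ y', A i s(x', y') * e j x' * e l y' = ∑ y', e l y' * (nmu z (a i)).mulVec (e j) y' := by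
        intro i j
        rw [Finset.sum_comm]
        refine Finset.sum_congr rfl fun y _ => ?_
        rw [hAe, Matrix.mulVec, dotProduct, Finset.mul_sum]
        refine Finset.sum_congr rfl fun x' _ => ?_
        simp only [nmat, Matrix.of_apply]
        rw [Sym2.eq_swap]; ring
      rw [t, t, hrule])
  apply hbad
  refine nBad_anti (z' := A) ?_ (nsj_bad_hankel h2 h3 A hA e he c hc)
  intro i
  rw [hsp]
  exact Submodule.subset_span ⟨i, rfl⟩

lemma nsj_prin {S : Type} [CommRing S] [IsDomain S] [UniqueFactorizationMonoid S] (q : Ideal (Polynomial S))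
    (hq : q.IsPrime) (hne : q ≠ ⊥) (h0 : ∀ a, Polynomial.C a ∈ q → a = 0) :
    ∃ f ∈ q, f ≠ 0 ∧ ∀ g ∈ q, f ∣ g := by
  classical
  have hex : ∃ n, ∃ f ∈ q, f ≠ 0 ∧ f.natDegree = n := by
    obtain ⟨f, hf, hf0⟩ := Submodule.exists_mem_ne_zero_of_ne_bot hne
    exact ⟨_, f, hf, hf0, rfl⟩
  obtain ⟨f0, hf0, hf00, hd⟩ := Nat.find_spec hex
  have hmin : ∀ g ∈ q, g ≠ 0 → Nat.find hex ≤ g.natDegree := fun g hg hg0 => Nat.find_min' hex ⟨g, hg, hg0, rfl⟩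
  set d := Nat.find hex
  obtain ⟨f, hfp, hfq, hff⟩ : ∃ f, Prime f ∧ f ∈ q ∧ f ∣ f0 := by
    obtain ⟨s, hs, hsp⟩ := UniqueFactorizationMonoid.exists_prime_factors f0 hf00
    have h1 : s.prod ∈ q := by
      obtain ⟨u, hu⟩ := hsp.symm
      rw [← hu]; exact q.mul_mem_right _ hf0
    obtain ⟨f, hf, hfq⟩ := (hq.multiset_prod_mem_iff_exists_mem s).1 h1
    exact ⟨f, hs f hf, hfq, (Multiset.dvd_prod hf).trans hsp.dvd⟩
  have hfd : f.natDegree = d := by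
    apply le_antisymm
    · rw [← hd]; exact Polynomial.natDegree_le_of_dvd hff hf00
    · exact hmin f hfq hfp.ne_zero
  have hlc : ¬ f ∣ Polynomial.C f.leadingCoeff := by
    intro h
    have h1 := q.mem_of_dvd h hfq
    have h2 := h0 _ h1
    exact hfp.ne_zero (Polynomial.leadingCoeff_eq_zero.1 h2)
  refine ⟨f, hfq, hfp.ne_zero, ?_⟩
  have main : ∀ n, ∀ g ∈ q, g.natDegree < n → f ∣ g := by
    intro n
    induction n with
    | zero => intro g _ h; omega
    | succ n ih =>
      intro g hg hgn
      by_cases hg0 : g = 0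
      · rw [hg0]; exact dvd_zero _
      have hge := hmin g hg hg0
      let g' := Polynomial.C f.leadingCoeff * g - Polynomial.C g.leadingCoeff * Polynomial.X ^ (g.natDegree - d) * f
      have hg' : g' ∈ q := q.sub_mem (q.mul_mem_left _ hg) (q.mul_mem_left _ hfq)
      have hdvd : f ∣ g' := by
        by_cases hg'0 : g' = 0
        · rw [hg'0]; exact dvd_zero _
        have hle : g'.natDegree ≤ g.natDegree := by
          refine (Polynomial.natDegree_sub_le _ _).trans (max_le ?_ ?_)
          · exact Polynomial.natDegree_C_mul_le _ _
          · rw [mul_assoc]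
            refine (Polynomial.natDegree_C_mul_le _ _).trans ?_
            refine (Polynomial.natDegree_mul_le).trans ?_
            rw [Polynomial.natDegree_X_pow, hfd]; omega
        have hco : g'.coeff g.natDegree = 0 := by
          simp only [g', Polynomial.coeff_sub, Polynomial.coeff_C_mul, mul_assoc]
          have : Polynomial.coeff (Polynomial.X ^ (g.natDegree - d) * f) g.natDegree = f.leadingCoeff := by
            rw [Polynomial.coeff_X_pow_mul', if_pos (by omega), Polynomial.leadingCoeff, hfd]
            congr 1; omega
          rw [this, Polynomial.leadingCoeff, Polynomial.leadingCoeff]; ring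
        rcases Nat.lt_or_ge g'.natDegree n with h | h
        · exact ih g' hg' h
        · exfalso
          have he : g'.natDegree = g.natDegree := by omega
          rw [← he] at hco
          exact hg'0 (Polynomial.leadingCoeff_eq_zero.1 hco)
      have h2 : f ∣ Polynomial.C f.leadingCoeff * g := by
        have := dvd_add hdvd (Dvd.intro_left (Polynomial.C g.leadingCoeff * Polynomial.X ^ (g.natDegree - d)) rfl)
        simpa [g'] using this
      exact (hfp.dvd_or_dvd h2).resolve_left hlc
  exact fun g hg => main _ g hg (Nat.lt_succ_self _)

lemma nsj_solve [IsAlgClosed k] (h2 : (2 : k) ≠ 0) (C : NY → k) (h33 : C s(3, 3) ≠ 0)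
    (hd : C s(2, 3) ^ 2 - C s(3, 3) * C s(2, 2) ≠ 0) :
    ∃ (u v : Fin 4 → k) (s t : k), ∀ x, x ≠ s(1, 1) →
      C x = nuv u v x + s * (Pi.single s(0, 0) 1 : NY → k) x + t * (Pi.single s(0, 1) 1 : NY → k) x := by
  obtain ⟨r, hr⟩ := nsj_root2 (-(C s(2, 2) / C s(3, 3))) (2 * C s(2, 3) / C s(3, 3))
  have hr' : C s(3, 3) * r ^ 2 - 2 * C s(2, 3) * r + C s(2, 2) = 0 := by
    field_simp at hr; linear_combination hr
  set δ := C s(2, 3) - r * C s(3, 3) with hδ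
  have hδ2 : δ ^ 2 = C s(2, 3) ^ 2 - C s(3, 3) * C s(2, 2) := by
    rw [hδ]; linear_combination C s(3, 3) * hr'
  have hδ0 : δ ≠ 0 := by
    intro h; apply hd; rw [← hδ2, h]; ring
  obtain ⟨u0, e0⟩ : ∃ u0, u0 * δ = C s(0, 2) - r * C s(0, 3) := ⟨_, div_mul_cancel₀ _ hδ0⟩
  obtain ⟨u1, e1⟩ : ∃ u1, u1 * δ = C s(1, 2) - r * C s(1, 3) := ⟨_, div_mul_cancel₀ _ hδ0⟩
  obtain ⟨m, hm⟩ : ∃ m, 2 * m = C s(3, 3) := ⟨_, mul_div_cancel₀ _ h2⟩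
  let u : Fin 4 → k := ![u0, u1, r, 1]
  let v : Fin 4 → k := ![C s(0, 3) - u0 * m, C s(1, 3) - u1 * m, C s(2, 3) - r * m, m]
  refine ⟨u, v, C s(0, 0) - nuv u v s(0, 0), C s(0, 1) - nuv u v s(0, 1), ?_⟩
  have key : ∀ i j : Fin 4, i ≤ j → ¬ (i = 1 ∧ j = 1) → C s(i, j) = nuv u v s(i, j)
    + (C s(0, 0) - nuv u v s(0, 0)) * (if s(i, j) = (s(0, 0) : NY) then 1 else 0)
    + (C s(0, 1) - nuv u v s(0, 1)) * (if s(i, j) = (s(0, 1) : NY) then 1 else 0) := by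
    intro i j hij hne
    simp only [nuv_mk]
    fin_cases i <;> fin_cases j <;> first | (exfalso; revert hij; decide) | (exfalso; exact hne ⟨rfl, rfl⟩) | skip
    all_goals simp [u, v]
    · linear_combination -e0 + u0 * hδ + u0 * r * hm
    · linear_combination -e1 + u1 * hδ + u1 * r * hm
    · linear_combination hr' + r ^ 2 * hm
    · linear_combination -hm
  intro x hx
  simp only [Pi.single_apply]
  induction x using Sym2.ind with
  | _ i j =>
    rcases le_total i j with h | h
    · exact key i j h (by rintro ⟨rfl, rfl⟩; exact hx rfl)
    · rw [Sym2.eq_swap]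
      exact key j i h (by rintro ⟨rfl, rfl⟩; exact hx rfl)

def nuvz (A B : NY → k) (u v : Fin 4 → k) (s t : k) : Fin 3 → NY → k :=
  ![A, B, fun i => nuv u v i + s * A i + t * B i]

lemma nsj_poly_zero [Infinite k] (p : Polynomial k) (h : ∀ x, x ≠ 0 → p.eval x = 0) (x : k) : p.eval x = 0 := by
  have hp : Polynomial.X * p = 0 := by
    apply Polynomial.funext
    intro y
    rw [Polynomial.eval_mul, Polynomial.eval_X, Polynomial.eval_zero]
    by_cases hy : y = 0
    · rw [hy, zero_mul]
    · rw [h y hy, mul_zero]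
  rw [(mul_eq_zero.1 hp).resolve_left Polynomial.X_ne_zero, Polynomial.eval_zero]

lemma nsj_ev2 (H : Polynomial (MvPolynomial NY k)) (c : NY → Polynomial k) (x : k) :
    Polynomial.eval x (Polynomial.eval₂ (eval₂Hom Polynomial.C c) Polynomial.X H)
      = Polynomial.eval₂ (eval (fun s => (c s).eval x)) x H := by
  have h1 := Polynomial.hom_eval₂ H (eval₂Hom Polynomial.C c) (Polynomial.evalRingHom x) Polynomial.X
  rw [Polynomial.coe_evalRingHom, Polynomial.eval_X] at h1
  rw [h1]
  congr 1
  apply MvPolynomial.ringHom_ext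
  · intro r; simp
  · intro i; simp

lemma nsj_indep [IsAlgClosed k] (h2 : (2 : k) ≠ 0) (g : MvPolynomial NZ k)
    (hg : ∀ A B C C' : NY → k, (∀ s, s ≠ s(1, 1) → C s = C' s) → nev ![A, B, C] g = nev ![A, B, C'] g)
    (hz : ∀ A B u v s t, nev (nuvz A B u v s t) g = 0) : g = 0 := by
  classical
  have : Infinite k := IsAlgClosed.instInfinite
  by_contra hg0
  obtain ⟨z, hzne⟩ : ∃ z : NZ → k, eval z g ≠ 0 := by
    by_contra h; push Not at h
    exact hg0 (MvPolynomial.funext fun z => by rw [h, map_zero])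
  let E0 : NY → k := Pi.single s(0, 0) 1
  let E1 : NY → k := Pi.single s(0, 1) 1
  let A : k → NY → k := fun x s => E0 s + x * (z (0, s) - E0 s)
  let B : k → NY → k := fun x s => E1 s + x * (z (1, s) - E1 s)
  let cf : NZ → Polynomial (MvPolynomial NY k) := fun i =>
    if i.1 = 0 then Polynomial.C (C (E0 i.2)) + Polynomial.X * Polynomial.C (C (z (0, i.2) - E0 i.2))
    else if i.1 = 1 then Polynomial.C (C (E1 i.2)) + Polynomial.X * Polynomial.C (C (z (1, i.2) - E1 i.2))
    else Polynomial.C (X i.2)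
  let G : Polynomial (MvPolynomial NY k) := eval₂Hom (Polynomial.C.comp C) cf g
  have hG : ∀ x Cc, Polynomial.eval₂ (eval Cc) x G = nev ![A x, B x, Cc] g := by
    intro x Cc
    have : (Polynomial.eval₂RingHom (eval Cc) x).comp (eval₂Hom (Polynomial.C.comp C) cf) = nev ![A x, B x, Cc] := by
      apply MvPolynomial.ringHom_ext
      · intro r; simp [nev]
      · rintro ⟨i, s⟩
        fin_cases i <;> simp [nev, cf, A, B]
    exact DFunLike.congr_fun this g
  have hG0 : G ≠ 0 := by
    intro h0
    have h1 := hG 1 (fun s => z (2, s))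
    rw [h0, Polynomial.eval₂_zero] at h1
    apply hzne
    rw [h1]
    unfold nev
    congr 2
    funext ⟨i, s⟩
    fin_cases i <;> simp [A, B]
  obtain ⟨H, hH, hdvd⟩ := Polynomial.exists_eq_pow_rootMultiplicity_mul_and_not_dvd G hG0 0
  generalize Polynomial.rootMultiplicity 0 G = n at hH
  rw [map_zero, sub_zero] at hH hdvd
  rw [Polynomial.X_dvd_iff] at hdvd
  have hGH : ∀ x Cc, nev ![A x, B x, Cc] g = x ^ n * Polynomial.eval₂ (eval Cc) x H := by
    intro x Cc
    rw [← hG, hH, Polynomial.eval₂_mul, Polynomial.eval₂_X_pow]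
  set h := H.coeff 0 with hh
  have hH0 : ∀ Cc, Polynomial.eval₂ (eval Cc) 0 H = eval Cc h := fun Cc => by
    rw [Polynomial.eval₂_at_zero]
  have key : ∀ c : NY → Polynomial k, (∀ x, x ≠ 0 → nev ![A x, B x, fun s => (c s).eval x] g = 0) →
      eval (fun s => (c s).eval 0) h = 0 := by
    intro c hc
    rw [← hH0, ← nsj_ev2]
    apply nsj_poly_zero
    intro x hx
    rw [nsj_ev2]
    have := hc x hx
    rw [hGH] at this
    exact (mul_eq_zero.1 this).resolve_left (pow_ne_zero _ hx)
  have hvan : ∀ u v s t, eval (fun i => nuv u v i + s * E0 i + t * E1 i) h = 0 := by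
    intro u v s t
    have := key (fun i => Polynomial.C (nuv u v i) + Polynomial.C s * (Polynomial.C (E0 i) + Polynomial.X * Polynomial.C (z (0, i) - E0 i))
      + Polynomial.C t * (Polynomial.C (E1 i) + Polynomial.X * Polynomial.C (z (1, i) - E1 i))) (by
        intro x hx
        have := hz (A x) (B x) u v s t
        rw [← this]
        congr 2
        simp [nuvz, A, B])
    simpa using this
  have hind : ∀ C C' : NY → k, (∀ s, s ≠ s(1, 1) → C s = C' s) → eval C h = eval C' h := by
    intro C C' hCC
    rw [← hH0, ← hH0, ← sub_eq_zero]
    have e := fun (C : NY → k) (x : k) => nsj_ev2 H (fun s => Polynomial.C (C s)) x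
    simp only [Polynomial.eval_C] at e
    have e' : ∀ (C : NY → k) (x : k), Polynomial.eval₂ (eval C) x H = Polynomial.eval₂ (eval fun s => C s) x H := fun _ _ => rfl
    rw [e' C, e' C', ← e, ← e, ← Polynomial.eval_sub]
    apply nsj_poly_zero
    intro x hx
    rw [Polynomial.eval_sub, e, e]
    have := hg (A x) (B x) C C' hCC
    rw [hGH, hGH] at this
    rw [sub_eq_zero]
    exact mul_left_cancel₀ (pow_ne_zero _ hx) this
  have hP : h * (X s(3, 3) * (X s(2, 3) ^ 2 - X s(3, 3) * X s(2, 2))) ≠ (0 : MvPolynomial NY k) := by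
    refine mul_ne_zero hdvd (mul_ne_zero (X_ne_zero _) ?_)
    intro h0
    have := congrArg (eval (fun s : NY => if s = s(2, 3) then (1 : k) else 0)) h0
    have hne : ¬ (s(3, 3) : NY) = s(2, 3) := by decide
    simp [hne] at this
  obtain ⟨Cc, hCc⟩ : ∃ Cc : NY → k, eval Cc (h * (X s(3, 3) * (X s(2, 3) ^ 2 - X s(3, 3) * X s(2, 2)))) ≠ 0 := by
    by_contra h'; push Not at h'
    exact hP (MvPolynomial.funext fun z => by rw [h', map_zero])
  simp only [map_mul, map_sub, map_pow, eval_X, mul_ne_zero_iff] at hCc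
  obtain ⟨u, v, s, t, hsol⟩ := nsj_solve h2 Cc hCc.2.1 hCc.2.2
  apply hCc.1
  rw [hind Cc _ hsol]
  exact hvan u v s t

lemma nsj_chow [IsAlgClosed k] (h2 : (2 : k) ≠ 0) (h3 : (3 : k) ≠ 0) (z0 : Fin 3 → NY → k) (hz0 : ¬ nBad z0) :
    ∃ F : MvPolynomial NZ k, (∀ A B u v s t, nev (nuvz A B u v s t) F = 0) ∧ ∀ z, nev z F = 0 → nBad z := by
  classical
  have : Infinite k := IsAlgClosed.instInfinite
  let P := NY ⊕ NY ⊕ Fin 4 ⊕ Fin 4 ⊕ Fin 2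
  let U : Fin 4 → MvPolynomial P k := fun i => X (Sum.inr (Sum.inr (Sum.inl i)))
  let V : Fin 4 → MvPolynomial P k := fun i => X (Sum.inr (Sum.inr (Sum.inr (Sum.inl i))))
  let W : Fin 2 → MvPolynomial P k := fun i => X (Sum.inr (Sum.inr (Sum.inr (Sum.inr i))))
  let a : NY → MvPolynomial P k := fun s => X (Sum.inl s)
  let b : NY → MvPolynomial P k := fun s => X (Sum.inr (Sum.inl s))
  let ρ : MvPolynomial NZ k →+* MvPolynomial P k := eval₂Hom C (fun i : NZ =>
    if i.1 = 0 then a i.2 else if i.1 = 1 then b i.2 else nuv U V i.2 + W 0 * a i.2 + W 1 * b i.2)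
  have hev : ∀ (y : P → k) (g : MvPolynomial NZ k), eval y (ρ g) =
      nev (nuvz (fun s => y (Sum.inl s)) (fun s => y (Sum.inr (Sum.inl s)))
        (fun i => y (Sum.inr (Sum.inr (Sum.inl i)))) (fun i => y (Sum.inr (Sum.inr (Sum.inr (Sum.inl i)))))
        (y (Sum.inr (Sum.inr (Sum.inr (Sum.inr 0))))) (y (Sum.inr (Sum.inr (Sum.inr (Sum.inr 1)))))) g := by
    intro y g
    have : (eval y).comp ρ = nev (nuvz (fun s => y (Sum.inl s)) (fun s => y (Sum.inr (Sum.inl s)))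
        (fun i => y (Sum.inr (Sum.inr (Sum.inl i)))) (fun i => y (Sum.inr (Sum.inr (Sum.inr (Sum.inl i)))))
        (y (Sum.inr (Sum.inr (Sum.inr (Sum.inr 0))))) (y (Sum.inr (Sum.inr (Sum.inr (Sum.inr 1)))))) := by
      apply MvPolynomial.ringHom_ext
      · intro r; simp [nev, ρ]
      · rintro ⟨i, s⟩
        induction s using Sym2.ind with
        | _ i' j' => fin_cases i <;> simp [nev, ρ, nuvz, a, b, U, V, W, nuv_mk]
    exact DFunLike.congr_fun this g
  have hmem : ∀ g, ρ g = 0 ↔ ∀ A B u v s t, nev (nuvz A B u v s t) g = 0 := by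
    intro g
    constructor
    · intro h A B u v s t
      have := hev (Sum.elim A (Sum.elim B (Sum.elim u (Sum.elim v ![s, t])))) g
      rw [h, map_zero] at this
      exact this.symm
    · intro h
      apply MvPolynomial.funext
      intro y
      rw [hev, h, map_zero]
  have hdvdex : ∀ z, ¬ nBad z → ∃ g, nev z g ≠ 0 ∧ ρ g = 0 := by
    intro z hz
    have hli : LinearIndependent k z := by
      by_contra h; exact hz (nsj_bad_dep h2 h3 z h)
    obtain ⟨g, hg, hgz⟩ := nsj_semicont h2 h3 z (by
      have := hli.comp (![0, 1] : Fin 2 → Fin 3) (by decide)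
      convert this using 1
      funext i; fin_cases i <;> rfl) (not_le.1 hz)
    refine ⟨g, hg, (hmem g).2 fun A B u v s t => hgz _ (nsj_bad_uv h2 h3 A B u v s t)⟩
  let c11 : NZ := (2, s(1, 1))
  let S := {x : NZ // x ≠ c11}
  let Φ : MvPolynomial NZ k ≃ₐ[k] Polynomial (MvPolynomial S k) :=
    (renameEquiv k (Equiv.optionSubtypeNe c11).symm).trans (optionEquivLeft k S)
  let q : Ideal (Polynomial (MvPolynomial S k)) := RingHom.ker (ρ.comp (Φ.symm : Polynomial (MvPolynomial S k) →+* MvPolynomial NZ k))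
  have hqmem : ∀ f, f ∈ q ↔ ρ (Φ.symm f) = 0 := fun f => Iff.rfl
  have hne : q ≠ ⊥ := by
    obtain ⟨g, hg, hgρ⟩ := hdvdex z0 hz0
    intro hb
    have h1 : Φ g ∈ q := by rw [hqmem, AlgEquiv.symm_apply_apply]; exact hgρ
    rw [hb, Ideal.mem_bot] at h1
    have : g = 0 := by simpa using h1
    rw [this, map_zero] at hg; exact hg rfl
  obtain ⟨f, hfq, hf0, hfd⟩ := nsj_prin q (RingHom.ker_isPrime _) hne (by
    intro p hp
    rw [hqmem] at hp
    have e1 : Φ.symm (Polynomial.C p) = rename Subtype.val p := by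
      rw [AlgEquiv.symm_apply_eq]
      have : (((Φ : MvPolynomial NZ k →+* Polynomial (MvPolynomial S k)).comp (rename Subtype.val : MvPolynomial S k →ₐ[k] MvPolynomial NZ k).toRingHom)) = Polynomial.C := by
        apply MvPolynomial.ringHom_ext
        · intro r; simp [Φ]
        · intro i; simp [Φ, i.2]
      exact (DFunLike.congr_fun this p).symm
    rw [e1] at hp
    have := nsj_indep h2 (rename Subtype.val p) (by
      intro A B Cc C' hCC
      unfold nev
      rw [eval_rename, eval_rename]
      congr 2
      funext ⟨⟨i, s⟩, hi⟩
      fin_cases i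
      · rfl
      · rfl
      · apply hCC
        rintro rfl
        exact hi rfl) ((hmem _).1 hp)
    exact (rename_injective _ Subtype.val_injective) (by rw [this, map_zero]))
  refine ⟨Φ.symm f, (hmem _).1 ((hqmem f).1 hfq), ?_⟩
  intro z hz
  by_contra hb
  obtain ⟨g, hg, hgρ⟩ := hdvdex z hb
  have h1 : Φ g ∈ q := by rw [hqmem, AlgEquiv.symm_apply_apply]; exact hgρ
  obtain ⟨r, hr⟩ := hfd _ h1
  apply hg
  have : g = Φ.symm f * Φ.symm r := by rw [← map_mul, ← hr, AlgEquiv.symm_apply_apply]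
  rw [this, map_mul, hz, zero_mul]

def ncert : List ((Fin 7 × Fin 7 × Fin 7) × List (ℤ × ℕ)) := [
  ((4,4,4),[(1,42)]), ((3,4,4),[(1,36)]), ((0,0,1),[(1,1)]), ((0,0,3),[(1,49)]), ((0,0,0),[(1,0)]), ((2,4,4),[(1,35)]),
  ((4,4,5),[(1,84)]), ((0,0,2),[(1,7)]), ((2,2,2),[(1,6)]), ((1,2,2),[(1,5)]), ((2,2,4),[(1,54)]), ((4,6,6),[(1,246)]),
  ((6,6,6),[(1,294)]), ((3,6,6),[(1,245)]), ((5,6,6),[(1,252)]), ((2,2,3),[(1,12)]), ((2,4,5),[(1,77)]), ((2,3,3),[(1,18)]),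
  ((0,2,4),[(1,21)]), ((3,3,4),[(1,30)]), ((0,1,1),[(1,2)]), ((2,2,6),[(1,102)]), ((3,4,5),[(1,78)]), ((2,4,6),[(1,150)]),
  ((4,5,6),[(1,204)]), ((5,5,6),[(1,210)]), ((0,4,4),[(1,28)]), ((0,1,2),[(1,8)]), ((1,2,4),[(1,53)]), ((1,2,3),[(1,11)]),
  ((1,3,3),[(1,17)]), ((3,3,5),[(1,72)]), ((5,5,5),[(1,168)]), ((2,3,5),[(1,66)]), ((2,5,5),[(1,119)]), ((0,3,4),[(1,22)]),
  ((1,3,4),[(1,23)]), ((1,1,4),[(1,52)]), ((1,1,1),[(1,3)]), ((2,3,6),[(1,108)]), ((0,1,6),[(1,99)]), ((0,3,3),[(1,16)]),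
  ((1,2,5),[(1,59)]), ((1,4,6),[(1,149)]), ((3,3,6),[(1,114)]), ((1,4,5),[(1,71)]), ((0,5,6),[(1,154)]), ((0,2,5),[(1,63)]),
  ((0,3,5),[(1,64)]), ((0,6,6),[(1,196)]), ((1,3,6),[(1,107)]), ((1,5,6),[(1,155)]), ((0,1,5),[(1,57)]), ((0,0,6),[(1,98)]),
  ((1,1,5),[(1,58)]), ((1,5,5),[(1,113)]), ((0,2,6),[(1,105)]), ((0,4,6),[(1,148)]), ((1,1,6),[(1,100)]), ((0,5,5),[(1,112)]),
  ((1,1,2),[(2,9),(-2,14),(1,50)]), ((0,2,2),[(1,4)]), ((0,1,3),[(1,9)]), ((0,0,4),[(1,14)]), ((0,1,4),[(2,10),(1,51)]), ((0,2,3),[(1,15)]),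
  ((1,1,3),[(1,10)]), ((0,0,5),[(1,56)]), ((0,3,6),[(24,24),(-4,65),(4,101),(4,70),(-2,106),(3,147)]), ((3,3,3),[(1,147)]), ((2,3,4),[(1,24)]), ((2,2,5),[(1,60)]),
  ((1,4,4),[(1,29)]), ((1,3,5),[(1,65)]), ((1,2,6),[(1,101)]), ((0,4,5),[(1,70)]), ((2,5,6),[(2,120),(1,161)]), ((3,4,6),[(1,156)]),
  ((3,5,5),[(1,120)]), ((1,6,6),[(1,197)]), ((4,5,5),[(2,162),(-2,198),(1,203)]), ((4,4,6),[(1,126)]), ((3,5,6),[(1,162)]), ((2,6,6),[(1,198)])]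

def nQl : Fin 7 → List (ℤ × ℕ) :=
  ![[(1,0)], [(1,1)], [(2,7),(1,2)], [(2,49),(-1,8)], [(2,50),(1,14)], [(1,56)], [(1,98)]]

def nLm (l l' : List (ℤ × ℕ)) : List (ℤ × ℕ) :=
  l.flatMap fun p => l'.map fun q => (p.1 * q.1, p.2 + q.2)

def nLc (l : List (ℤ × ℕ)) (n : ℕ) : ℤ := (l.map fun p => if p.2 = n then p.1 else 0).sum

def nLd (d : Fin 7 × Fin 7 × Fin 7) : List (ℤ × ℕ) := nLm (nLm (nQl d.1) (nQl d.2.1)) (nQl d.2.2)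

def nLv (f : List (ℤ × ℕ)) (d : Fin 7 × Fin 7 × Fin 7) : ℤ := (f.map fun p => p.1 * nLc (nLd d) p.2).sum

def nchk : List ((Fin 7 × Fin 7 × Fin 7) × List (ℤ × ℕ)) → Bool
  | [] => true
  | a :: l => decide (nLv a.2 a.1 ∣ 1296) && (l.all fun b => nLv a.2 b.1 == 0) && nchk l

lemma nchk_cert : nchk ncert = true := by decide +kernel

lemma ncert_length : ncert.length = 84 := by decide +kernel

def nLp (k : Type) [Field k] (l : List (ℤ × ℕ)) : Polynomial k :=
  (l.map fun p => Polynomial.C (p.1 : k) * Polynomial.X ^ p.2).sum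

lemma nLp_mul (l l' : List (ℤ × ℕ)) : nLp k (nLm l l') = nLp k l * nLp k l' := by
  induction l with
  | nil => simp [nLp, nLm]
  | cons a l ih =>
    have h1 : nLm (a :: l) l' = (l'.map fun q => (a.1 * q.1, a.2 + q.2)) ++ nLm l l' := rfl
    have h2 : nLp k ((l'.map fun q => (a.1 * q.1, a.2 + q.2)) ++ nLm l l') =
        nLp k (l'.map fun q => (a.1 * q.1, a.2 + q.2)) + nLp k (nLm l l') := by
      simp [nLp]
    have h3 : nLp k (l'.map fun q => (a.1 * q.1, a.2 + q.2)) =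
        (Polynomial.C (a.1 : k) * Polynomial.X ^ a.2) * nLp k l' := by
      clear h1 h2 ih
      induction l' with
      | nil => simp [nLp]
      | cons b l' ih =>
        simp only [nLp, List.map_cons, List.sum_cons] at ih ⊢
        rw [ih]
        push_cast
        rw [Polynomial.C_mul]
        ring
    rw [h1, h2, h3, ih]
    simp only [nLp, List.map_cons, List.sum_cons]
    ring

lemma nLp_coeff (l : List (ℤ × ℕ)) (n : ℕ) : (nLp k l).coeff n = (nLc l n : k) := by
  induction l with
  | nil => simp [nLp, nLc]
  | cons a l ih =>
    simp only [nLp, nLc, List.map_cons, List.sum_cons, Polynomial.coeff_add] at ih ⊢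
    rw [ih, Polynomial.coeff_C_mul, Polynomial.coeff_X_pow]
    push_cast
    by_cases h : a.2 = n
    · simp [h]
    · simp [h, Ne.symm h]

def nLf (k : Type) [Field k] (f : List (ℤ × ℕ)) : Polynomial k →ₗ[k] k :=
  (f.map fun p => (p.1 : k) • Polynomial.lcoeff k p.2).sum

lemma nLf_apply (f : List (ℤ × ℕ)) (d) : nLf k f (nLp k (nLd d)) = (nLv f d : k) := by
  induction f with
  | nil => simp [nLf, nLv]
  | cons a f ih =>
    simp only [nLf, nLv, List.map_cons, List.sum_cons, LinearMap.add_apply] at ih ⊢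
    rw [ih]
    simp [nLp_coeff]

lemma nsj_li_cert (h2 : (2 : k) ≠ 0) (h3 : (3 : k) ≠ 0)
    (l : List ((Fin 7 × Fin 7 × Fin 7) × List (ℤ × ℕ))) (hl : nchk l = true) :
    LinearIndependent k (fun i : Fin l.length => nLp k (nLd (l.get i).1)) := by
  induction l with
  | nil =>
    have : IsEmpty (Fin ([] : List ((Fin 7 × Fin 7 × Fin 7) × List (ℤ × ℕ))).length) := Fin.isEmpty
    exact linearIndependent_empty_type
  | cons a l ih =>
    simp only [nchk, Bool.and_eq_true, decide_eq_true_eq, List.all_eq_true, beq_iff_eq] at hl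
    obtain ⟨⟨h, h0⟩, hr⟩ := hl
    have e : (fun i : Fin (a :: l).length => nLp k (nLd ((a :: l).get i).1)) =
        Fin.cons (nLp k (nLd a.1)) (fun i : Fin l.length => nLp k (nLd (l.get i).1)) := by
      funext i
      refine Fin.cases ?_ (fun j => ?_) i <;> rfl
    rw [e]
    refine linearIndependent_finCons.mpr ⟨ih hr, fun hm => ?_⟩
    have hle : Submodule.span k (Set.range fun i : Fin l.length => nLp k (nLd (l.get i).1)) ≤
        LinearMap.ker (nLf k a.2) := by
      rw [Submodule.span_le]
      rintro _ ⟨i, rfl⟩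
      simp only [SetLike.mem_coe, LinearMap.mem_ker]
      rw [nLf_apply, h0 _ (List.get_mem l i)]
      simp
    have := hle hm
    rw [LinearMap.mem_ker, nLf_apply] at this
    obtain ⟨c, hc⟩ := h
    have hh : ((1296 : ℤ) : k) = 0 := by rw [hc]; push_cast; rw [this, zero_mul]
    have : (2 : k) ^ 4 * 3 ^ 4 = 0 := by rw [← hh]; norm_num
    simp [h2, h3] at this

def nidx : NY → Fin 10 :=
  Sym2.lift ⟨fun i j => (![![0,1,2,3],![1,4,5,6],![2,5,7,8],![3,6,8,9]] : Fin 4 → Fin 4 → Fin 10) i j,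
    by decide⟩

def nvec {R : Type} (v : Fin 10 → R) : NY → R := fun s => v (nidx s)

lemma nvec_mk {R : Type} (v : Fin 10 → R) (i j : Fin 4) : nvec v s(i, j) =
   v ((![![0,1,2,3],![1,4,5,6],![2,5,7,8],![3,6,8,9]] : Fin 4 → Fin 4 → Fin 10) i j) := rfl

lemma nsj_univ_NY : (Finset.univ : Finset NY) = {s(0,0),s(0,1),s(0,2),s(0,3),s(1,1),s(1,2),s(1,3),s(2,2),
    s(2,3),s(3,3)} := by decide

lemma nsj_sum_NY {M : Type} [AddCommMonoid M] (f : NY → M) : ∑ s, f s = f s(0,0) + (f s(0,1) + (f s(0,2) +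
    (f s(0,3) + (f s(1,1) + (f s(1,2) + (f s(1,3) + (f s(2,2) + (f s(2,3) + f s(3,3))))))))) := by
  rw [nsj_univ_NY]
  repeat rw [Finset.sum_insert (by decide)]
  rw [Finset.sum_singleton]

lemma nsj_ext_NY {M : Type} {f g : NY → M} (h : ∀ i j : Fin 4, i ≤ j → f s(i,j) = g s(i,j)) : f = g := by
  funext s
  induction s using Sym2.ind with
  | _ i j =>
    rcases le_total i j with hij | hij
    · exact h i j hij
    · rw [Sym2.eq_swap]; exact h j i hij

def nA0 (k : Type) [Field k] : NY → k := nvec ![0,0,1,0,-2,0,0,0,0,0]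
def nB0 (k : Type) [Field k] : NY → k := nvec ![0,0,0,0,0,0,1,-2,0,0]
def nCs (k : Type) [Field k] : NY → k := nvec ![0,0,0,1,0,2,0,0,0,0]

def nag (k : Type) [Field k] : Fin 7 → NY → k := ![nvec ![1,0,0,0,0,0,0,0,0,0], nvec ![0,1,0,0,0,0,0,0,0,0],
  nvec ![0,0,2,0,1,0,0,0,0,0], nvec ![0,0,0,2,0,-1,0,0,0,0], nvec ![0,0,0,0,0,0,2,1,0,0],
  nvec ![0,0,0,0,0,0,0,0,1,0], nvec ![0,0,0,0,0,0,0,0,0,1]]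

lemma nag_li : LinearIndependent k (nag k) := by
  rw [Fintype.linearIndependent_iff]
  intro g hg
  have e : ∀ s, ∑ i, g i * nag k i s = 0 := fun s => by
    have := congrFun hg s
    simpa using this
  have e0 := e s(0,0)
  have e1 := e s(0,1)
  have e2 := e s(1,1)
  have e3 := e s(1,2)
  have e4 := e s(2,2)
  have e5 := e s(2,3)
  have e6 := e s(3,3)
  simp [Fin.sum_univ_succ, nag, nvec_mk] at e0 e1 e2 e3 e4 e5 e6
  intro i
  fin_cases i <;> assumption

lemma nsj_z0_li : LinearIndependent k ![nA0 k, nB0 k, nCs k] := by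
  rw [Fintype.linearIndependent_iff]
  intro g hg
  have e : ∀ s, ∑ i, g i * (![nA0 k, nB0 k, nCs k] : Fin 3 → NY → k) i s = 0 := fun s => by
    have := congrFun hg s
    simpa using this
  have e0 := e s(0,2)
  have e1 := e s(1,3)
  have e2 := e s(0,3)
  simp [Fin.sum_univ_succ, nA0, nB0, nCs, nvec_mk] at e0 e1 e2
  intro i
  fin_cases i <;> assumption

lemma nag_perp (i j) : ∑ s, nag k i s * (![nA0 k, nB0 k, nCs k] : Fin 3 → NY → k) j s = 0 := by
  rw [nsj_sum_NY]
  fin_cases i <;> fin_cases j <;> simp [nag, nA0, nB0, nCs, nvec_mk]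

def nwt (k : Type) [Field k] : MvPolynomial (Fin 4) k →ₐ[k] Polynomial k :=
  aeval (fun a => (Polynomial.X : Polynomial k) ^ (![0,1,7,49] : Fin 4 → ℕ) a)

lemma nwt_q (i) : nwt k (nq (nag k) i) = nLp k (nQl i) := by
  have hv : ∀ a b : Fin 4, nver k s(a,b) = X a * X b := fun _ _ => rfl
  have hC : (Polynomial.C 2 : Polynomial k) = 2 := rfl
  rw [nq, nsj_sum_NY]
  fin_cases i <;>
  · simp [nag, nvec_mk, nwt, hv, nLp, nQl, Algebra.smul_def, ← pow_add, ← pow_succ', hC]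
    try ring

lemma nsj_good [IsAlgClosed k] (h2 : (2 : k) ≠ 0) (h3 : (3 : k) ≠ 0) : nKp ![nA0 k, nB0 k, nCs k] = ⊥ := by
  have hiso := nsj_iso h2 h3 ![nA0 k, nB0 k, nCs k] nsj_z0_li (nag k) nag_li nag_perp
  have hLI := nsj_li_cert h2 h3 ncert nchk_cert
  let T : homogeneousSubmodule (Fin 7) k 3 →ₗ[k] Polynomial k :=
    ((nwt k).toLinearMap ∘ₗ (aeval (nq (nag k))).toLinearMap) ∘ₗ Submodule.subtype _
  have hT : ∀ d : Fin 7 × Fin 7 × Fin 7, nLp k (nLd d) ∈ LinearMap.range T := by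
    intro d
    have hm : (X d.1 * X d.2.1 * X d.2.2 : MvPolynomial (Fin 7) k) ∈ homogeneousSubmodule (Fin 7) k 3 := by
      rw [mem_homogeneousSubmodule]
      exact ((isHomogeneous_X _ _).mul (isHomogeneous_X _ _)).mul (isHomogeneous_X _ _)
    refine ⟨⟨_, hm⟩, ?_⟩
    simp [T, nLd, nLp_mul, nwt_q]
  have hr : 84 ≤ Module.finrank k (LinearMap.range T) := by
    have hLI' : LinearIndependent k (fun i : Fin ncert.length =>
        (⟨nLp k (nLd (ncert.get i).1), hT _⟩ : LinearMap.range T)) := by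
      apply LinearIndependent.of_comp (LinearMap.range T).subtype
      exact hLI
    have := hLI'.fintype_card_le_finrank
    rwa [Fintype.card_fin, ncert_length] at this
  have hsum := LinearMap.finrank_range_add_finrank_ker T
  have h84 : Module.finrank k (homogeneousSubmodule (Fin 7) k 3) = 84 := by
    rw [nsj_finrank_hom, Fintype.card_fin, Nat.multichoose_eq]; decide
  have hker : Module.finrank k (LinearMap.ker T) = 0 := by omega
  have hker' : LinearMap.ker T = ⊥ := Submodule.finrank_eq_zero.mp hker
  have hc : cubicRelations (nq (nag k)) = ⊥ := by
    rw [eq_bot_iff]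
    rintro p ⟨hp, hp0⟩
    have : (⟨p, hp⟩ : homogeneousSubmodule (Fin 7) k 3) ∈ LinearMap.ker T := by
      rw [LinearMap.mem_ker]
      have h0 : aeval (nq (nag k)) p = 0 := hp0
      change nwt k (aeval (nq (nag k)) p) = 0
      rw [h0, map_zero]
    rw [hker', Submodule.mem_bot] at this
    exact congrArg Subtype.val this
  rw [hc, finrank_bot] at hiso
  exact Submodule.finrank_eq_zero.mp hiso.symm

def ns1 {R : Type} [CommRing R] (a1 a2 a3 b1 b2 b3 : R) : R :=
  b1 * b2 + b1 * b3 + b2 * b3 + (a1 + a2 + a3) * (b1 * b2 * b3)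

def ns3 {R : Type} [CommRing R] (a1 a2 a3 b1 b2 b3 : R) : R :=
  1 + (a1 + a2 + a3) * (b1 + b2 + b3) + (a1 * a2 + a1 * a3 + a2 * a3) * (b1 * b2 + b1 * b3 + b2 * b3)
    + a1 * a2 * a3 * (b1 * b2 * b3)

def ns5 {R : Type} [CommRing R] (a1 a2 a3 b1 b2 b3 : R) : R :=
  a1 * a2 + a1 * a3 + a2 * a3 + a1 * a2 * a3 * (b1 + b2 + b3)

def nE {R : Type} [CommRing R] (c a1 a2 a3 b1 b2 b3 : R) : NY → R :=
  nvec ![b1 * b2 * b3, c * ns1 a1 a2 a3 b1 b2 b3, 0, 0,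
    b1 + b2 + b3 + (a1 + a2 + a3) * (b1 * b2 + b1 * b3 + b2 * b3) + (a1 * a2 + a1 * a3 + a2 * a3) * (b1 * b2 * b3),
    c * ns3 a1 a2 a3 b1 b2 b3, 0,
    a1 + a2 + a3 + (a1 * a2 + a1 * a3 + a2 * a3) * (b1 + b2 + b3) + a1 * a2 * a3 * (b1 * b2 + b1 * b3 + b2 * b3),
    c * ns5 a1 a2 a3 b1 b2 b3, a1 * a2 * a3]

lemma nE_a12 {R : Type} [CommRing R] (c a1 a2 a3 b1 b2 b3 : R) : nE c a2 a1 a3 b1 b2 b3 = nE c a1 a2 a3 b1 b2 b3 := by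
  simp only [nE, ns1, ns3, ns5]
  congr 1
  congr! 1 <;> ring_nf

lemma nE_a13 {R : Type} [CommRing R] (c a1 a2 a3 b1 b2 b3 : R) : nE c a3 a2 a1 b1 b2 b3 = nE c a1 a2 a3 b1 b2 b3 := by
  simp only [nE, ns1, ns3, ns5]
  congr 1
  congr! 1 <;> ring_nf

lemma nE_b12 {R : Type} [CommRing R] (c a1 a2 a3 b1 b2 b3 : R) : nE c a1 a2 a3 b2 b1 b3 = nE c a1 a2 a3 b1 b2 b3 := by
  simp only [nE, ns1, ns3, ns5]
  congr 1
  congr! 1 <;> ring_nf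

lemma nE_b13 {R : Type} [CommRing R] (c a1 a2 a3 b1 b2 b3 : R) : nE c a1 a2 a3 b3 b2 b1 = nE c a1 a2 a3 b1 b2 b3 := by
  simp only [nE, ns1, ns3, ns5]
  congr 1
  congr! 1 <;> ring_nf

def nC0 (k : Type) [Field k] : NY → k := nvec ![0,0,0,1,0,-1,0,0,0,0]

lemma nsj_uvroot (c : k) (hc : 2 * c = 1) (E : NY → k) (u v : Fin 4 → k)
    (h00 : E s(0,0) = u 0 * v 0) (h01 : E s(0,1) = c * (u 0 * v 1 + u 1 * v 0)) (h02 : E s(0,2) = 0)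
    (h03 : E s(0,3) = 0) (h11 : E s(1,1) = u 0 * v 2 + u 1 * v 1 + u 2 * v 0)
    (h12 : E s(1,2) = c * (u 0 * v 3 + u 1 * v 2 + u 2 * v 1 + u 3 * v 0)) (h13 : E s(1,3) = 0)
    (h22 : E s(2,2) = u 1 * v 3 + u 2 * v 2 + u 3 * v 1) (h23 : E s(2,3) = c * (u 2 * v 3 + u 3 * v 2))
    (h33 : E s(3,3) = u 3 * v 3) (t : k) (ht : t * (u 0 * v 3 + u 3 * v 0) = 2) :
    ∃ u' s' t', nln (nA0 k) (nB0 k) (nC0 k) E t = nuvz (nA0 k) (nB0 k) u' v s' t' := by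
  refine ⟨fun i => t * c * u i, - (t * c * (u 0 * v 2 + u 2 * v 0)), - (t * c * (u 1 * v 3 + u 3 * v 1)), ?_⟩
  have ht' : t * c * (u 0 * v 3 + u 3 * v 0) = 1 := by linear_combination c * ht + hc
  unfold nln nuvz
  congr 3
  apply nsj_ext_NY
  intro i j hij
  fin_cases i <;> fin_cases j <;> first | exact absurd hij (by decide) | skip
  all_goals simp only [Fin.zero_eta, Fin.mk_one, Fin.reduceFinMk, nuv_mk, h00, h01, h02, h03, h11, h12, h13, h22, h23, h33]
  all_goals simp [nC0, nA0, nB0, nvec_mk]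
  · linear_combination - t * u 0 * v 0 * hc
  · ring
  · ring
  · linear_combination - ht'
  · linear_combination - t * (u 0 * v 2 + u 1 * v 1 + u 2 * v 0) * hc
  · linear_combination ht'
  · ring
  · linear_combination - t * (u 1 * v 3 + u 2 * v 2 + u 3 * v 1) * hc
  · ring
  · linear_combination - t * u 3 * v 3 * hc

lemma nsj_root0 (c : k) (hc : 2 * c = 1) (a1 a2 a3 b1 b2 b3 t : k) (ht : t * (1 + a1 * a2 * a3 * (b1 * b2 * b3)) = 2) :
    ∃ u v s' t', nln (nA0 k) (nB0 k) (nC0 k) (nE c a1 a2 a3 b1 b2 b3) t = nuvz (nA0 k) (nB0 k) u v s' t' := by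
  obtain ⟨u, s', t', h⟩ := nsj_uvroot c hc (nE c a1 a2 a3 b1 b2 b3)
    ![1, a1 + a2 + a3, a1 * a2 + a1 * a3 + a2 * a3, a1 * a2 * a3]
    ![b1 * b2 * b3, b1 * b2 + b1 * b3 + b2 * b3, b1 + b2 + b3, 1]
    (by simp [nE, nvec_mk]) (by simp [nE, nvec_mk, ns1]) (by simp [nE, nvec_mk])
    (by simp [nE, nvec_mk]) (by simp [nE, nvec_mk]) (by simp [nE, nvec_mk, ns3]) (by simp [nE, nvec_mk])
    (by simp [nE, nvec_mk]) (by simp [nE, nvec_mk, ns5]) (by simp [nE, nvec_mk]) t (by simpa using ht)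
  exact ⟨u, _, s', t', h⟩

lemma nsj_root1 (c : k) (hc : 2 * c = 1) (a1 a2 a3 b1 b2 b3 t : k) (ht : t * (a1 * b1 + a2 * a3 * (b2 * b3)) = 2) :
    ∃ u v s' t', nln (nA0 k) (nB0 k) (nC0 k) (nE c a1 a2 a3 b1 b2 b3) t = nuvz (nA0 k) (nB0 k) u v s' t' := by
  obtain ⟨u, s', t', h⟩ := nsj_uvroot c hc (nE c a1 a2 a3 b1 b2 b3)
    ![b1, 1 + b1 * (a2 + a3), a2 + a3 + b1 * (a2 * a3), a2 * a3]
    ![b2 * b3, b2 + b3 + a1 * (b2 * b3), 1 + a1 * (b2 + b3), a1]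
    (by simp [nE, nvec_mk]; ring) (by simp [nE, nvec_mk, ns1, -mul_eq_mul_left_iff]; ring) (by simp [nE, nvec_mk])
    (by simp [nE, nvec_mk]) (by simp [nE, nvec_mk]; ring) (by simp [nE, nvec_mk, ns3, -mul_eq_mul_left_iff]; ring) (by simp [nE, nvec_mk])
    (by simp [nE, nvec_mk]; ring) (by simp [nE, nvec_mk, ns5, -mul_eq_mul_left_iff]; ring) (by simp [nE, nvec_mk]; ring) t (by
      simp; linear_combination ht)
  exact ⟨u, _, s', t', h⟩

lemma nsj_pf (C : NY → k) (h02 : C s(0,2) = 0) (h03 : C s(0,3) = 1) (h13 : C s(1,3) = 0)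
    (hQ : 4 - C s(1,2) + C s(0,1) * C s(2,3) - 4 * C s(0,0) * C s(3,3) = 0) :
    (nS ![nA0 k, nB0 k, C]).det = 0 := by
  classical
  rw [← Matrix.exists_mulVec_eq_zero_iff]
  have sw : ∀ i j : Fin 4, C s(i,j) = C s(j,i) := fun i j => by rw [Sym2.eq_swap]
  refine ⟨fun p => (![![-C s(2,3), 0, 1, 0], ![-2, 0, 0, 2 * C s(0,0)],
    ![C s(2,2), -2 + 2 * C s(0,0) * C s(3,3),
      - C s(0,0) * C s(2,3), -2 * C s(0,1)]] : Fin 3 → Fin 4 → k) p.1 p.2, ?_, ?_⟩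
  · intro h
    have := congrFun h (0, 2)
    simp at this
  · funext ⟨i, a⟩
    rw [Matrix.mulVec, dotProduct, Fintype.sum_prod_type, Fin.sum_univ_three]
    simp only [Fin.sum_univ_four]
    fin_cases i <;> fin_cases a <;>
      simp [nS, nA0, nB0, nvec_mk, h02, h03, h13, sw 1 0, sw 2 0, sw 3 0, sw 2 1, sw 3 1, sw 3 2]
    all_goals try ring
    all_goals linear_combination hQ

lemma nsj_evdet (z : Fin 3 → NY → k) : nev z (nS (fun i s => (X (i, s) : MvPolynomial NZ k))).det = (nS z).det := by
  rw [RingHom.map_det]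
  congr 1
  ext p q
  simp only [RingHom.mapMatrix_apply, Matrix.map_apply, nS, Matrix.of_apply]
  split_ifs <;> simp [nev]

lemma nsj_cof (P : Polynomial k) (hP : P.eval 0 ≠ 0) : ∀ᶠ h in Filter.cofinite, P.eval h ≠ 0 := by
  have hP0 : P ≠ 0 := by rintro rfl; simp at hP
  have : {h | ¬ P.eval h ≠ 0} ⊆ P.rootSet k := by
    intro h hh
    simp only [ne_eq, not_not, Set.mem_setOf_eq] at hh
    rw [Polynomial.mem_rootSet]
    exact ⟨hP0, by simpa using hh⟩
  exact (Polynomial.rootSet_finite P k).subset this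

def nEh {R : Type} [CommRing R] (c h : R) : NY → R := nE c (h^3) (h^4) (h^5) (h^3) (h^6) (h^9)

def nt3 {R : Type} [CommRing R] (h : R) : R := ns3 (h^3) (h^4) (h^5) (h^3) (h^6) (h^9)

def nD1 {R : Type} [CommRing R] (h : R) : R :=
  (1 + h^3 + h^6 + (h^3 + h^4 + h^5) * h^9) * (1 + h + h^2 + h^5 * (h^3 + h^6 + h^9)) - 16 * h^14

lemma nD1_eq {R : Type} [CommRing R] (h : R) : h^16 * nD1 h =
    ns1 (h^3) (h^4) (h^5) (h^3) (h^6) (h^9) * ns5 (h^3) (h^4) (h^5) (h^3) (h^6) (h^9)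
    - 16 * (h^3 * h^6 * h^9) * (h^3 * h^4 * h^5) := by
  simp only [nD1, ns1, ns5]; ring

def nxv {R : Type} [CommRing R] (h : R) (v : ℕ) : R := h ^ v + h ^ (30 - v)

lemma nsj_uvroots (c : k) (hc : 2 * c = 1) (h t : k) (i : Fin 10)
    (ht : t * nxv h ((![0,6,7,8,9,10,11,12,13,14] : Fin 10 → ℕ) i) = 2) :
    ∃ u v s' t', nln (nA0 k) (nB0 k) (nC0 k) (nEh c h) t = nuvz (nA0 k) (nB0 k) u v s' t' := by
  have main := fun (a1 a2 a3 b1 b2 b3 : k) (e : nEh c h = nE c a1 a2 a3 b1 b2 b3) hh => by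
    have := nsj_root1 c hc a1 a2 a3 b1 b2 b3 t hh
    rwa [← e] at this
  unfold nxv at ht
  fin_cases i <;> simp at ht
  · exact nsj_root0 c hc _ _ _ _ _ _ t (by rw [← ht]; ring)
  · exact main (h^3) (h^4) (h^5) (h^3) (h^6) (h^9) rfl (by rw [← ht]; ring)
  · exact main (h^4) (h^3) (h^5) (h^3) (h^6) (h^9) (nE_a12 ..).symm (by rw [← ht]; ring)
  · exact main (h^5) (h^4) (h^3) (h^3) (h^6) (h^9) (nE_a13 ..).symm (by rw [← ht]; ring)
  · exact main (h^3) (h^4) (h^5) (h^6) (h^3) (h^9) (nE_b12 ..).symm (by rw [← ht]; ring)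
  · exact main (h^4) (h^3) (h^5) (h^6) (h^3) (h^9) (by rw [nE_b12, nE_a12]; rfl) (by rw [← ht]; ring)
  · exact main (h^5) (h^4) (h^3) (h^6) (h^3) (h^9) (by rw [nE_b12, nE_a13]; rfl) (by rw [← ht]; ring)
  · exact main (h^3) (h^4) (h^5) (h^9) (h^6) (h^3) (nE_b13 ..).symm (by rw [← ht]; ring)
  · exact main (h^4) (h^3) (h^5) (h^9) (h^6) (h^3) (by rw [nE_b13, nE_a12]; rfl) (by rw [← ht]; ring)
  · exact main (h^5) (h^4) (h^3) (h^9) (h^6) (h^3) (by rw [nE_b13, nE_a13]; rfl) (by rw [← ht]; ring)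

lemma nsj_pfroots (c : k) (hc : 2 * c = 1) (h t : k) (ht : 20 - 2 * t * nt3 h + t ^ 2 * (h ^ 16 * nD1 h) = 0)
    (h2 : (2 : k) ≠ 0) :
    (nS (nln (nA0 k) (nB0 k) (nC0 k) (nEh c h) t)).det = 0 := by
  have hc2 : 4 * c ^ 2 = 1 := by linear_combination (2 * c + 1) * hc
  have h4 : (4 : k) ≠ 0 := by
    intro h; apply h2; have : (2 : k) * 2 = 0 := by rw [← h]; norm_num
    simpa using this
  apply nsj_pf
  · simp [nC0, nEh, nE, nvec_mk]
  · simp [nC0, nEh, nE, nvec_mk]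
  · simp [nC0, nEh, nE, nvec_mk]
  · rw [nD1_eq] at ht
    have e3 : nt3 h = ns3 (h^3) (h^4) (h^5) (h^3) (h^6) (h^9) := rfl
    rw [e3] at ht
    simp only [nC0, nEh, nE, nvec_mk]
    simp
    generalize ns1 (h^3) (h^4) (h^5) (h^3) (h^6) (h^9) = s1 at *
    generalize ns3 (h^3) (h^4) (h^5) (h^3) (h^6) (h^9) = s3 at *
    generalize ns5 (h^3) (h^4) (h^5) (h^3) (h^6) (h^9) = s5 at *
    apply mul_left_cancel₀ h4
    linear_combination ht + (t^2 * s1 * s5) * hc2 - 2 * t * s3 * hc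

lemma nsj_evcof (F : MvPolynomial NZ k) (c : k) (hF : nev (nln (nA0 k) (nB0 k) (nC0 k) (nEh c 0) 6) F ≠ 0) :
    ∀ᶠ h in Filter.cofinite, nev (nln (nA0 k) (nB0 k) (nC0 k) (nEh c h) 6) F ≠ 0 := by
  let Z : Fin 3 → NY → Polynomial k := ![fun s => Polynomial.C (nA0 k s), fun s => Polynomial.C (nB0 k s),
    fun s => Polynomial.C (nC0 k s) + 6 * nEh (Polynomial.C c) Polynomial.X s]
  let P : Polynomial k := aeval (fun i : NZ => Z i.1 i.2) F
  have hE : ∀ h s, (nEh (Polynomial.C c) Polynomial.X s).eval h = nEh c h s := by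
    intro h s
    refine congrFun (?_ : (fun s => (nEh (Polynomial.C c) Polynomial.X s).eval h) = nEh c h) s
    apply nsj_ext_NY
    intro i j hij
    fin_cases i <;> fin_cases j <;> first | exact absurd hij (by decide) | skip
    all_goals simp [nEh, nE, nvec_mk, ns1, ns3, ns5]
  have e : ∀ h, P.eval h = nev (nln (nA0 k) (nB0 k) (nC0 k) (nEh c h) 6) F := by
    intro h
    have : ((Polynomial.evalRingHom h).comp (aeval (fun i : NZ => Z i.1 i.2)).toRingHom) =
        nev (nln (nA0 k) (nB0 k) (nC0 k) (nEh c h) 6) := by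
      apply MvPolynomial.ringHom_ext
      · intro r; simp [nev]
      · rintro ⟨i, s⟩
        fin_cases i <;> simp [nev, Z, nln, hE]
    exact DFunLike.congr_fun this F
  have := nsj_cof P (by rw [e]; exact hF)
  simpa only [e] using this

lemma nsj_hcond [IsAlgClosed k] (h2 : (2 : k) ≠ 0) (p : k → Prop) (hp : ∀ᶠ h in Filter.cofinite, p h) :
    ∃ h : k, p h ∧ h ≠ 0 ∧ (∀ n, 1 ≤ n → n ≤ 30 → 1 - h ^ n ≠ 0) ∧ (∀ n, 1 ≤ n → n ≤ 30 → 1 + h ^ n ≠ 0) ∧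
      nD1 h ≠ 0 ∧ nt3 h ^ 2 - 20 * h ^ 16 * nD1 h ≠ 0 ∧
      (5 * nxv h 0 ^ 2 - nxv h 0 * nt3 h + h ^ 16 * nD1 h ≠ 0) ∧
      ∀ v, 6 ≤ v → v ≤ 14 → 5 * nxv h v ^ 2 - nxv h v * nt3 h + h ^ 16 * nD1 h ≠ 0 := by
  have : Infinite k := IsAlgClosed.instInfinite
  have c0 : ∀ᶠ h : k in Filter.cofinite, h ≠ 0 := by
    rw [Filter.eventually_cofinite]; simp
  have c1 : ∀ n ∈ Finset.Icc 1 30, ∀ᶠ h : k in Filter.cofinite, 1 - h ^ n ≠ 0 := by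
    intro n hn
    have hn0 : n ≠ 0 := by simp at hn; omega
    exact (nsj_cof (1 - Polynomial.X ^ n : Polynomial k) (by simp [hn0])).mono fun h hh => by simpa using hh
  have c2 : ∀ n ∈ Finset.Icc 1 30, ∀ᶠ h : k in Filter.cofinite, 1 + h ^ n ≠ 0 := by
    intro n hn
    have hn0 : n ≠ 0 := by simp at hn; omega
    exact (nsj_cof (1 + Polynomial.X ^ n : Polynomial k) (by simp [hn0])).mono fun h hh => by simpa using hh
  have eD : ∀ h : k, (nD1 (Polynomial.X : Polynomial k)).eval h = nD1 h := by
    intro h; simp [nD1]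
  have eT : ∀ h : k, (nt3 (Polynomial.X : Polynomial k)).eval h = nt3 h := by
    intro h; simp [nt3, ns3]
  have D0 : nD1 (0 : k) = 1 := by simp [nD1]
  have T0 : nt3 (0 : k) = 1 := by simp [nt3, ns3]
  have c3 : ∀ᶠ h : k in Filter.cofinite, nD1 h ≠ 0 := by
    simpa only [eD] using nsj_cof (nD1 (Polynomial.X : Polynomial k)) (by rw [eD, D0]; exact one_ne_zero)
  have c4 : ∀ᶠ h : k in Filter.cofinite, nt3 h ^ 2 - 20 * h ^ 16 * nD1 h ≠ 0 := by
    have := nsj_cof (nt3 (Polynomial.X : Polynomial k) ^ 2 - 20 * Polynomial.X ^ 16 * nD1 (Polynomial.X : Polynomial k))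
      (by simp [eD, eT, D0, T0])
    simpa [eD, eT] using this
  have c5 : ∀ᶠ h : k in Filter.cofinite, 5 * nxv h 0 ^ 2 - nxv h 0 * nt3 h + h ^ 16 * nD1 h ≠ 0 := by
    have := nsj_cof (5 * (1 + Polynomial.X ^ 30) ^ 2 - (1 + Polynomial.X ^ 30) * nt3 (Polynomial.X : Polynomial k)
      + Polynomial.X ^ 16 * nD1 (Polynomial.X : Polynomial k)) (by
        simp [eD, eT, D0, T0]
        have : (5 - 1 : k) = 2 * 2 := by norm_num
        rw [this]; exact mul_ne_zero h2 h2)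
    simpa [eD, eT, nxv] using this
  have c6 : ∀ v ∈ Finset.Icc 6 14, ∀ᶠ h : k in Filter.cofinite,
      5 * h ^ v * (1 + h ^ (30 - 2 * v)) ^ 2 - (1 + h ^ (30 - 2 * v)) * nt3 h + h ^ (16 - v) * nD1 h ≠ 0 := by
    intro v hv
    simp only [Finset.mem_Icc] at hv
    have hv0 : v ≠ 0 := by omega
    have hv1 : 30 - 2 * v ≠ 0 := by omega
    have hv2 : 16 - v ≠ 0 := by omega
    have := nsj_cof (5 * Polynomial.X ^ v * (1 + Polynomial.X ^ (30 - 2 * v)) ^ 2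
      - (1 + Polynomial.X ^ (30 - 2 * v)) * nt3 (Polynomial.X : Polynomial k)
      + Polynomial.X ^ (16 - v) * nD1 (Polynomial.X : Polynomial k)) (by
        simp [eD, eT, D0, T0, hv0, hv1, hv2])
    simpa [eD, eT] using this
  rw [← Filter.eventually_all_finset] at c1 c2 c6
  obtain ⟨h, hp, h0, h1, h2', h3, h4, h5, h6⟩ :=
    (hp.and (c0.and (c1.and (c2.and (c3.and (c4.and (c5.and c6))))))).exists
  refine ⟨h, hp, h0, fun n hn hn' => h1 n (Finset.mem_Icc.mpr ⟨hn, hn'⟩),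
    fun n hn hn' => h2' n (Finset.mem_Icc.mpr ⟨hn, hn'⟩), h3, h4, h5, fun v hv hv' => ?_⟩
  have := mul_ne_zero (pow_ne_zero v h0) (h6 v (Finset.mem_Icc.mpr ⟨hv, hv'⟩))
  have e1 : h ^ (30 - v) = h ^ v * h ^ (30 - 2 * v) := by rw [← pow_add]; congr 1; omega
  have e2 : h ^ 16 = h ^ v * h ^ (16 - v) := by rw [← pow_add]; congr 1; omega
  intro hh
  apply this
  rw [← hh, nxv, e1, e2]
  ring

def nww : Fin 10 → ℕ := ![0,6,7,8,9,10,11,12,13,14]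

lemma nsj_roots [IsAlgClosed k] (h2 : (2 : k) ≠ 0) (F : MvPolynomial NZ k)
    (hF1 : ∀ A B u v s t, nev (nuvz A B u v s t) F = 0) (hF2 : ∀ z : Fin 3 → NY → k, (nS z).det = 0 → nev z F = 0)
    (hF3 : nev ![nA0 k, nB0 k, nCs k] F ≠ 0) :
    ∃ P Q t0, nev (nln (nA0 k) (nB0 k) P Q t0) F ≠ 0 ∧ ∃ t : Fin 12 → k, Function.Injective t ∧
      ∀ i, nev (nln (nA0 k) (nB0 k) P Q (t i)) F = 0 := by
  set c : k := 2⁻¹ with hcdef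
  have hc : 2 * c = 1 := mul_inv_cancel₀ h2
  have e0 : nln (nA0 k) (nB0 k) (nC0 k) (nEh c 0) 6 = ![nA0 k, nB0 k, nCs k] := by
    unfold nln
    congr 3
    apply nsj_ext_NY
    intro i j hij
    fin_cases i <;> fin_cases j <;> first | exact absurd hij (by decide) | skip
    all_goals simp [nCs, nC0, nEh, nE, nvec_mk, ns1, ns3, ns5]
    linear_combination 3 * hc
  obtain ⟨h, hp, h0, hm, hpl, hD, hdisc, hv0, hv6⟩ := nsj_hcond h2 _ (nsj_evcof F c (by rw [e0]; exact hF3))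
  refine ⟨nC0 k, nEh c h, 6, hp, ?_⟩
  have hw30 : ∀ i j, nww i + nww j < 30 := by decide
  have hx0 : ∀ i, nxv h (nww i) ≠ 0 := by
    intro i
    have := hw30 i i
    have e1 : h ^ (30 - nww i) = h ^ (nww i) * h ^ (30 - 2 * nww i) := by rw [← pow_add]; congr 1; omega
    rw [nxv, e1]
    have := mul_ne_zero (pow_ne_zero (nww i) h0) (hpl (30 - 2 * nww i) (by omega) (by omega))
    intro hh; apply this; rw [← hh]; ring
  have hxc : ∀ i, 5 * nxv h (nww i) ^ 2 - nxv h (nww i) * nt3 h + h ^ 16 * nD1 h ≠ 0 := by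
    intro i
    rcases (by decide : ∀ i, nww i = 0 ∨ (6 ≤ nww i ∧ nww i ≤ 14)) i with hi | ⟨hi, hi'⟩
    · rw [hi]; exact hv0
    · exact hv6 _ hi hi'
  have hxlt : ∀ i j, nww i < nww j → nxv h (nww i) ≠ nxv h (nww j) := by
    intro i j hij hx
    have h30 := hw30 i j
    have e1 : h ^ (nww j) = h ^ (nww i) * h ^ (nww j - nww i) := by rw [← pow_add]; congr 1; omega
    have e2 : h ^ (30 - nww i) = h ^ (nww i) * h ^ (nww j - nww i) * h ^ (30 - nww i - nww j) := by
      rw [← pow_add, ← pow_add]; congr 1; omega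
    have e3 : h ^ (30 - nww j) = h ^ (nww i) * h ^ (30 - nww i - nww j) := by
      rw [← pow_add]; congr 1; omega
    have := mul_ne_zero (mul_ne_zero (pow_ne_zero (nww i) h0) (hm (nww j - nww i) (by omega) (by omega)))
      (hm (30 - nww i - nww j) (by omega) (by omega))
    apply this
    rw [nxv, nxv, e1, e2, e3] at hx
    linear_combination hx
  have hinj : Function.Injective fun i => 2 / nxv h (nww i) := by
    intro i j hij
    have hij' : nxv h (nww i) = nxv h (nww j) := by
      have h1 := hx0 i
      have h2' := hx0 j
      simp only at hij
      rw [div_eq_div_iff h1 h2'] at hij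
      exact (mul_left_cancel₀ h2 hij).symm
    rcases lt_trichotomy (nww i) (nww j) with hl | he | hl
    · exact absurd hij' (hxlt i j hl)
    · exact (by decide : ∀ i j, nww i = nww j → i = j) i j he
    · exact absurd hij'.symm (hxlt j i hl)
  have ha : h ^ 16 * nD1 h ≠ 0 := mul_ne_zero (pow_ne_zero _ h0) hD
  set a := h ^ 16 * nD1 h with hadef
  obtain ⟨r, hr⟩ := nsj_root2 (-20 / a) (2 * nt3 h / a)
  have hra : 20 - 2 * r * nt3 h + r ^ 2 * a = 0 := by
    field_simp at hr
    linear_combination hr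
  set r' := 2 * nt3 h / a - r with hr'def
  have hsum : a * (r + r') = 2 * nt3 h := by rw [hr'def]; field_simp; ring
  have hra' : 20 - 2 * r' * nt3 h + r' ^ 2 * a = 0 := by
    linear_combination hra + (r' - r) * hsum
  have hrr : r ≠ r' := by
    intro hh
    rw [← hh] at hsum
    apply hdisc
    have e1 : nt3 h = a * r := by
      apply mul_left_cancel₀ h2; linear_combination -hsum
    rw [mul_assoc, ← hadef, e1]
    rw [e1] at hra
    linear_combination -a * hra
  have hne : ∀ x, 20 - 2 * x * nt3 h + x ^ 2 * a = 0 → ∀ i, 2 / nxv h (nww i) ≠ x := by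
    intro x hx i hi
    have hxi : x * nxv h (nww i) = 2 := by rw [← hi, div_mul_cancel₀ _ (hx0 i)]
    apply hxc i
    apply mul_left_cancel₀ (mul_ne_zero h2 h2)
    set y := nxv h (nww i)
    linear_combination y ^ 2 * hx + 2 * y * nt3 h * hxi - a * (x * y + 2) * hxi
  refine ⟨Fin.cons r (Fin.cons r' fun i => 2 / nxv h (nww i)), ?_, ?_⟩
  · rw [Fin.cons_injective_iff, Fin.cons_injective_iff]
    refine ⟨?_, ?_, hinj⟩
    · rintro ⟨i, hi⟩
      revert hi
      refine Fin.cases ?_ (fun j => ?_) i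
      · intro hi; exact hrr hi.symm
      · intro hi; exact hne r hra j hi
    · rintro ⟨i, hi⟩
      exact hne r' hra' i hi
  · intro i
    refine Fin.cases ?_ (fun j => Fin.cases ?_ (fun i => ?_) j) i
    · exact hF2 _ (nsj_pfroots c hc h r hra h2)
    · exact hF2 _ (nsj_pfroots c hc h r' hra' h2)
    · obtain ⟨u, v, s', t', e⟩ := nsj_uvroots c hc h (2 / nxv h (nww i)) i (div_mul_cancel₀ _ (hx0 i))
      change nev (nln (nA0 k) (nB0 k) (nC0 k) (nEh c h) (2 / nxv h (nww i))) F = 0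
      rw [e]; exact hF1 _ _ _ _ _ _

lemma nsj_line [IsAlgClosed k] (h2 : (2 : k) ≠ 0) (h3 : (3 : k) ≠ 0) :
    ∃ F : MvPolynomial NZ k, (∀ z, nev z F = 0 → nBad z) ∧
    ∃ P Q t0, nev (nln (nA0 k) (nB0 k) P Q t0) F ≠ 0 ∧ ∃ t : Fin 12 → k, Function.Injective t ∧
      ∀ i, nev (nln (nA0 k) (nB0 k) P Q (t i)) F = 0 := by
  have hg := nsj_good h2 h3
  have hgb : ¬ nBad ![nA0 k, nB0 k, nCs k] := by
    unfold nBad; rw [hg, finrank_bot]; decide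
  obtain ⟨G, hG1, hG2⟩ := nsj_chow h2 h3 _ hgb
  have hF : ∀ z, nev z (G * (nS (fun i s => (X (i, s) : MvPolynomial NZ k))).det) = 0 → nBad z := by
    intro z hz
    rw [map_mul, nsj_evdet, mul_eq_zero] at hz
    rcases hz with hz | hz
    · exact hG2 z hz
    · exact nsj_bad_det h2 h3 z hz
  refine ⟨_, hF, nsj_roots h2 _ ?_ ?_ fun h => hgb (hF _ h)⟩
  · intro A B u v s t
    rw [map_mul, hG1, zero_mul]
  · intro z hz
    rw [map_mul, nsj_evdet, hz, mul_zero]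

lemma nKp_rot (A B C : NY → k) : nKp ![A, B, C] = nKp ![B, C, A] := by
  apply le_antisymm
  · exact nKp_anti _ _ fun i => Submodule.subset_span ⟨(![1, 2, 0] : Fin 3 → Fin 3) i, by fin_cases i <;> rfl⟩
  · exact nKp_anti _ _ fun i => Submodule.subset_span ⟨(![2, 0, 1] : Fin 3 → Fin 3) i, by fin_cases i <;> rfl⟩

lemma nKp_swp (A B C : NY → k) : nKp ![A, B, C] = nKp ![A, C, B] := by
  apply le_antisymm
  · exact nKp_anti _ _ fun i => Submodule.subset_span ⟨(![0, 2, 1] : Fin 3 → Fin 3) i, by fin_cases i <;> rfl⟩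
  · exact nKp_anti _ _ fun i => Submodule.subset_span ⟨(![0, 2, 1] : Fin 3 → Fin 3) i, by fin_cases i <;> rfl⟩

lemma nsj_subst (F : MvPolynomial NZ k) (z : Fin 3 → NY → k) (j : Fin 3) :
    ∃ f : MvPolynomial NY k, ∀ Y, eval Y f = nev (Function.update z j Y) F := by
  classical
  refine ⟨aeval (fun i : NZ => if i.1 = j then X i.2 else C (z i.1 i.2)) F, fun Y => ?_⟩
  have : ((eval Y).comp (aeval (fun i : NZ => if i.1 = j then X i.2 else C (z i.1 i.2))).toRingHom) =
      nev (Function.update z j Y) := by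
    apply MvPolynomial.ringHom_ext
    · intro r; simp [nev]
    · rintro ⟨i, s⟩
      by_cases h : i = j
      · subst h; simp [nev]
      · simp [nev, h]
  exact DFunLike.congr_fun this F

lemma nsj_choose [Infinite k] (F : MvPolynomial NZ k) (z1 z2 z3 : Fin 3 → NY → k) (j1 j2 j3 : Fin 3)
    (h1 : ∃ Y, nev (Function.update z1 j1 Y) F ≠ 0) (h2 : ∃ Y, nev (Function.update z2 j2 Y) F ≠ 0)
    (h3 : ∃ Y, nev (Function.update z3 j3 Y) F ≠ 0) :
    ∃ Y, nev (Function.update z1 j1 Y) F ≠ 0 ∧ nev (Function.update z2 j2 Y) F ≠ 0 ∧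
      nev (Function.update z3 j3 Y) F ≠ 0 := by
  obtain ⟨f1, e1⟩ := nsj_subst F z1 j1
  obtain ⟨f2, e2⟩ := nsj_subst F z2 j2
  obtain ⟨f3, e3⟩ := nsj_subst F z3 j3
  simp only [← e1, ← e2, ← e3] at *
  have ne : ∀ f : MvPolynomial NY k, (∃ Y, eval Y f ≠ 0) → f ≠ 0 := by
    rintro f ⟨Y, hY⟩ rfl
    simp at hY
  by_contra hcon
  push Not at hcon
  have : f1 * (f2 * f3) = 0 := by
    apply MvPolynomial.funext
    intro Y
    rw [map_mul, map_mul, map_zero]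
    by_cases a1 : eval Y f1 = 0
    · rw [a1, zero_mul]
    by_cases a2 : eval Y f2 = 0
    · rw [a2, zero_mul, mul_zero]
    rw [hcon Y a1 a2, mul_zero, mul_zero]
  exact mul_ne_zero (ne f1 h1) (mul_ne_zero (ne f2 h2) (ne f3 h3)) this

lemma nup0 (A B C Y : NY → k) : Function.update ![A, B, C] 0 Y = ![Y, B, C] := by
  funext i; fin_cases i <;> simp
lemma nup1 (A B C Y : NY → k) : Function.update ![A, B, C] 1 Y = ![A, Y, C] := by
  funext i; fin_cases i <;> simp
lemma nup2 (A B C Y : NY → k) : Function.update ![A, B, C] 2 Y = ![A, B, Y] := by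
  funext i; fin_cases i <;> simp

lemma nsj_dich [IsAlgClosed k] (h2 : (2 : k) ≠ 0) (h3 : (3 : k) ≠ 0) (z : Fin 3 → NY → k) (hz : ¬ nBad z) :
    nKp z = ⊥ := by
  have : Infinite k := IsAlgClosed.instInfinite
  obtain ⟨F, hF, P, Q, t0, ht0, t, ht, htF⟩ := nsj_line h2 h3
  have gb : ∀ z : Fin 3 → NY → k, nKp z = ⊥ → ¬ nBad z := by
    intro z hz; unfold nBad; rw [hz, finrank_bot]; decide
  have step : ∀ A B C C' : NY → k, nKp ![A, B, C] = ⊥ → nev ![A, B, C'] F ≠ 0 → nKp ![A, B, C'] = ⊥ := by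
    intro A B C C' hg hn
    refine nsj_engine h2 h3 F hF _ _ P Q t0 ht0 t ht htF A B C C' ?_ hg hn
    have hLI : LinearIndependent k ![A, B, C] := by
      by_contra hh
      exact gb _ hg (nsj_bad_dep h2 h3 _ hh)
    have := hLI.comp (![0, 1] : Fin 2 → Fin 3) (by decide)
    convert this using 1
    funext i; fin_cases i <;> rfl
  obtain ⟨A, B, C, rfl⟩ : ∃ A B C, z = ![A, B, C] := ⟨z 0, z 1, z 2, by funext i; fin_cases i <;> rfl⟩
  have good := nsj_good h2 h3
  have nb : ∀ z', nKp z' = nKp ![A, B, C] → nev z' F ≠ 0 := by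
    intro z' hz' h0
    have := hF z' h0
    unfold nBad at this hz
    rw [hz'] at this
    exact hz this
  obtain ⟨X, hX1, hX2, hX3⟩ := nsj_choose F ![nA0 k, nB0 k, 0] ![0, A, B] ![0, B, A] 2 0 0
    ⟨nCs k, by rw [nup2]; exact fun h => gb _ good (hF _ h)⟩
    ⟨C, by rw [nup0]; exact nb _ (by rw [nKp_rot])⟩
    ⟨C, by rw [nup0]; exact nb _ (by rw [nKp_swp, nKp_rot])⟩
  rw [nup2] at hX1
  rw [nup0] at hX2 hX3
  have g1 := step _ _ _ X good hX1
  rw [nKp_swp] at g1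
  obtain ⟨Y, hY1, hY2, -⟩ := nsj_choose F ![nA0 k, X, 0] ![X, 0, A] ![X, 0, A] 2 1 1
    ⟨nB0 k, by rw [nup2]; exact fun h => gb _ g1 (hF _ h)⟩
    ⟨B, by rw [nup1]; exact hX3⟩ ⟨B, by rw [nup1]; exact hX3⟩
  rw [nup2] at hY1
  rw [nup1] at hY2
  have g2 := step _ _ _ Y g1 hY1
  rw [nKp_rot] at g2
  have g3 := step _ _ _ A g2 hY2
  rw [nKp_swp] at g3
  have g4 := step _ _ _ B g3 hX2
  rw [nKp_rot] at g4
  exact step _ _ _ C g4 (nb _ rfl)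

lemma nsj_quad_coords (f : MvPolynomial (Fin 4) k) (hf : f.IsHomogeneous 2) :
    ∃ c : NY → k, f = ∑ s, c s • nver k s := by
  have key : f ∈ Submodule.span k (Set.range (nver k)) := by
    rw [f.as_sum]
    apply Submodule.sum_mem
    intro d hd
    have hdeg : d.degree = 2 := by
      have := hf (mem_support_iff.mp hd)
      rwa [Finsupp.degree_eq_weight_one]
    have hd' : ∃ x y, d = Finsupp.single x 1 + Finsupp.single y 1 := by
      have hc : Multiset.card (Finsupp.toMultiset d) = 2 := by
        rw [Finsupp.card_toMultiset, ← hdeg]; rfl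
      obtain ⟨x, y, hxy⟩ := Multiset.card_eq_two.mp hc
      refine ⟨x, y, Multiset.toFinsupp.symm.injective ?_⟩
      change Finsupp.toMultiset d = Finsupp.toMultiset _
      rw [hxy]; simp
    obtain ⟨x, y, rfl⟩ := hd'
    have : monomial (Finsupp.single x 1 + Finsupp.single y 1) (coeff (Finsupp.single x 1 + Finsupp.single y 1) f) =
        coeff (Finsupp.single x 1 + Finsupp.single y 1) f • nver k s(x, y) := by
      rw [nver_mk, X, X, monomial_mul, smul_monomial]; simp
    rw [this]
    exact Submodule.smul_mem _ _ (Submodule.subset_span ⟨_, rfl⟩)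
  obtain ⟨c, hc⟩ := (Submodule.mem_span_range_iff_exists_fun k).mp key
  exact ⟨c, hc.symm⟩

def nH (k : Type) [Field k] : MvPolynomial (Fin 4) k →ₗ[k] (NY → k) :=
  LinearMap.pi fun s => lcoeff k 0 ∘ₗ (pderiv ((![0,0,0,0,1,1,1,2,2,3] : Fin 10 → Fin 4) (nidx s))).toLinearMap ∘ₗ
    (pderiv ((![0,1,2,3,1,2,3,2,3,3] : Fin 10 → Fin 4) (nidx s))).toLinearMap

lemma nH_mk (f : MvPolynomial (Fin 4) k) (x y : Fin 4) (h : x ≤ y) :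
    nH k f s(x, y) = coeff 0 (pderiv x (pderiv y f)) := by
  fin_cases x <;> fin_cases y <;> first | exact absurd h (by decide) | rfl

lemma nH_inj (h2 : (2 : k) ≠ 0) (f : MvPolynomial (Fin 4) k) (hf : f.IsHomogeneous 2) (h : nH k f = 0) : f = 0 := by
  obtain ⟨c, rfl⟩ := nsj_quad_coords f hf
  have hc : c = 0 := by
    apply nsj_ext_NY
    intro x y hxy
    have := congrFun h s(x, y)
    rw [nH_mk _ _ _ hxy, nsj_sum_NY] at this
    simp only [nver_mk] at this
    fin_cases x <;> fin_cases y <;> first | exact absurd hxy (by decide) | skip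
    all_goals simp [pderiv_X, Derivation.leibniz] at this
    all_goals simp
    all_goals first | exact this | (apply mul_left_cancel₀ h2; linear_combination this)
  simp [hc]

lemma nsj_diffOp_lin (g : MvPolynomial (Fin 4) k) : ∃ T : MvPolynomial (Fin 4) k →ₗ[k] MvPolynomial (Fin 4) k,
    (∀ f, T f = diffOp f g) ∧ ∀ m, T (monomial m 1) = monD k m g := by
  refine ⟨Finsupp.linearCombination k (fun m => monD k m g) ∘ₗ (AddMonoidAlgebra.coeffLinearEquiv k).toLinearMap, ?_, ?_⟩
  · intro f; rfl
  · intro m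
    change Finsupp.linearCombination k (fun m => monD k m g) (Finsupp.single m 1) = _
    simp


lemma nsj_diffOp_H (a : NY → k) (g : MvPolynomial (Fin 4) k) :
    coeff 0 (diffOp (∑ s, a s • nver k s) g) = ∑ s, a s * nH k g s := by
  obtain ⟨T, hT1, hT2⟩ := nsj_diffOp_lin g
  rw [← hT1, map_sum, coeff_sum]
  refine Finset.sum_congr rfl fun s _ => ?_
  rw [map_smul, coeff_smul, smul_eq_mul]
  congr 1
  refine congrFun (?_ : (fun s => coeff 0 (T (nver k s))) = nH k g) s
  apply nsj_ext_NY
  intro x y hxy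
  rw [nH_mk _ _ _ hxy, nver_mk]
  have : (X x * X y : MvPolynomial (Fin 4) k) = monomial (Finsupp.single x 1 + Finsupp.single y 1) 1 := by
    rw [X, X, monomial_mul]; simp
  rw [this, hT2]
  fin_cases x <;> fin_cases y <;> first | exact absurd hxy (by decide) | skip
  all_goals simp [monD, Finsupp.single_apply, pow_two]

/-- **no single jump occurs.** For any 3-dimensional space `L` of
quadratic forms in `k[x₀,x₁,x₂,x₃]`: if some nonzero homogeneous cubic
`C ∈ k[y₀,…,y₆]` satisfies `C(q₀,…,q₆) = 0` for a basis `q₀,…,q₆` of `L^⊥`,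
then in fact `dim K(L) ≥ 3`. -/
theorem no_single_jump
    [IsAlgClosed k] (h2 : (2 : k) ≠ 0) (h3 : (3 : k) ≠ 0)
    (L : Submodule k (MvPolynomial (Fin 4) k))
    (hquad : L ≤ homogeneousSubmodule (Fin 4) k 2)
    (hdim : Module.finrank k L = 3)
    (q : Fin 7 → MvPolynomial (Fin 4) k) (hq : IsPerpBasis L q)
    (hjump : cubicRelations q ≠ ⊥) :
    3 ≤ Module.finrank k (cubicRelations q) := by
  classical
  obtain ⟨hqLI, hspan⟩ := hq
  have hqp : ∀ i, q i ∈ perpSet L := fun i => by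
    rw [← hspan]; exact Submodule.subset_span ⟨i, rfl⟩
  choose a ha using fun i => nsj_quad_coords (q i) (hqp i).1
  have hqa : q = nq a := funext ha
  have : Module.Finite k L := Module.finite_of_finrank_eq_succ hdim
  let b := Module.finBasisOfFinrankEq k L hdim
  let z : Fin 3 → NY → k := fun i => nH k (b i : MvPolynomial (Fin 4) k)
  have hz : LinearIndependent k z := by
    have hb : LinearIndependent k (fun i => (b i : MvPolynomial (Fin 4) k)) :=
      b.linearIndependent.map' L.subtype (Submodule.ker_subtype L)
    refine hb.map (f := nH k) ?_
    rw [Submodule.disjoint_def]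
    intro f hf hf0
    have hfL : f ∈ L := by
      refine (Submodule.span_le.mpr ?_ : _ ≤ L) hf
      rintro _ ⟨i, rfl⟩
      exact (b i).2
    exact nH_inj h2 f (hquad hfL) hf0
  have haLI : LinearIndependent k a := by
    apply LinearIndependent.of_comp (Fintype.linearCombination k (nver k))
    convert hqLI using 1
    funext i
    rw [ha i]
    simp [Fintype.linearCombination_apply]
  have haz : ∀ i j, ∑ s, a i s * z j s = 0 := by
    intro i j
    rw [← nsj_diffOp_H, ← ha i, (hqp i).2 _ (b j).2, coeff_zero]
  have hiso := nsj_iso h2 h3 z hz a haLI haz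
  rw [← hqa] at hiso
  by_contra hlt
  have hnb : ¬ nBad z := by
    unfold nBad; rw [← hiso]; exact hlt
  rw [nsj_dich h2 h3 z hnb, finrank_bot] at hiso
  exact hjump (Submodule.finrank_eq_zero.mp hiso)

end
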